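/- Let f be a homeomorphism of the torus ℝ²/ℤ² isotopic to the identity, with a lift F : ℝ² → ℝ² satisfying F(x + v) = F(x) + v for all x ∈ ℝ² and v ∈ ℤ². Let R ⊆ ℚ² be the set of rotation vectors of all cycles of f, i.e. the set of vectors w/q where q is a positive integer, w ∈ ℤ², and F^q(x) = x + w for some x ∈ ℝ². Then there exists a compact convex set C ⊆ ℝ² such that R ⊆ ℚ² ∩ C, and every point of (ℚ² ∩ C) \ R lies in the interior of some nondegenerate line segment contained in the boundary of C. That is, R equals the intersection of ℚ² with a compact convex set, except perhaps for some points from interiors of segments contained in the boundary of that set. -/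

import Mathlib

open Function

/-- The set of rotation vectors of all cycles of the torus homeomorphism with lift `F`:
vectors `(a/q, b/q)` with `q` a positive integer, `(a, b) ∈ ℤ²` and `F^[q] x = x + (a, b)`
for some `x ∈ ℝ²`. -/
def torusRotSet (F : ℝ × ℝ → ℝ × ℝ) : Set (ℚ × ℚ) :=
  {w | ∃ (q : ℕ) (a b : ℤ) (x : ℝ × ℝ), 0 < q ∧
        F^[q] x = x + ((a : ℝ), (b : ℝ)) ∧ w = ((a : ℚ) / q, (b : ℚ) / q)}

namespace FT

lemma lift_exp {E : Type*} [TopologicalSpace E] [SimplyConnectedSpace E]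
    [LocallyPathConnectedSpace E] (f : E → ℂ) (hf : Continuous f) (h0 : ∀ x, f x ≠ 0) :
    ∃ L : E → ℂ, Continuous L ∧ ∀ x, Complex.exp (L x) = f x := by
  have a : E := Classical.arbitrary E
  obtain ⟨L, ⟨-, hL⟩, -⟩ := Complex.isCoveringMapOn_exp.existsUnique_continuousMap_lifts
    ⟨f, hf⟩ (a₀ := a) (Complex.exp_log (h0 a)) (fun x => h0 x)
  exact ⟨L, L.continuous, fun x => congrFun hL x⟩

lemma lift_unique {E : Type*} [TopologicalSpace E] [PreconnectedSpace E] {f g : E → ℂ}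
    (hf : Continuous f) (hg : Continuous g) (h : ∀ x, Complex.exp (f x) = Complex.exp (g x))
    (a : E) (ha : f a = g a) (x : E) : f x = g x := by
  have := Complex.isCoveringMap_exp.eq_of_comp_eq hf hg
    (by ext y; exact h y) a ha
  exact congrFun this x

lemma lift_const {E : Type*} [TopologicalSpace E] [PreconnectedSpace E] {f : E → ℂ}
    (hf : Continuous f) (h : ∀ x, Complex.exp (f x) = 1) (x y : E) : f x = f y := by
  refine lift_unique (g := fun _ => f y) hf continuous_const (fun x => ?_) y rfl x
  rw [h, h]

/-- Orientation-preserving-type condition. -/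
def OP (G : ℂ → ℂ) : Prop := ∃ Λ : ℂ × ℂ → ℂ, ContinuousOn Λ {p | p.1 ≠ p.2} ∧
  ∀ p q, p ≠ q → Complex.exp (Λ (p, q)) = (G p - G q) / (p - q)

lemma OP.id : OP (fun z => z) :=
  ⟨fun _ => 0, continuousOn_const, fun p q h => by
    rw [div_self (sub_ne_zero.2 h)]; simp⟩

lemma OP.comp {H G : ℂ → ℂ} (hH : OP H) (hG : OP G) (hc : Continuous G) (hi : Injective G) :
    OP (fun z => H (G z)) := by
  obtain ⟨A, hA, hA'⟩ := hH
  obtain ⟨B, hB, hB'⟩ := hG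
  refine ⟨fun p => A (G p.1, G p.2) + B p, ?_, ?_⟩
  · refine ContinuousOn.add (hA.comp (f := fun p : ℂ × ℂ => (G p.1, G p.2)) (by fun_prop) ?_) hB
    intro p hp
    exact fun h => hp (hi h)
  · intro p q h
    have h1 : G p ≠ G q := fun e => h (hi e)
    rw [Complex.exp_add, hA' _ _ h1, hB' _ _ h, div_mul_div_cancel₀ (sub_ne_zero.2 h1)]

lemma OP.symm {G : ℂ ≃ₜ ℂ} (hG : OP G) : OP G.symm := by
  obtain ⟨B, hB, hB'⟩ := hG
  refine ⟨fun p => - B (G.symm p.1, G.symm p.2), ?_, ?_⟩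
  · refine ContinuousOn.neg (hB.comp (f := fun p : ℂ × ℂ => (G.symm p.1, G.symm p.2))
      (by fun_prop) ?_)
    intro p hp
    exact fun h => hp (G.symm.injective h)
  · intro p q h
    have h1 : G.symm p ≠ G.symm q := fun e => h (G.symm.injective e)
    rw [Complex.exp_neg, hB' _ _ h1]
    simp

lemma OP.trans {H G : ℂ ≃ₜ ℂ} (hH : OP H) (hG : OP G) : OP (G.trans H) :=
  OP.comp (H := H) (G := G) hH hG G.continuous G.injective

lemma OP.of_bdd (G : ℂ ≃ₜ ℂ) (M : ℝ) (hM : ∀ z, ‖G z - z‖ ≤ M) : OP G := by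
  obtain ⟨L, hL, hL'⟩ := lift_exp
    (fun p : ℂ × ℂ => (G (p.1 + Complex.exp p.2) - G p.1) / Complex.exp p.2)
    (by
      refine Continuous.div (by fun_prop) (by fun_prop) ?_
      intro x; exact Complex.exp_ne_zero _)
    (by
      intro p
      refine div_ne_zero (sub_ne_zero.2 fun h => ?_) (Complex.exp_ne_zero _)
      have := G.injective h
      simp [Complex.exp_ne_zero] at this)
  have hM0 : 0 ≤ M := (norm_nonneg _).trans (hM 0)
  -- monodromy
  have hmon : ∀ p : ℂ × ℂ, L (p.1, p.2 + 2 * Real.pi * Complex.I) = L p := by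
    have hc : ∀ p p' : ℂ × ℂ, L (p.1, p.2 + 2 * Real.pi * Complex.I) - L p =
        L (p'.1, p'.2 + 2 * Real.pi * Complex.I) - L p' := by
      intro p p'
      refine lift_const (f := fun p : ℂ × ℂ => L (p.1, p.2 + 2 * Real.pi * Complex.I) - L p)
        (by fun_prop) ?_ p p'
      intro x
      have h1 : Complex.exp (L x) ≠ 0 := Complex.exp_ne_zero _
      rw [Complex.exp_sub, hL', hL', Complex.exp_periodic, ← hL' x, div_self h1]
    obtain ⟨x0, hx0⟩ : ∃ x0 : ℝ, 4 * M + 1 = Real.exp x0 :=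
      ⟨Real.log (4 * M + 1), (Real.exp_log (by linarith)).symm⟩
    set r : ℝ → ℂ := fun t => (G (0 + Complex.exp (x0 + t * Complex.I)) - G 0) /
      Complex.exp (x0 + t * Complex.I) with hr
    have hre : ∀ t, r t ∈ Complex.slitPlane := by
      intro t
      set w := Complex.exp (x0 + t * Complex.I) with hw
      have hwn : ‖w‖ = 4 * M + 1 := by rw [hw, Complex.norm_exp, hx0]; simp
      have hw0 : w ≠ 0 := Complex.exp_ne_zero _
      have h1 : ‖r t - 1‖ < 1 := by
        have : r t - 1 = ((G (0 + w) - (0 + w)) - (G 0 - 0)) / w := by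
          rw [hr]; simp only [← hw]; field_simp; ring
        rw [this, norm_div, hwn, div_lt_one (by linarith)]
        calc _ ≤ ‖G (0 + w) - (0 + w)‖ + ‖G 0 - 0‖ := norm_sub_le _ _
          _ ≤ M + M := add_le_add (hM _) (hM _)
          _ < _ := by linarith
      left
      have := (Complex.abs_re_le_norm (r t - 1)).trans_lt h1
      rw [abs_lt] at this
      simp at this
      linarith
    have hrc : Continuous r := by
      refine Continuous.div (by fun_prop) (by fun_prop) ?_
      intro x; exact Complex.exp_ne_zero _
    have hper : r (2 * Real.pi) = r 0 := by
      have : Complex.exp (x0 + (2 * Real.pi : ℝ) * Complex.I) = Complex.exp (x0 + (0:ℝ) * Complex.I) := by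
        rw [show (x0 + (2 * Real.pi : ℝ) * Complex.I : ℂ) = (x0 + (0:ℝ) * Complex.I) + 2 * Real.pi * Complex.I by push_cast; ring]
        exact Complex.exp_periodic _
      simp only [hr]; rw [this]
    have hk := lift_const (f := fun t : ℝ => L (0, x0 + t * Complex.I) - Complex.log (r t))
      (by
        refine Continuous.sub (by fun_prop) ?_
        exact hrc.clog hre)
      (by
        intro t
        have h1 : r t ≠ 0 := Complex.slitPlane_ne_zero (hre t)
        rw [Complex.exp_sub, hL', Complex.exp_log h1]
        exact div_self h1) (2 * Real.pi) 0
    simp only [hper] at hk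
    intro p
    have := hc p (0, x0)
    have h2 : L (0, x0 + 2 * Real.pi * Complex.I) = L (0, x0) := by
      have := sub_left_inj.1 hk
      push_cast at this
      simpa using this
    simp only [h2, sub_self] at this
    exact sub_eq_zero.1 this
  have hmon2 : ∀ q a b : ℂ, Complex.exp a = Complex.exp b → L (q, a) = L (q, b) := by
    intro q a b hab
    obtain ⟨n, hn⟩ := Complex.exp_eq_exp_iff_exists_int.1 hab
    have hp : Periodic (fun z => L (q, z)) (2 * Real.pi * Complex.I) := fun z => hmon (q, z)
    rw [hn]
    exact hp.int_mul n b
  refine ⟨fun p => L (p.2, Complex.log (p.1 - p.2)), ?_, ?_⟩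
  · intro p hp
    have hne : p.1 - p.2 ≠ 0 := sub_ne_zero.2 hp
    refine ContinuousAt.continuousWithinAt ?_
    by_cases hs : p.1 - p.2 ∈ Complex.slitPlane
    · refine hL.continuousAt.comp (f := fun p : ℂ × ℂ => (p.2, Complex.log (p.1 - p.2))) ?_
      refine ContinuousAt.prodMk (by fun_prop) ?_
      exact ContinuousAt.clog (by fun_prop) hs
    · have hs' : -(p.1 - p.2) ∈ Complex.slitPlane := by
        rw [Complex.mem_slitPlane_iff] at hs ⊢
        push Not at hs
        left
        rcases hs.1.lt_or_eq with h | h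
        · simp only [Complex.neg_re]; linarith
        · exact absurd (Complex.ext h hs.2) hne
      have heq : (fun p : ℂ × ℂ => L (p.2, Complex.log (p.1 - p.2))) =ᶠ[nhds p]
          (fun p : ℂ × ℂ => L (p.2, Complex.log (-(p.1 - p.2)) + Real.pi * Complex.I)) := by
        have : ∀ᶠ x : ℂ × ℂ in nhds p, x.1 - x.2 ≠ 0 :=
          ContinuousAt.eventually_ne (g := fun x : ℂ × ℂ => x.1 - x.2) (by fun_prop) hne
        filter_upwards [this] with x hx
        apply hmon2
        rw [Complex.exp_log hx, Complex.exp_add, Complex.exp_log (neg_ne_zero.2 hx),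
          Complex.exp_pi_mul_I]; ring
      refine ContinuousAt.congr ?_ heq.symm
      refine hL.continuousAt.comp
        (f := fun p : ℂ × ℂ => (p.2, Complex.log (-(p.1 - p.2)) + Real.pi * Complex.I)) ?_
      refine ContinuousAt.prodMk (by fun_prop) ?_
      exact ContinuousAt.add (ContinuousAt.clog (f := fun p : ℂ × ℂ => -(p.1 - p.2)) (by fun_prop) hs')
        continuousAt_const
  · intro p q h
    simp only
    rw [hL']
    simp only
    rw [Complex.exp_log (sub_ne_zero.2 h)]
    simp

lemma OP.no_period_two {G : ℂ ≃ₜ ℂ} (hG : OP G) (hf : ∀ z, G z ≠ z) (x : ℂ) : G (G x) ≠ x := by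
  intro hx
  obtain ⟨L, hL, hL'⟩ := hG
  -- symmetry
  have hsym : ∀ p q, p ≠ q → L (p, q) = L (q, p) := by
    intro p q hpq
    set m := (p + q) / 2
    set d := (p - q) / 2 with hd
    have hd0 : d ≠ 0 := div_ne_zero (sub_ne_zero.2 hpq) two_ne_zero
    have hne : ∀ t : ℝ, m + Complex.exp (t * Complex.I) * d ≠ m - Complex.exp (t * Complex.I) * d := by
      intro t h
      have : Complex.exp (t * Complex.I) * d = 0 := by linear_combination h / 2
      exact mul_ne_zero (Complex.exp_ne_zero _) hd0 this
    set f : ℝ → ℂ := fun t => L (m + Complex.exp (t * Complex.I) * d, m - Complex.exp (t * Complex.I) * d) with hfd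
    set g : ℝ → ℂ := fun t => L (m - Complex.exp (t * Complex.I) * d, m + Complex.exp (t * Complex.I) * d) with hgd
    have hfc : Continuous f := hL.comp_continuous (by fun_prop) (fun t => hne t)
    have hgc : Continuous g := hL.comp_continuous (by fun_prop) (fun t => (hne t).symm)
    have hcon := lift_const (f := fun t => f t - g t) (hfc.sub hgc) (by
      intro t
      rw [Complex.exp_sub, hL' _ _ (hne t), hL' _ _ (hne t).symm]
      have h1 := sub_ne_zero.2 (hne t)
      have h2 := sub_ne_zero.2 (hne t).symm
      have h3 := sub_ne_zero.2 (G.injective.ne (hne t))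
      have h4 := sub_ne_zero.2 (G.injective.ne (hne t).symm)
      rw [div_div_div_eq, div_eq_one_iff_eq (mul_ne_zero h1 h4)]
      ring) Real.pi 0
    have hfp : f Real.pi = g 0 := by
      simp only [hfd, hgd, Complex.exp_pi_mul_I]; simp [sub_eq_add_neg]
    have hgp : g Real.pi = f 0 := by
      simp only [hfd, hgd, Complex.exp_pi_mul_I]; simp [sub_eq_add_neg]
    simp only [hfp, hgp] at hcon
    have h0 : f 0 = g 0 := by linear_combination (-1 / 2) * hcon
    have hp : m + d = p := by simp only [m, d]; ring
    have hq : m - d = q := by simp only [m, d]; ring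
    simp only [hfd, hgd] at h0
    simpa [hp, hq] using h0
  obtain ⟨ψ, hψ, hψ'⟩ := lift_exp (fun p => G p - p) (by fun_prop)
    (fun p => sub_ne_zero.2 (hf p))
  have hcon := lift_const (f := fun p => ψ (G p) - ψ p - L (G p, p))
    (by
      refine Continuous.sub (by fun_prop) ?_
      exact hL.comp_continuous (f := fun p => (G p, p)) (by fun_prop) (fun p => hf p))
    (by
      intro p
      have h1 := sub_ne_zero.2 (hf p)
      have h2 := sub_ne_zero.2 (hf (G p))
      rw [Complex.exp_sub, Complex.exp_sub, hψ', hψ', hL' _ _ (hf p)]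
      exact div_self (div_ne_zero h2 h1)) (G x) x
  simp only [hx] at hcon
  have hne := hf x
  rw [hsym _ _ hne] at hcon
  have h3 : ψ (G x) = ψ x := by linear_combination (-1 / 2) * hcon
  have h4 := hψ' (G x)
  have h5 := hψ' x
  rw [h3, h5, hx] at h4
  apply hne
  linear_combination h4 / 2

end FT

namespace FT

/-- support condition -/
def Supp (h : ℂ ≃ₜ ℂ) (U : Set ℂ) : Prop := ∀ z, z ∉ U → h z = z

lemma Supp.mem {h : ℂ ≃ₜ ℂ} {U : Set ℂ} (hs : Supp h U) {z : ℂ} (hz : z ∈ U) : h z ∈ U := by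
  by_contra hc
  have := h.injective (hs _ hc)
  rw [this] at hc
  exact hc hz

lemma push_local (x y : ℂ) (r : ℝ) (hr : ‖y - x‖ < r) :
    ∃ h : ℂ ≃ₜ ℂ, OP h ∧ Supp h (Metric.ball x r) ∧ h x = y := by
  have hr0 : 0 < r := (norm_nonneg _).trans_lt hr
  set g : ℂ → ℂ := fun z => ((max 0 (1 - ‖z - x‖ / r) : ℝ) : ℂ) * (y - x) with hg
  obtain ⟨c, hc⟩ : ∃ c : NNReal, (c : ℝ) = ‖y - x‖ / r :=
    ⟨Real.toNNReal (‖y - x‖ / r), Real.coe_toNNReal _ (by positivity)⟩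
  have hc1 : c < 1 := by
    rw [← NNReal.coe_lt_coe, hc, NNReal.coe_one]
    rwa [div_lt_one hr0]
  have hgl : ∀ p q, ‖g p - g q‖ ≤ c * ‖p - q‖ := by
    intro p q
    have h1 : g p - g q =
      ((max 0 (1 - ‖p - x‖ / r) - max 0 (1 - ‖q - x‖ / r) : ℝ) : ℂ) * (y - x) := by
      simp only [hg]; push_cast; ring
    rw [h1, norm_mul, Complex.norm_real, Real.norm_eq_abs]
    have h2 : |max 0 (1 - ‖p - x‖ / r) - max 0 (1 - ‖q - x‖ / r)| ≤ ‖p - q‖ / r := by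
      calc _ ≤ |(1 - ‖p - x‖ / r) - (1 - ‖q - x‖ / r)| := by
            refine (abs_max_sub_max_le_max _ _ _ _).trans ?_
            simp
        _ = |‖q - x‖ - ‖p - x‖| / r := by
          rw [← abs_of_pos hr0, ← abs_div, abs_of_pos hr0]; congr 1; ring
        _ ≤ ‖p - q‖ / r := by
          gcongr
          refine (abs_norm_sub_norm_le _ _).trans ?_
          rw [← norm_neg]; apply le_of_eq; congr 1; ring
    calc _ ≤ ‖p - q‖ / r * ‖y - x‖ := by gcongr
      _ = c * ‖p - q‖ := by rw [hc]; ring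
  have happ : ApproximatesLinearOn (fun z => z + g z)
      ((ContinuousLinearEquiv.refl ℝ ℂ : ℂ ≃L[ℝ] ℂ) : ℂ →L[ℝ] ℂ) Set.univ c := by
    intro p _ q _
    simp only [ContinuousLinearEquiv.coe_refl, ContinuousLinearMap.coe_id', id_eq]
    rw [show p + g p - (q + g q) - (p - q) = g p - g q by ring]
    exact hgl p q
  set h := happ.toHomeomorph _ (Or.inr (by
    refine hc1.trans_le ?_
    have : ‖((ContinuousLinearEquiv.refl ℝ ℂ).symm : ℂ →L[ℝ] ℂ)‖₊ = 1 := by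
      ext; exact ContinuousLinearMap.norm_id
    rw [this]; simp)) with hh
  have hval : ∀ z, h z = z + g z := fun z => rfl
  refine ⟨h, ?_, ?_, ?_⟩
  · have hs : ∀ p q : ℂ, p ≠ q → (h p - h q) / (p - q) ∈ Complex.slitPlane := by
      intro p q hpq
      have hn : 0 < ‖p - q‖ := norm_pos_iff.2 (sub_ne_zero.2 hpq)
      have h1 : ‖(h p - h q) / (p - q) - 1‖ < 1 := by
        have : (h p - h q) / (p - q) - 1 = (g p - g q) / (p - q) := by
          have := sub_ne_zero.2 hpq
          rw [hval, hval]; field_simp; ring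
        rw [this, norm_div, div_lt_one hn]
        calc _ ≤ c * ‖p - q‖ := hgl p q
          _ < 1 * ‖p - q‖ := by gcongr; exact_mod_cast hc1
          _ = _ := one_mul _
      left
      have := (Complex.abs_re_le_norm _).trans_lt h1
      rw [abs_lt] at this
      simp only [Complex.sub_re, Complex.one_re] at this
      linarith
    refine ⟨fun p => Complex.log ((h p.1 - h p.2) / (p.1 - p.2)), ?_, ?_⟩
    · refine ContinuousOn.clog ?_ (fun p hp => hs _ _ hp)
      refine ContinuousOn.div (by fun_prop) (by fun_prop) (fun p hp => sub_ne_zero.2 hp)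
    · intro p q hpq
      exact Complex.exp_log (Complex.slitPlane_ne_zero (hs p q hpq))
  · intro z hz
    rw [hval]
    simp only [Metric.mem_ball, not_lt, dist_eq_norm] at hz
    have : max 0 (1 - ‖z - x‖ / r) = 0 := by
      rw [max_eq_left]; rw [sub_nonpos, le_div_iff₀ hr0]; linarith
    simp [hg, this]
  · rw [hval]; simp [hg]

lemma push {U : Set ℂ} (hU : IsOpen U) (hc : IsPreconnected U) {x y : ℂ} (hx : x ∈ U) (hy : y ∈ U) :
    ∃ h : ℂ ≃ₜ ℂ, OP h ∧ Supp h U ∧ h x = y := by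
  refine hc.induction₂ (fun x y => ∃ h : ℂ ≃ₜ ℂ, OP h ∧ Supp h U ∧ h x = y) ?_ ?_ ?_ hx hy
  · intro x hx
    obtain ⟨r, hr, hrU⟩ := Metric.isOpen_iff.1 hU x hx
    refine Filter.Eventually.filter_mono nhdsWithin_le_nhds ?_
    filter_upwards [Metric.ball_mem_nhds x hr] with y hy
    obtain ⟨h, h1, h2, h3⟩ := push_local x y r (by simpa [dist_eq_norm] using hy)
    exact ⟨h, h1, fun z hz => h2 z (fun h => hz (hrU h)), h3⟩
  · rintro x y z hx hy hz ⟨h, h1, h2, h3⟩ ⟨k, k1, k2, k3⟩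
    refine ⟨h.trans k, OP.trans k1 h1, ?_, by simp [h3, k3]⟩
    intro w hw
    simp [h2 w hw, k2 w hw]
  · rintro x y hx hy ⟨h, h1, h2, h3⟩
    refine ⟨h.symm, OP.symm h1, ?_, by rw [← h3]; simp⟩
    intro w hw
    rw [Homeomorph.symm_apply_eq, h2 w hw]

/-- fixed point free OP homeos -/
def FPF (G : ℂ ≃ₜ ℂ) : Prop := OP G ∧ ∀ z, G z ≠ z

lemma FPF.symm {G : ℂ ≃ₜ ℂ} (hG : FPF G) : FPF G.symm :=
  ⟨OP.symm hG.1, fun z h => hG.2 z (by rw [Homeomorph.symm_apply_eq] at h; exact h.symm)⟩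

lemma FPF.post {G h : ℂ ≃ₜ ℂ} (hG : FPF G) {U : Set ℂ} (hf : ∀ z ∈ U, G z ∉ U) (hh : OP h)
    (hs : Supp h U) : FPF (G.trans h) := by
  refine ⟨OP.trans hh hG.1, fun z hz => ?_⟩
  simp only [Homeomorph.trans_apply] at hz
  by_cases hm : G z ∈ U
  · have := hs.mem hm
    rw [hz] at this
    exact hf z this hm
  · rw [hs _ hm] at hz
    exact hG.2 z hz

lemma FPF.pre {G h : ℂ ≃ₜ ℂ} (hG : FPF G) {U : Set ℂ} (hf : ∀ z ∈ U, G z ∉ U) (hh : OP h)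
    (hs : Supp h U) : FPF (h.trans G) := by
  refine ⟨OP.trans hG.1 hh, fun z hz => ?_⟩
  simp only [Homeomorph.trans_apply] at hz
  by_cases hm : z ∈ U
  · have := hf _ (hs.mem hm)
    rw [hz] at this
    exact this hm
  · rw [hs _ hm] at hz
    exact hG.2 z hz

lemma thin {K W : Set ℂ} (hK : IsCompact K) (hKc : IsPreconnected K) (hW : IsOpen W)
    (hKW : K ⊆ W) : ∃ U, IsOpen U ∧ IsPreconnected U ∧ K ⊆ U ∧ U ⊆ W := by
  obtain ⟨δ, hδ, hs⟩ := hK.exists_thickening_subset_open hW hKW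
  refine ⟨Metric.thickening δ K, Metric.isOpen_thickening, ?_, Metric.self_subset_thickening hδ K, hs⟩
  rcases K.eq_empty_or_nonempty with h | ⟨x0, hx0⟩
  · simp [h, isPreconnected_empty]
  refine isPreconnected_of_forall x0 ?_
  intro y hy
  rw [Metric.thickening_eq_biUnion_ball] at hy ⊢
  simp only [Set.mem_iUnion] at hy
  obtain ⟨x, hx, hy⟩ := hy
  refine ⟨K ∪ Metric.ball x δ, ?_, Or.inl hx0, Or.inr hy, ?_⟩
  · refine Set.union_subset ?_ ?_
    · intro z hz
      exact Set.mem_biUnion hz (Metric.mem_ball_self hδ)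
    · exact Set.subset_biUnion_of_mem (u := fun x => Metric.ball x δ) hx
  · exact IsPreconnected.union x hx (Metric.mem_ball_self hδ) hKc
      (convex_ball x δ).isPreconnected

/-- thin free neighbourhood, with an additional closed set A avoided, and additional set `B`
avoided by the image -/
lemma thin_free (G : ℂ ≃ₜ ℂ) {K A B : Set ℂ} (hK : IsCompact K) (hKc : IsPreconnected K)
    (hf : ∀ z ∈ K, G z ∉ K) (hA : IsClosed A) (hKA : ∀ z ∈ K, z ∉ A)
    (hB : IsClosed B) (hKB : ∀ z ∈ K, G z ∉ B) :
    ∃ U, IsOpen U ∧ IsPreconnected U ∧ K ⊆ U ∧ (∀ z ∈ U, G z ∉ U) ∧ (∀ z ∈ U, z ∉ A) ∧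
      (∀ z ∈ U, G z ∉ B) := by
  have hd : Disjoint K (G '' K) := by
    rw [Set.disjoint_left]
    rintro z hz ⟨w, hw, rfl⟩
    exact hf w hw hz
  obtain ⟨V1, V2, o1, o2, s1, s2, d⟩ := SeparatedNhds.of_isCompact_isCompact hK (hK.image G.continuous) hd
  obtain ⟨U, u1, u2, u3, u4⟩ := thin hK hKc
    (W := (V1 ∩ G ⁻¹' V2) ∩ (Aᶜ ∩ G ⁻¹' Bᶜ))
    ((o1.inter (o2.preimage G.continuous)).inter
      (hA.isOpen_compl.inter (hB.isOpen_compl.preimage G.continuous)))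
    (fun z hz => ⟨⟨s1 hz, s2 ⟨z, hz, rfl⟩⟩, hKA z hz, hKB z hz⟩)
  refine ⟨U, u1, u2, u3, ?_, fun z hz => (u4 hz).2.1, fun z hz => (u4 hz).2.2⟩
  intro z hz hz'
  exact Set.disjoint_left.1 d (u4 hz').1.1 (u4 hz).1.2

lemma iter_eq_of {f g : ℂ → ℂ} {x : ℂ} {k : ℕ} (h : ∀ j < k, g (f^[j] x) = f (f^[j] x)) :
    ∀ j ≤ k, g^[j] x = f^[j] x := by
  intro j hj
  induction j with
  | zero => rfl
  | succ j ih =>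
    rw [iterate_succ_apply', iterate_succ_apply', ih (by omega), h j (by omega)]

/-- (F): compact connected free sets are free for smaller iterates -/
lemma free_iter {n : ℕ} (IH : ∀ k, 1 ≤ k → k < n → ∀ G : ℂ ≃ₜ ℂ, FPF G → ∀ x, G^[k] x ≠ x)
    {G : ℂ ≃ₜ ℂ} (hG : FPF G) {K : Set ℂ} (hK : IsCompact K) (hKc : IsPreconnected K)
    (hf : ∀ z ∈ K, G z ∉ K) : ∀ k, 1 ≤ k → k < n → ∀ z ∈ K, G^[k] z ∉ K := by
  intro k
  induction k using Nat.strong_induction_on with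
  | _ k ih =>
  intro hk1 hkn z hz hzk
  have hav : ∀ j, 1 ≤ j → j < k → G^[j] z ∉ K := fun j h1 h2 => ih j h2 h1 (by omega) z hz
  obtain ⟨U, u1, u2, u3, u4, u5, -⟩ := thin_free G hK hKc hf
    (A := (fun j => G^[j] z) '' (Set.Ico 1 k)) (B := ∅)
    (((Set.finite_Ico 1 k).image _).isClosed)
    (by
      rintro w hw ⟨j, hj, rfl⟩
      exact hav j hj.1 hj.2 hw) isClosed_empty (by simp)
  obtain ⟨h, h1, h2, h3⟩ := push u1 u2 (u3 hzk) (u3 hz)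
  have hF := hG.post u4 h1 h2
  obtain ⟨m, rfl⟩ : ∃ m, k = m + 1 := ⟨k - 1, by omega⟩
  have key : ∀ j ≤ m, (G.trans h)^[j] z = G^[j] z := by
    apply iter_eq_of
    intro j hj
    simp only [Homeomorph.trans_apply]
    apply h2
    intro hm
    rw [← iterate_succ_apply' (f := G)] at hm
    exact u5 _ hm ⟨j + 1, ⟨by omega, by omega⟩, rfl⟩
  refine IH (m + 1) hk1 hkn _ hF z ?_
  rw [iterate_succ_apply', key m le_rfl]
  simp only [Homeomorph.trans_apply]
  rw [← iterate_succ_apply' (f := G), h3]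

lemma arc_case {n : ℕ} (hn : 3 ≤ n)
    (IH : ∀ k, 1 ≤ k → k < n → ∀ G : ℂ ≃ₜ ℂ, FPF G → ∀ x, G^[k] x ≠ x)
    {G : ℂ ≃ₜ ℂ} (hG : FPF G) (γ : ℝ → ℂ) (hγ : Continuous γ) (hi : Injective γ)
    (hper : G^[n] (γ 0) = γ 0) (s T : ℝ) (hs : 0 ≤ s) (hsT : s < T) (hcol : G (γ s) = γ T)
    (hmin : ∀ a b, 0 ≤ a → a ≤ T → 0 ≤ b → b ≤ T → G (γ a) = γ b → a = T ∨ b = T) : False := by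
  -- free segments
  have hcpt : ∀ a b : ℝ, IsCompact (γ '' Set.Icc a b) := fun a b => isCompact_Icc.image hγ
  have hcon : ∀ a b : ℝ, IsPreconnected (γ '' Set.Icc a b) :=
    fun a b => isPreconnected_Icc.image _ hγ.continuousOn
  have hfree : ∀ c, c < T → ∀ z ∈ γ '' Set.Icc 0 c, G z ∉ γ '' Set.Icc 0 c := by
    rintro c hc _ ⟨a, ha, rfl⟩ ⟨b, hb, hab⟩
    rcases hmin a b ha.1 (by linarith [ha.2]) hb.1 (by linarith [hb.2]) hab.symm with h | h
    · linarith [ha.2]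
    · linarith [hb.2]
  have hF : ∀ k a b, 1 ≤ k → k < n → 0 ≤ a → a < T → 0 ≤ b → b < T → G^[k] (γ a) ≠ γ b := by
    intro k a b hk hkn ha haT hb hbT h
    refine free_iter IH hG (hcpt 0 (max a b)) (hcon 0 (max a b)) (hfree _ (max_lt haT hbT)) k hk hkn
      (γ a) ⟨a, ⟨ha, le_max_left _ _⟩, rfl⟩ ?_
    rw [h]
    exact ⟨b, ⟨hb, le_max_right _ _⟩, rfl⟩
  -- uniqueness of the collision
  have huniq : ∀ a b, 0 ≤ a → a ≤ T → 0 ≤ b → b ≤ T → G (γ a) = γ b → a = s ∧ b = T := by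
    intro a b ha haT hb hbT h
    rcases hmin a b ha haT hb hbT h with h1 | h1
    · exfalso
      subst h1
      rcases hbT.lt_or_eq with h2 | h2
      · exact hF 2 s b (by omega) (by omega) hs hsT hb h2 (by
          change G (G (γ s)) = γ b
          rw [hcol, h])
      · rw [h2] at h; exact hG.2 _ h
    · subst h1
      exact ⟨hi (G.injective (h.trans hcol.symm)), rfl⟩
  obtain ⟨T', hT1, hT2⟩ := exists_between hsT
  set E := G '' (γ '' Set.Icc 0 s) ∪ γ '' Set.Icc T' T with hE
  have hEc : IsCompact E := ((hcpt 0 s).image G.continuous).union (hcpt T' T)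
  have hEp : IsPreconnected E := IsPreconnected.union (γ T)
    ⟨γ s, ⟨s, ⟨hs, le_rfl⟩, rfl⟩, hcol⟩ ⟨T, ⟨hT2.le, le_rfl⟩, rfl⟩
    ((hcon 0 s).image _ G.continuous.continuousOn) (hcon T' T)
  have hGG : ∀ a b, 0 ≤ a → a ≤ s → 0 ≤ b → b ≤ T → G (G (γ a)) ≠ γ b := by
    intro a b ha has hb hbT h
    rcases hbT.lt_or_eq with h2 | h2
    · exact hF 2 a b (by omega) (by omega) ha (by linarith) hb h2 h
    · rw [h2, ← hcol] at h
      have := huniq a s ha (by linarith) hs hsT.le (G.injective h)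
      linarith [this.2]
  have hEf : ∀ z ∈ E, G z ∉ E := by
    rintro z (⟨_, ⟨a, ha, rfl⟩, rfl⟩ | ⟨a, ha, rfl⟩) (⟨_, ⟨b, hb, rfl⟩, h⟩ | ⟨b, hb, h⟩)
    · have := huniq a b ha.1 (by linarith [ha.2]) hb.1 (by linarith [hb.2]) (G.injective h).symm
      linarith [this.2, hb.2]
    · exact hGG a b ha.1 ha.2 (by linarith [hb.1]) hb.2 h.symm
    · have := hi (G.injective h)
      linarith [ha.1, hb.2]
    · have := huniq a b (by linarith [ha.1]) ha.2 (by linarith [hb.1]) hb.2 h.symm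
      linarith [this.1, ha.1]
  have horb : ∀ k, 2 ≤ k → k < n → G^[k] (γ 0) ∉ E := by
    have h1 : ∀ k, 2 ≤ k → k < n → G^[k] (γ 0) ∉ G '' (γ '' Set.Icc 0 s) := by
      rintro k hk hkn ⟨_, ⟨a, ha, rfl⟩, h⟩
      obtain ⟨m, rfl⟩ : ∃ m, k = m + 1 := ⟨k - 1, by omega⟩
      rw [iterate_succ_apply'] at h
      exact hF m 0 a (by omega) (by omega) le_rfl (by linarith) ha.1 (by linarith [ha.2])
        (G.injective h).symm
    rintro k hk hkn (h | ⟨b, hb, h⟩)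
    · exact h1 k hk hkn h
    · rcases hb.2.lt_or_eq with h2 | h2
      · exact hF k 0 b (by omega) (by omega) le_rfl (by linarith) (by linarith [hb.1]) h2 h.symm
      · rw [h2] at h
        exact h1 k hk hkn (h ▸ ⟨γ s, ⟨s, ⟨hs, le_rfl⟩, rfl⟩, hcol⟩)
  obtain ⟨U, u1, u2, u3, u4, u5, u6⟩ := thin_free G hEc hEp hEf
    (A := (fun j => G^[j] (γ 0)) '' (Set.Ico 2 n)) (B := γ '' Set.Icc 0 T')
    (((Set.finite_Ico 2 n).image _).isClosed)
    (by
      rintro w hw ⟨j, hj, rfl⟩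
      exact horb j hj.1 hj.2 hw) (hcpt _ _).isClosed
    (by
      rintro z (⟨_, ⟨a, ha, rfl⟩, rfl⟩ | ⟨a, ha, rfl⟩) ⟨b, hb, h⟩
      · exact hGG a b ha.1 ha.2 hb.1 (by linarith [hb.2]) h.symm
      · have := huniq a b (by linarith [ha.1]) ha.2 hb.1 (by linarith [hb.2]) h.symm
        linarith [this.2, hb.2])
  have hw : γ T' ∈ U := u3 (Or.inr ⟨T', ⟨le_rfl, hT2.le⟩, rfl⟩)
  have hx1 : G (γ 0) ∈ U := u3 (Or.inl ⟨γ 0, ⟨0, ⟨le_rfl, hs⟩, rfl⟩, rfl⟩)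
  obtain ⟨l, l1, l2, l3⟩ := push u1 u2 hw hx1
  have hG1 := hG.pre u4 l1 l2
  have hKf : ∀ z ∈ γ '' Set.Icc 0 T', (l.trans G) z ∉ γ '' Set.Icc 0 T' := by
    intro z hz
    simp only [Homeomorph.trans_apply]
    by_cases hm : z ∈ U
    · exact u6 _ (l2.mem hm)
    · rw [l2 z hm]; exact hfree T' hT2 z hz
  refine free_iter IH hG1 (hcpt 0 T') (hcon 0 T') hKf (n - 1) (by omega) (by omega) (γ T')
    ⟨T', ⟨by linarith, le_rfl⟩, rfl⟩ ?_
  have key : ∀ j, 1 ≤ j → j < n → (l.trans G)^[j] (γ T') = G^[j+1] (γ 0) := by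
    intro j hj
    induction j, hj using Nat.le_induction with
    | base =>
      intro _
      simp [l3]
    | succ j hj ih =>
      intro hjn
      rw [iterate_succ_apply', ih (by omega), iterate_succ_apply' (f := G) (n := j + 1)]
      simp only [Homeomorph.trans_apply]
      rw [l2]
      intro hm
      exact u5 _ hm ⟨j + 1, ⟨by omega, by omega⟩, rfl⟩
  rw [key (n - 1) (by omega) (by omega), show n - 1 + 1 = n by omega, hper]
  exact ⟨0, ⟨le_rfl, by linarith⟩, rfl⟩

/-- Brouwer: no periodic points. -/
lemma FPF.no_periodic : ∀ n, 1 ≤ n → ∀ G : ℂ ≃ₜ ℂ, FPF G → ∀ x, G^[n] x ≠ x := by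
  intro n
  induction n using Nat.strong_induction_on with
  | _ n ih =>
  intro hn1 G hG x0 hx0
  have IH : ∀ k, 1 ≤ k → k < n → ∀ G : ℂ ≃ₜ ℂ, FPF G → ∀ x, G^[k] x ≠ x :=
    fun k h1 h2 => ih k h2 h1
  rcases (by omega : n = 1 ∨ n = 2 ∨ 3 ≤ n) with rfl | rfl | hn
  · exact hG.2 x0 hx0
  · exact hG.1.no_period_two hG.2 x0 hx0
  set d := G x0 - x0 with hd
  have hd0 : d ≠ 0 := sub_ne_zero.2 (hG.2 x0)
  set γ : ℝ → ℂ := fun t => x0 + t * d with hγd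
  have hγ : Continuous γ := by fun_prop
  have hi : Injective γ := by
    intro a b h
    simp only [hγd, add_right_inj, mul_eq_mul_right_iff, hd0, or_false] at h
    exact_mod_cast h
  have h0 : γ 0 = x0 := by simp [hγd]
  have h1 : γ 1 = G x0 := by simp [hγd, hd]
  set Z : Set (ℝ × ℝ) := (Set.Icc 0 1 ×ˢ Set.Icc 0 1) ∩ {p | G (γ p.1) = γ p.2} with hZ
  have hZc : IsCompact Z := (isCompact_Icc.prod isCompact_Icc).inter_right
    (isClosed_eq (by fun_prop) (by fun_prop))
  obtain ⟨⟨s, t⟩, hst, hm⟩ := hZc.exists_isMinOn (f := fun p : ℝ × ℝ => max p.1 p.2)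
    ⟨(0, 1), by simp [hZ, h0, h1]⟩ (by fun_prop)
  have hmin : ∀ a b, 0 ≤ a → a ≤ max s t → 0 ≤ b → b ≤ max s t → G (γ a) = γ b →
      a = max s t ∨ b = max s t := by
    intro a b ha ha' hb hb' h
    have hle : max s t ≤ 1 := max_le hst.1.1.2 hst.1.2.2
    have : max s t ≤ max a b :=
      hm (show (a, b) ∈ Z from ⟨⟨⟨ha, ha'.trans hle⟩, ⟨hb, hb'.trans hle⟩⟩, h⟩)
    rcases le_total a b with h2 | h2
    · rw [max_eq_right h2] at this; right; exact le_antisymm hb' this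
    · rw [max_eq_left h2] at this; left; exact le_antisymm ha' this
  have hst2 : G (γ s) = γ t := hst.2
  rcases lt_trichotomy s t with h | h | h
  · rw [max_eq_right h.le] at hmin
    exact arc_case hn IH hG γ hγ hi (by rw [h0]; exact hx0) s t hst.1.1.1 h hst2 hmin
  · rw [h] at hst2; exact hG.2 _ hst2
  · rw [max_eq_left h.le] at hmin
    refine arc_case hn IH hG.symm γ hγ hi ?_ t s hst.1.2.1 h (by rw [← hst2]; simp) ?_
    · rw [h0]
      have : LeftInverse (G.symm)^[n] G^[n] := LeftInverse.iterate G.symm_apply_apply n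
      rw [← hx0, this x0, hx0]
    · intro a b ha ha' hb hb' hab
      rw [Homeomorph.symm_apply_eq] at hab
      exact (hmin b a hb hb' ha ha' hab.symm).symm

lemma tg_path {ι : Type*} {r : ι → ι → Prop} {a b : ι} (h : Relation.TransGen r a b) :
    ∃ n : ℕ, 0 < n ∧ ∃ c : ℕ → ι, c 0 = a ∧ c n = b ∧ ∀ i < n, r (c i) (c (i + 1)) := by
  induction h with
  | @single b h => exact ⟨1, one_pos, fun i => if i = 0 then a else b, by simp, by simp, by
      intro i hi
      have : i = 0 := by omega
      simpa [this] using h⟩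
  | @tail b d h1 h2 ih =>
    obtain ⟨n, hn, c, c0, cn, hc⟩ := ih
    refine ⟨n + 1, by omega, fun i => if i ≤ n then c i else d, by simp [c0], by simp, ?_⟩
    intro i hi
    by_cases h : i + 1 ≤ n
    · simp only [h, if_true, show i ≤ n by omega]; exact hc i (by omega)
    · have : i = n := by omega
      subst this
      simp [cn, h2]

/-- Franks lemma -/
lemma franks {ι : Type*} {G : ℂ ≃ₜ ℂ} (hG : FPF G) (U : ι → Set ℂ) (ho : ∀ i, IsOpen (U i))
    (hp : ∀ i, IsPreconnected (U i)) (hdis : ∀ i j, i ≠ j → Disjoint (U i) (U j))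
    (hfree : ∀ i, ∀ z ∈ U i, G z ∉ U i) (b : ι) :
    ¬ Relation.TransGen (fun i j => ∃ z ∈ U i, G z ∈ U j) b b := by
  intro hb
  set r := (fun i j => ∃ z ∈ U i, G z ∈ U j) with hr
  have hex : ∃ n : ℕ, 0 < n ∧ ∃ c : ℕ → ι, c n = c 0 ∧ ∀ i < n, r (c i) (c (i + 1)) := by
    obtain ⟨n, hn, c, c0, cn, hc⟩ := tg_path hb
    exact ⟨n, hn, c, by rw [c0, cn], hc⟩
  classical
  obtain ⟨hn, c, c0, hc⟩ := Nat.find_spec hex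
  have hmin := fun m => Nat.find_min hex (m := m)
  set n := Nat.find hex with hnd
  have hinj : ∀ i j, i < j → j < n → c i ≠ c j := by
    intro i j hij hjn h
    refine hmin (j - i) (by omega) ⟨by omega, fun k => c (i + k), ?_, ?_⟩
    · simp [show i + (j - i) = j by omega, h]
    · intro k hk
      exact hc (i + k) (by omega)
  choose! x hx hx' using hc
  -- y i
  set y : ℕ → ℂ := fun i => if i = 0 then G (x (n - 1)) else G (x (i - 1)) with hy
  have hyU : ∀ i < n, y i ∈ U (c i) := by
    intro i hi
    by_cases h0 : i = 0
    · subst h0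
      simp only [hy, if_true]
      have := hx' (n - 1) (by omega)
      rwa [show n - 1 + 1 = n by omega, c0] at this
    · simp only [hy, h0, if_false]
      have := hx' (i - 1) (by omega)
      rwa [show i - 1 + 1 = i by omega] at this
  have hpush : ∀ m ≤ n, ∃ h : ℂ ≃ₜ ℂ, OP h ∧
      (∀ z, h z = z ∨ ∃ i < m, z ∈ U (c i) ∧ h z ∈ U (c i)) ∧ ∀ i < m, h (y i) = x i := by
    intro m
    induction m with
    | zero =>
      intro _
      exact ⟨Homeomorph.refl ℂ, OP.id, fun z => Or.inl rfl, by simp⟩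
    | succ m ih =>
      intro hm
      obtain ⟨h, h1, h2, h3⟩ := ih (by omega)
      obtain ⟨k, k1, k2, k3⟩ := push (ho (c m)) (hp (c m)) (hyU m (by omega)) (hx m (by omega))
      have hd : ∀ i < m, ∀ z, z ∈ U (c i) → z ∉ U (c m) := fun i hi z hz hz' =>
        Set.disjoint_left.1 (hdis _ _ (hinj i m hi (by omega))) hz hz'
      refine ⟨h.trans k, OP.trans k1 h1, ?_, ?_⟩
      · intro z
        simp only [Homeomorph.trans_apply]
        rcases h2 z with e | ⟨i, hi, e1, e2⟩
        · rw [e]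
          by_cases hz : z ∈ U (c m)
          · exact Or.inr ⟨m, by omega, hz, k2.mem hz⟩
          · exact Or.inl (k2 z hz)
        · rw [k2 _ (hd i hi _ e2)]
          exact Or.inr ⟨i, by omega, e1, e2⟩
      · intro i hi
        simp only [Homeomorph.trans_apply]
        rcases Nat.lt_succ_iff_lt_or_eq.1 hi with h' | rfl
        · rw [h3 i h', k2 _ (hd i h' _ (hx i (by omega)))]
        · rcases h2 (y i) with e | ⟨j, hj, e1, e2⟩
          · rw [e, k3]
          · exact absurd (hyU i (by omega)) (hd j hj _ e1)
  obtain ⟨h, h1, h2, h3⟩ := hpush n le_rfl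
  have hF : FPF (G.trans h) := by
    refine ⟨OP.trans h1 hG.1, fun z hz => ?_⟩
    simp only [Homeomorph.trans_apply] at hz
    rcases h2 (G z) with e | ⟨i, hi, e1, e2⟩
    · rw [e] at hz; exact hG.2 z hz
    · rw [hz] at e2; exact hfree _ z e2 e1
  have key : ∀ j < n, (G.trans h)^[j] (x 0) = x j := by
    intro j hj
    induction j with
    | zero => rfl
    | succ j ih =>
      rw [iterate_succ_apply', ih (by omega)]
      simp only [Homeomorph.trans_apply]
      have := h3 (j + 1) hj
      simpa [hy] using this
  refine FPF.no_periodic n hn _ hF (x 0) ?_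
  conv_lhs => rw [show n = (n - 1) + 1 by omega]
  rw [iterate_succ_apply', key (n - 1) (by omega)]
  have := h3 0 hn
  simpa [hy] using this

end FT

namespace FT

/-- closed cells of the brick tiling -/
def cell (c : ℤ × ℤ) : Set ℂ :=
  {z | ((c.2 : ℝ) ≤ z.im ∧ z.im ≤ c.2 + 1) ∧
    ((c.1 : ℝ) ≤ z.re + (z.im - c.2) / 2 ∧ z.re + (z.im - c.2) / 2 ≤ c.1 + 1)}

/-- open cells -/
def ocell (c : ℤ × ℤ) : Set ℂ :=
  {z | ((c.2 : ℝ) < z.im ∧ z.im < c.2 + 1) ∧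
    ((c.1 : ℝ) < z.re + (z.im - c.2) / 2 ∧ z.re + (z.im - c.2) / 2 < c.1 + 1)}

/-- lattice embedding -/
def emb (c : ℤ × ℤ) : ℂ := ⟨c.1, c.2⟩

lemma emb_add (c d : ℤ × ℤ) : emb (c + d) = emb c + emb d := by
  apply Complex.ext <;> simp [emb]

lemma emb_neg (c : ℤ × ℤ) : emb (-c) = - emb c := by
  apply Complex.ext <;> simp [emb]

lemma mem_cell_add {z : ℂ} {c : ℤ × ℤ} (l : ℤ × ℤ) : z + emb l ∈ cell (c + l) ↔ z ∈ cell c := by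
  simp only [cell, emb, Set.mem_ofPred_eq, Complex.add_im, Complex.add_re, Prod.fst_add,
    Prod.snd_add, Int.cast_add]
  constructor <;> rintro ⟨⟨h1, h2⟩, h3, h4⟩ <;>
    exact ⟨⟨by linarith, by linarith⟩, by linarith, by linarith⟩

lemma mem_ocell_add {z : ℂ} {c : ℤ × ℤ} (l : ℤ × ℤ) : z + emb l ∈ ocell (c + l) ↔ z ∈ ocell c := by
  simp only [ocell, emb, Set.mem_ofPred_eq, Complex.add_im, Complex.add_re, Prod.fst_add,
    Prod.snd_add, Int.cast_add]
  constructor <;> rintro ⟨⟨h1, h2⟩, h3, h4⟩ <;>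
    exact ⟨⟨by linarith, by linarith⟩, by linarith, by linarith⟩

lemma isClosed_cell (c : ℤ × ℤ) : IsClosed (cell c) := by
  have hr := Complex.continuous_re
  have hi := Complex.continuous_im
  exact ((isClosed_le continuous_const hi).inter (isClosed_le hi continuous_const)).inter
    ((isClosed_le continuous_const (hr.add ((hi.sub continuous_const).div_const 2))).inter
    (isClosed_le (hr.add ((hi.sub continuous_const).div_const 2)) continuous_const))

lemma isOpen_ocell (c : ℤ × ℤ) : IsOpen (ocell c) := by
  have hr := Complex.continuous_re
  have hi := Complex.continuous_im
  exact ((isOpen_lt continuous_const hi).inter (isOpen_lt hi continuous_const)).inter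
    ((isOpen_lt continuous_const (hr.add ((hi.sub continuous_const).div_const 2))).inter
    (isOpen_lt (hr.add ((hi.sub continuous_const).div_const 2)) continuous_const))

lemma ocell_subset (c : ℤ × ℤ) : ocell c ⊆ cell c :=
  fun _ h => ⟨⟨h.1.1.le, h.1.2.le⟩, h.2.1.le, h.2.2.le⟩

lemma convex_ocell (c : ℤ × ℤ) : Convex ℝ (ocell c) := by
  intro x hx y hy a b ha hb hab
  obtain ⟨⟨h1, h2⟩, h3, h4⟩ := hx
  obtain ⟨⟨k1, k2⟩, k3, k4⟩ := hy
  have hb' : b = 1 - a := by linarith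
  subst hb'
  simp only [ocell, Set.mem_ofPred_eq, Complex.add_im, Complex.add_re, Complex.real_smul,
    Complex.mul_re, Complex.mul_im, Complex.ofReal_re, Complex.ofReal_im, zero_mul, sub_zero, add_zero]
  rcases ha.eq_or_lt with h | h
  · subst h; refine ⟨⟨?_, ?_⟩, ?_, ?_⟩ <;> linarith
  · refine ⟨⟨?_, ?_⟩, ?_, ?_⟩ <;> nlinarith

lemma cell_cover (z : ℂ) : ∃ c, z ∈ cell c := by
  refine ⟨(⌊z.re + (z.im - ⌊z.im⌋) / 2⌋, ⌊z.im⌋), ⟨⟨Int.floor_le _, ?_⟩, Int.floor_le _, ?_⟩⟩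
  · exact (Int.lt_floor_add_one _).le
  · exact (Int.lt_floor_add_one _).le

lemma cell_eq_of {z : ℂ} {c d : ℤ × ℤ} (h : z ∈ ocell c) (k : z ∈ cell d) : c = d := by
  obtain ⟨⟨h1, h2⟩, h3, h4⟩ := h
  obtain ⟨⟨k1, k2⟩, k3, k4⟩ := k
  have e2 : c.2 = d.2 := by
    have a1 : (c.2 : ℝ) < d.2 + 1 := by linarith
    have a2 : (d.2 : ℝ) < c.2 + 1 := by linarith
    norm_cast at a1 a2; omega
  rw [← e2] at k3 k4
  have e1 : c.1 = d.1 := by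
    have a1 : (c.1 : ℝ) < d.1 + 1 := by linarith
    have a2 : (d.1 : ℝ) < c.1 + 1 := by linarith
    norm_cast at a1 a2; omega
  exact Prod.ext e1 e2

lemma cell_subset_closure (c : ℤ × ℤ) : cell c ⊆ closure (ocell c) := by
  intro z hz
  set m : ℂ := ⟨c.1 + 1 / 4, c.2 + 1 / 2⟩ with hm
  have ht : Filter.Tendsto (fun t : ℝ => z + t * (m - z)) (nhdsWithin 0 (Set.Ioi 0)) (nhds z) := by
    have : Continuous (fun t : ℝ => z + t * (m - z)) := by fun_prop
    have h2 := this.tendsto 0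
    simp only [Complex.ofReal_zero, zero_mul, add_zero] at h2
    exact h2.mono_left nhdsWithin_le_nhds
  refine mem_closure_of_tendsto ht ?_
  filter_upwards [Ioo_mem_nhdsGT (show (0:ℝ) < 1 by norm_num)] with t ht
  obtain ⟨t0, t1⟩ := ht
  obtain ⟨⟨h1, h2⟩, h3, h4⟩ := hz
  simp only [ocell, hm, Set.mem_ofPred_eq, Complex.add_im, Complex.add_re,
    Complex.mul_re, Complex.mul_im, Complex.ofReal_re, Complex.ofReal_im, zero_mul, sub_zero, add_zero,
    Complex.sub_re, Complex.sub_im]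
  refine ⟨⟨?_, ?_⟩, ?_, ?_⟩ <;> nlinarith

lemma cell_meets {c : ℤ × ℤ} {z : ℂ} (hz : z ∈ cell c) {N : Set ℂ} (hN : IsOpen N) (hzN : z ∈ N) :
    ∃ w ∈ N, w ∈ ocell c :=
  mem_closure_iff.1 (cell_subset_closure c hz) N hN hzN

lemma ocell_nonempty (c : ℤ × ℤ) : (ocell c).Nonempty :=
  ⟨⟨c.1 + 1 / 4, c.2 + 1 / 2⟩, by
    simp only [ocell, Set.mem_ofPred_eq]
    refine ⟨⟨?_, ?_⟩, ?_, ?_⟩ <;> linarith⟩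

lemma cell_dist {c : ℤ × ℤ} {z w : ℂ} (hz : z ∈ cell c) (hw : w ∈ cell c) : ‖z - w‖ ≤ 3 := by
  obtain ⟨⟨h1, h2⟩, h3, h4⟩ := hz
  obtain ⟨⟨k1, k2⟩, k3, k4⟩ := hw
  refine (Complex.norm_le_abs_re_add_abs_im _).trans ?_
  simp only [Complex.sub_re, Complex.sub_im]
  have a : |z.re - w.re| ≤ 3 / 2 := by rw [abs_le]; constructor <;> linarith
  have b : |z.im - w.im| ≤ 1 := by rw [abs_le]; constructor <;> linarith
  linarith

lemma cell_emb_dist {c : ℤ × ℤ} {z : ℂ} (hz : z ∈ cell c) : ‖z - emb c‖ ≤ 3 := by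
  refine cell_dist hz ?_
  simp only [cell, emb, Set.mem_ofPred_eq]
  refine ⟨⟨?_, ?_⟩, ?_, ?_⟩ <;> linarith

/-- finitely many cells near a bounded set -/
lemma finite_emb (R : ℝ) (z : ℂ) : {c : ℤ × ℤ | ‖z - emb c‖ ≤ R}.Finite := by
  refine ((Set.finite_Icc ⌊z.re - R⌋ ⌈z.re + R⌉).prod (Set.finite_Icc ⌊z.im - R⌋ ⌈z.im + R⌉)).subset ?_
  intro c hc
  have h1 := (Complex.abs_re_le_norm _).trans hc
  have h2 := (Complex.abs_im_le_norm _).trans hc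
  simp only [emb, Complex.sub_re, Complex.sub_im, abs_le] at h1 h2
  refine ⟨⟨?_, ?_⟩, ?_, ?_⟩
  · rw [← @Int.cast_le ℝ]; linarith [Int.floor_le (z.re - R)]
  · rw [← @Int.cast_le ℝ]; linarith [Int.le_ceil (z.re + R)]
  · rw [← @Int.cast_le ℝ]; linarith [Int.floor_le (z.im - R)]
  · rw [← @Int.cast_le ℝ]; linarith [Int.le_ceil (z.im + R)]

lemma locallyFinite_cell : LocallyFinite cell := by
  intro z
  refine ⟨Metric.ball z 1, Metric.ball_mem_nhds z one_pos, (finite_emb 4 z).subset ?_⟩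
  rintro c ⟨w, hw, hw'⟩
  have := cell_emb_dist hw
  rw [Metric.mem_ball, dist_eq_norm] at hw'
  calc ‖z - emb c‖ = ‖(w - emb c) - (w - z)‖ := by congr 1; ring
    _ ≤ _ := norm_sub_le _ _
    _ ≤ 4 := by linarith

lemma isClosed_biUnion_cell (X : Set (ℤ × ℤ)) : IsClosed (⋃ c ∈ X, cell c) := by
  rw [Set.biUnion_eq_iUnion]
  exact (locallyFinite_cell.comp_injective Subtype.val_injective).isClosed_iUnion
    (fun c => isClosed_cell _)

/-- adjacency -/
def Adj (c d : ℤ × ℤ) : Prop := c ≠ d ∧ (cell c ∩ cell d).Nonempty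

lemma Adj.symm {c d : ℤ × ℤ} (h : Adj c d) : Adj d c := ⟨h.1.symm, by rw [Set.inter_comm]; exact h.2⟩

lemma adj_translate {c d : ℤ × ℤ} (l : ℤ × ℤ) (h : Adj c d) : Adj (c + l) (d + l) := by
  refine ⟨fun e => h.1 (add_right_cancel e), ?_⟩
  obtain ⟨z, h1, h2⟩ := h.2
  exact ⟨z + emb l, (mem_cell_add l).2 h1, (mem_cell_add l).2 h2⟩

lemma adj_diff {c d : ℤ × ℤ} (h : Adj c d) : d = c + (1, 0) ∨ d = c + (0, 1) ∨ d = c + (-1, 1) ∨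
    c = d + (1, 0) ∨ c = d + (0, 1) ∨ c = d + (-1, 1) := by
  obtain ⟨hne, z, ⟨⟨h1, h2⟩, h3, h4⟩, ⟨⟨k1, k2⟩, k3, k4⟩⟩ := h
  have a1 : (c.2 : ℝ) ≤ d.2 + 1 := by linarith
  have a2 : (d.2 : ℝ) ≤ c.2 + 1 := by linarith
  norm_cast at a1 a2
  obtain ⟨c1, c2⟩ := c
  obtain ⟨d1, d2⟩ := d
  simp only [Prod.mk_add_mk, Prod.mk.injEq, ne_eq] at *
  rcases (by omega : d2 = c2 ∨ d2 = c2 + 1 ∨ c2 = d2 + 1) with e | e | e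
  · subst e
    have b1 : (c1 : ℝ) ≤ d1 + 1 := by linarith
    have b2 : (d1 : ℝ) ≤ c1 + 1 := by linarith
    norm_cast at b1 b2; omega
  · subst e; push_cast at *
    have b1 : (c1 : ℝ) < d1 + 2 := by linarith
    have b2 : (d1 : ℝ) < c1 + 1 := by linarith
    norm_cast at b1 b2; omega
  · subst e; push_cast at *
    have b1 : (d1 : ℝ) < c1 + 2 := by linarith
    have b2 : (c1 : ℝ) < d1 + 1 := by linarith
    norm_cast at b1 b2; omega

lemma adj_ball_aux (c d : ℤ × ℤ) (h : d = c + (1, 0) ∨ d = c + (0, 1) ∨ d = c + (-1, 1)) :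
    ∃ p : ℂ, p ∈ cell c ∧ p ∈ cell d ∧ Metric.ball p (1 / 8) ⊆ cell c ∪ cell d := by
  obtain ⟨c1, c2⟩ := c
  have hb : ∀ p z : ℂ, z ∈ Metric.ball p (1 / 8) → (-(1 / 8) < z.re - p.re ∧ z.re - p.re < 1 / 8) ∧
      (-(1 / 8) < z.im - p.im ∧ z.im - p.im < 1 / 8) := by
    intro p z hz
    rw [Metric.mem_ball, dist_eq_norm] at hz
    have h1 := (Complex.abs_re_le_norm _).trans_lt hz
    have h2 := (Complex.abs_im_le_norm _).trans_lt hz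
    exact ⟨abs_lt.1 h1, abs_lt.1 h2⟩
  rcases h with rfl | rfl | rfl
  · refine ⟨⟨c1 + 3 / 4, c2 + 1 / 2⟩, ?_, ?_, ?_⟩
    · simp only [cell, Set.mem_ofPred_eq]; refine ⟨⟨?_, ?_⟩, ?_, ?_⟩ <;> linarith
    · simp only [cell, Set.mem_ofPred_eq, Prod.mk_add_mk]; push_cast; refine ⟨⟨?_, ?_⟩, ?_, ?_⟩ <;> linarith
    · intro z hz
      obtain ⟨⟨a1, a2⟩, b1, b2⟩ := hb _ _ hz
      simp only at a1 a2 b1 b2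
      simp only [cell, Set.mem_union, Set.mem_ofPred_eq, Prod.mk_add_mk]
      push_cast
      rcases le_total (z.re + (z.im - c2) / 2) (c1 + 1) with h | h
      · left; refine ⟨⟨?_, ?_⟩, ?_, ?_⟩ <;> linarith
      · right; refine ⟨⟨?_, ?_⟩, ?_, ?_⟩ <;> linarith
  · refine ⟨⟨c1 + 1 / 4, c2 + 1⟩, ?_, ?_, ?_⟩
    · simp only [cell, Set.mem_ofPred_eq]; refine ⟨⟨?_, ?_⟩, ?_, ?_⟩ <;> linarith
    · simp only [cell, Set.mem_ofPred_eq, Prod.mk_add_mk]; push_cast; refine ⟨⟨?_, ?_⟩, ?_, ?_⟩ <;> linarith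
    · intro z hz
      obtain ⟨⟨a1, a2⟩, b1, b2⟩ := hb _ _ hz
      simp only at a1 a2 b1 b2
      simp only [cell, Set.mem_union, Set.mem_ofPred_eq, Prod.mk_add_mk]
      push_cast
      rcases le_total z.im (c2 + 1) with h | h
      · left; refine ⟨⟨?_, ?_⟩, ?_, ?_⟩ <;> linarith
      · right; refine ⟨⟨?_, ?_⟩, ?_, ?_⟩ <;> linarith
  · refine ⟨⟨c1 - 1 / 4, c2 + 1⟩, ?_, ?_, ?_⟩
    · simp only [cell, Set.mem_ofPred_eq]; refine ⟨⟨?_, ?_⟩, ?_, ?_⟩ <;> linarith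
    · simp only [cell, Set.mem_ofPred_eq, Prod.mk_add_mk]; push_cast; refine ⟨⟨?_, ?_⟩, ?_, ?_⟩ <;> linarith
    · intro z hz
      obtain ⟨⟨a1, a2⟩, b1, b2⟩ := hb _ _ hz
      simp only at a1 a2 b1 b2
      simp only [cell, Set.mem_union, Set.mem_ofPred_eq, Prod.mk_add_mk]
      push_cast
      rcases le_total z.im (c2 + 1) with h | h
      · left; refine ⟨⟨?_, ?_⟩, ?_, ?_⟩ <;> linarith
      · right; refine ⟨⟨?_, ?_⟩, ?_, ?_⟩ <;> linarith

lemma adj_ball {c d : ℤ × ℤ} (h : Adj c d) :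
    ∃ p : ℂ, p ∈ cell c ∧ p ∈ cell d ∧ Metric.ball p (1 / 8) ⊆ cell c ∪ cell d := by
  rcases adj_diff h with h | h | h | h | h | h
  · exact adj_ball_aux c d (by tauto)
  · exact adj_ball_aux c d (by tauto)
  · exact adj_ball_aux c d (by tauto)
  all_goals
    obtain ⟨p, h1, h2, h3⟩ := adj_ball_aux d c (by tauto)
    exact ⟨p, h2, h1, by rw [Set.union_comm]; exact h3⟩

lemma adj_right (c : ℤ × ℤ) : Adj c (c + (1, 0)) := by
  obtain ⟨p, h1, h2, -⟩ := adj_ball_aux c (c + (1, 0)) (by tauto)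
  exact ⟨by simp [Prod.ext_iff], p, h1, h2⟩

lemma adj_up (c : ℤ × ℤ) : Adj c (c + (0, 1)) := by
  obtain ⟨p, h1, h2, -⟩ := adj_ball_aux c (c + (0, 1)) (by tauto)
  exact ⟨by simp [Prod.ext_iff], p, h1, h2⟩

lemma adj_norm {c d : ℤ × ℤ} (h : Adj c d) : |d.1 - c.1| ≤ 1 ∧ |d.2 - c.2| ≤ 1 := by
  rcases adj_diff h with h | h | h | h | h | h <;> subst h <;> simp

/-- walks inside X -/
def AW (X : Set (ℤ × ℤ)) (a b : ℤ × ℤ) : Prop := a ∈ X ∧ b ∈ X ∧ Adj a b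

lemma AW.symm {X : Set (ℤ × ℤ)} {a b : ℤ × ℤ} (h : AW X a b) : AW X b a := ⟨h.2.1, h.1, h.2.2.symm⟩

/-- reachability inside X -/
def Reach (X : Set (ℤ × ℤ)) : ℤ × ℤ → ℤ × ℤ → Prop := Relation.ReflTransGen (AW X)

lemma Reach.symm {X : Set (ℤ × ℤ)} {a b : ℤ × ℤ} (h : Reach X a b) : Reach X b a :=
  haveI : Std.Symm (AW X) := ⟨fun _ _ h => AW.symm h⟩
  (Relation.ReflTransGen.stdSymm (r := AW X)).symm _ _ h

lemma Reach.mono {X Y : Set (ℤ × ℤ)} (hXY : X ⊆ Y) {a b : ℤ × ℤ} (h : Reach X a b) : Reach Y a b :=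
  Relation.ReflTransGen.mono (fun _ _ h => ⟨hXY h.1, hXY h.2.1, h.2.2⟩) _ _ h

lemma Reach.trans {X : Set (ℤ × ℤ)} {a b c : ℤ × ℤ} (h : Reach X a b) (k : Reach X b c) :
    Reach X a c := Relation.ReflTransGen.trans h k

lemma Reach.mem {X : Set (ℤ × ℤ)} {a b : ℤ × ℤ} (h : Reach X a b) (ha : a ∈ X) : b ∈ X := by
  rcases Relation.ReflTransGen.cases_tail h with h | ⟨c, _, h⟩
  · rwa [h]
  · exact h.2.1

lemma Reach.translate {X Y : Set (ℤ × ℤ)} (l : ℤ × ℤ) (hXY : ∀ x ∈ X, x + l ∈ Y) {a b : ℤ × ℤ}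
    (h : Reach X a b) : Reach Y (a + l) (b + l) :=
  Relation.ReflTransGen.lift (fun x => x + l)
    (fun _ _ h => ⟨hXY _ h.1, hXY _ h.2.1, adj_translate l h.2.2⟩) _ _ h

/-- adjacency-connected sets of cells -/
def AdjConn (X : Set (ℤ × ℤ)) : Prop := ∀ c ∈ X, ∀ d ∈ X, Reach X c d

lemma AdjConn.union {X Y : Set (ℤ × ℤ)} (hX : AdjConn X) (hY : AdjConn Y) {x y : ℤ × ℤ}
    (hx : x ∈ X) (hy : y ∈ Y) (hxy : x = y ∨ Adj x y) : AdjConn (X ∪ Y) := by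
  have hst : Reach (X ∪ Y) x y := by
    rcases hxy with h | h
    · rw [h]; exact Relation.ReflTransGen.refl
    · exact Relation.ReflTransGen.single ⟨Or.inl hx, Or.inr hy, h⟩
  have h1 : ∀ c ∈ X ∪ Y, Reach (X ∪ Y) c x := by
    rintro c (hc | hc)
    · exact (hX c hc x hx).mono Set.subset_union_left
    · exact ((hY c hc y hy).mono Set.subset_union_right).trans hst.symm
  intro c hc d hd
  exact (h1 c hc).trans (h1 d hd).symm

/-- component -/
def comp (X : Set (ℤ × ℤ)) (c : ℤ × ℤ) : Set (ℤ × ℤ) := {d | Reach X c d}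

lemma comp_subset {X : Set (ℤ × ℤ)} {c : ℤ × ℤ} (hc : c ∈ X) : comp X c ⊆ X := fun _ h => h.mem hc

lemma self_mem_comp (X : Set (ℤ × ℤ)) (c : ℤ × ℤ) : c ∈ comp X c := Relation.ReflTransGen.refl

lemma comp_reach {X : Set (ℤ × ℤ)} {c d : ℤ × ℤ} (h : Reach X c d) : Reach (comp X c) c d := by
  induction h with
  | refl => exact Relation.ReflTransGen.refl
  | tail h1 h2 ih =>
    exact Relation.ReflTransGen.tail ih ⟨h1, Relation.ReflTransGen.tail h1 h2, h2.2.2⟩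

lemma comp_adjConn (X : Set (ℤ × ℤ)) (c : ℤ × ℤ) : AdjConn (comp X c) := by
  intro a ha b hb
  exact (comp_reach ha).symm.trans (comp_reach hb)

/-- the open set of a family of cells -/
def O (X : Set (ℤ × ℤ)) : Set ℂ := interior (⋃ c ∈ X, cell c)

lemma isOpen_O (X : Set (ℤ × ℤ)) : IsOpen (O X) := isOpen_interior

lemma ocell_subset_O {X : Set (ℤ × ℤ)} {c : ℤ × ℤ} (hc : c ∈ X) : ocell c ⊆ O X :=
  interior_maximal ((ocell_subset c).trans (Set.subset_biUnion_of_mem (u := cell) hc)) (isOpen_ocell c)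

lemma O_meets {X : Set (ℤ × ℤ)} {z : ℂ} (hz : z ∈ O X) {N : Set ℂ} (hN : IsOpen N) (hzN : z ∈ N) :
    ∃ c ∈ X, ∃ w ∈ N, w ∈ ocell c := by
  have := interior_subset hz
  simp only [Set.mem_iUnion] at this
  obtain ⟨c, hc, hz'⟩ := this
  exact ⟨c, hc, cell_meets hz' hN hzN⟩

lemma mem_of_ocell_O {X : Set (ℤ × ℤ)} {c : ℤ × ℤ} {z : ℂ} (hz : z ∈ ocell c) (hz' : z ∈ O X) :
    c ∈ X := by
  have := interior_subset hz'
  simp only [Set.mem_iUnion] at this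
  obtain ⟨d, hd, hzd⟩ := this
  rwa [cell_eq_of hz hzd]

lemma O_inter {X Y : Set (ℤ × ℤ)} {z : ℂ} (hX : z ∈ O X) (hY : z ∈ O Y) : ∃ c, c ∈ X ∧ c ∈ Y := by
  obtain ⟨c, hc, w, hw, hwc⟩ := O_meets hX (isOpen_O Y) hY
  exact ⟨c, hc, mem_of_ocell_O hwc hw⟩

lemma O_preconnected {X : Set (ℤ × ℤ)} (hX : AdjConn X) : IsPreconnected (O X) := by
  have hch : ∀ c d : ℤ × ℤ, ∃ p : ℂ, Adj c d → p ∈ cell c ∧ p ∈ cell d ∧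
      Metric.ball p (1 / 8) ⊆ cell c ∪ cell d := by
    intro c d
    by_cases h : Adj c d
    · obtain ⟨p, hp⟩ := adj_ball h
      exact ⟨p, fun _ => hp⟩
    · exact ⟨0, fun h' => absurd h' h⟩
  choose p hp using hch
  set T : ℤ × ℤ → Set ℂ := fun c => ocell c ∪ ⋃ d ∈ {d | AW X c d}, (ocell c ∪ Metric.ball (p c d) (1/8)) with hT
  have hTc : ∀ c ∈ X, IsPreconnected (T c) := by
    intro c hc
    obtain ⟨z, hz⟩ := ocell_nonempty c
    refine isPreconnected_of_forall z ?_
    rintro y (hy | hy)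
    · exact ⟨ocell c, Set.subset_union_left, hz, hy, (convex_ocell c).isPreconnected⟩
    · simp only [Set.mem_iUnion] at hy
      obtain ⟨d, hd, hy⟩ := hy
      refine ⟨ocell c ∪ Metric.ball (p c d) (1 / 8), ?_, Or.inl hz, hy, ?_⟩
      · exact (Set.subset_biUnion_of_mem (u := fun d => ocell c ∪ Metric.ball (p c d) (1/8)) hd).trans
          Set.subset_union_right
      · obtain ⟨w, hw1, hw2⟩ := cell_meets (hp c d hd.2.2).1 (Metric.isOpen_ball)
          (Metric.mem_ball_self (x := p c d) (show (0:ℝ) < 1 / 8 by norm_num))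
        exact IsPreconnected.union w hw2 hw1 (convex_ocell c).isPreconnected
          (convex_ball _ _).isPreconnected
  have hS : IsPreconnected (⋃ c ∈ X, T c) := by
    refine IsPreconnected.biUnion_of_reflTransGen hTc ?_
    intro c hc d hd
    refine Relation.ReflTransGen.mono ?_ _ _ (hX c hc d hd)
    intro a b hab
    refine ⟨?_, hab.1⟩
    obtain ⟨w, hw1, hw2⟩ := cell_meets (hp a b hab.2.2).2.1 (Metric.isOpen_ball)
          (Metric.mem_ball_self (x := p a b) (show (0:ℝ) < 1 / 8 by norm_num))
    refine ⟨w, Or.inr ?_, Or.inl hw2⟩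
    simp only [Set.mem_iUnion]
    exact ⟨b, hab, Or.inr hw1⟩
  refine hS.subset_closure ?_ ?_
  · refine Set.iUnion₂_subset fun c hc => ?_
    refine Set.union_subset (ocell_subset_O hc) (Set.iUnion₂_subset fun d hd =>
      Set.union_subset (ocell_subset_O hc) ?_)
    refine interior_maximal ((hp c d hd.2.2).2.2.trans ?_) Metric.isOpen_ball
    exact Set.union_subset (Set.subset_biUnion_of_mem (u := cell) hc)
      (Set.subset_biUnion_of_mem (u := cell) hd.2.1)
  · intro z hz
    have := interior_subset hz
    simp only [Set.mem_iUnion] at this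
    obtain ⟨c, hc, hzc⟩ := this
    refine closure_mono ?_ (cell_subset_closure c hzc)
    exact Set.subset_union_left.trans (Set.subset_biUnion_of_mem (u := T) hc)

/-- cells meeting a preconnected set form an adjacency-connected set -/
lemma conn_cells {W : Set ℂ} (hW : IsPreconnected W) : AdjConn {d | (cell d ∩ W).Nonempty} := by
  set T := {d | (cell d ∩ W).Nonempty} with hT
  intro c hc d hd
  by_contra hcd
  obtain ⟨z, hzW, hz⟩ := isPreconnected_closed_iff.1 hW (⋃ a ∈ comp T c, cell a)
    (⋃ a ∈ T \ comp T c, cell a) (isClosed_biUnion_cell _) (isClosed_biUnion_cell _)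
    (by
      intro z hz
      obtain ⟨a, ha⟩ := cell_cover z
      have haT : a ∈ T := ⟨z, ha, hz⟩
      by_cases h : a ∈ comp T c
      · exact Or.inl (Set.mem_biUnion h ha)
      · exact Or.inr (Set.mem_biUnion ⟨haT, h⟩ ha))
    (by
      obtain ⟨z, h1, h2⟩ := hc
      exact ⟨z, h2, Set.mem_biUnion (self_mem_comp T c) h1⟩)
    (by
      obtain ⟨z, h1, h2⟩ := hd
      exact ⟨z, h2, Set.mem_biUnion (⟨⟨z, h1, h2⟩, hcd⟩ : d ∈ T \ comp T c) h1⟩)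
  obtain ⟨h1, h2⟩ := hz
  simp only [Set.mem_iUnion] at h1 h2
  obtain ⟨a, ha, hza⟩ := h1
  obtain ⟨b, hb, hzb⟩ := h2
  refine hb.2 (Relation.ReflTransGen.tail ha ⟨comp_subset hc ha, hb.1, ?_, z, hza, hzb⟩)
  rintro rfl
  exact hb.2 ha

/-- arrows between cells -/
def arrow (G : ℂ ≃ₜ ℂ) (c d : ℤ × ℤ) : Prop := ∃ z ∈ ocell c, G z ∈ ocell d

lemma arrow_symm {G : ℂ ≃ₜ ℂ} {c d : ℤ × ℤ} : arrow G.symm c d ↔ arrow G d c := by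
  constructor
  · rintro ⟨z, h1, h2⟩
    exact ⟨G.symm z, h2, by simpa using h1⟩
  · rintro ⟨z, h1, h2⟩
    exact ⟨G z, h2, by simpa using h1⟩

/-- image of a set of cells -/
def Phi (G : ℂ ≃ₜ ℂ) (X : Set (ℤ × ℤ)) : Set (ℤ × ℤ) := {d | ∃ c ∈ X, arrow G c d}

lemma arrow_of_O {G : ℂ ≃ₜ ℂ} {X Y : Set (ℤ × ℤ)} {z : ℂ} (hz : z ∈ O X) (hGz : G z ∈ O Y) :
    ∃ c ∈ X, ∃ d ∈ Y, arrow G c d := by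
  obtain ⟨d, hd, w, hw1, hw2⟩ := O_meets hGz ((isOpen_O X).preimage G.symm.continuous)
    (by simpa using hz)
  obtain ⟨c, hc, v, hv1, hv2⟩ := O_meets (X := X) (z := G.symm w) hw1
    ((isOpen_ocell d).preimage G.continuous) (by simpa using hw2)
  exact ⟨c, hc, d, hd, v, hv2, hv1⟩

lemma Phi_eq (G : ℂ ≃ₜ ℂ) (X : Set (ℤ × ℤ)) : Phi G X = {d | (cell d ∩ G '' O X).Nonempty} := by
  ext d
  constructor
  · rintro ⟨c, hc, z, h1, h2⟩
    exact ⟨G z, ocell_subset d h2, z, ocell_subset_O hc h1, rfl⟩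
  · rintro ⟨_, h1, z, hz, rfl⟩
    obtain ⟨w, hw1, hw2⟩ := cell_meets h1 ((isOpen_O X).preimage G.symm.continuous) (by simpa using hz)
    obtain ⟨c, hc, v, hv1, hv2⟩ := O_meets (X := X) (z := G.symm w) hw1
      ((isOpen_ocell d).preimage G.continuous) (by simpa using hw2)
    exact ⟨c, hc, v, hv2, hv1⟩

lemma Phi_adjConn (G : ℂ ≃ₜ ℂ) {X : Set (ℤ × ℤ)} (hX : AdjConn X) : AdjConn (Phi G X) := by
  rw [Phi_eq]
  exact conn_cells ((O_preconnected hX).image _ G.continuous.continuousOn)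

lemma arrow_of_cell (G : ℂ ≃ₜ ℂ) {c : ℤ × ℤ} {z : ℂ} (hz : z ∈ cell c) :
    ∃ e, arrow G c e ∧ G z ∈ cell e := by
  have h1 : z ∈ G ⁻¹' (⋃ e ∈ {e | arrow G c e}, cell e) := by
    refine closure_minimal ?_ ((isClosed_biUnion_cell _).preimage G.continuous)
      (cell_subset_closure c hz)
    intro w hw
    obtain ⟨e, he⟩ := cell_cover (G w)
    refine Set.mem_biUnion (x := e) ?_ he
    obtain ⟨v, hv1, hv2⟩ := cell_meets he ((isOpen_ocell c).preimage G.symm.continuous)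
      (by simpa using hw)
    exact ⟨G.symm v, hv1, by simpa using hv2⟩
  simp only [Set.mem_preimage, Set.mem_iUnion] at h1
  obtain ⟨e, h1, h2⟩ := h1
  exact ⟨e, h1, h2⟩

lemma exists_arrow (G : ℂ ≃ₜ ℂ) (c : ℤ × ℤ) : ∃ e, arrow G c e := by
  obtain ⟨z, hz⟩ := ocell_nonempty c
  obtain ⟨e, he, -⟩ := arrow_of_cell G (ocell_subset c hz)
  exact ⟨e, he⟩

end FT

namespace FT

lemma log_I_mul {w : ℂ} (hw : w ≠ 0) (hr : 0 ≤ w.re) :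
    Complex.log (Complex.I * w) = Complex.log w + Real.pi / 2 * Complex.I := by
  have h := Complex.abs_arg_le_pi_div_two_iff.2 hr
  rw [abs_le] at h
  have hpi := Real.pi_pos
  rw [Complex.log_mul Complex.I_ne_zero hw, Complex.log_I]
  · ring
  · rw [Complex.arg_I]; constructor <;> linarith

lemma slit_of {w : ℂ} (hw : w ≠ 0) (hr : 0 ≤ w.re) : w ∈ Complex.slitPlane := by
  rcases hr.eq_or_lt with h | h
  · right; intro h'; exact hw (Complex.ext h.symm h')
  · left; exact h

lemma side_aux {D L : ℝ → ℂ} (hD : Continuous D) (hL : Continuous L)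
    (hLD : ∀ t, Complex.exp (L t) = D t) (u : ℂ) (hu : u ≠ 0) (hr : ∀ t, 0 ≤ (u * D t).re)
    (a b : ℝ) : L b - L a = Complex.log (u * D b) - Complex.log (u * D a) := by
  have hne : ∀ t, u * D t ≠ 0 := fun t => mul_ne_zero hu (by rw [← hLD]; exact Complex.exp_ne_zero _)
  obtain ⟨l, hl⟩ : ∃ l, Complex.exp l = u := ⟨Complex.log u, Complex.exp_log hu⟩
  have := lift_const (f := fun t => L t + l - Complex.log (u * D t))
    (by
      refine Continuous.sub (by fun_prop) ?_
      exact Continuous.clog (by fun_prop) (fun t => slit_of (hne t) (hr t)))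
    (by
      intro t
      rw [Complex.exp_sub, Complex.exp_add, hLD, hl, Complex.exp_log (hne t), mul_comm]
      exact div_self (hne t)) a b
  linear_combination -this

lemma cross (f g : ℝ → ℂ) (hf : Continuous f) (hg : Continuous g)
    (h1 : ∀ t, (f 0).re ≤ (g t).re ∧ (g t).re ≤ (f 1).re)
    (h2 : ∀ s, (g 1).im ≤ (f s).im ∧ (f s).im ≤ (g 0).im) : ∃ s t, f s = g t := by
  by_contra hne
  push Not at hne
  obtain ⟨L, hL, hL'⟩ := lift_exp (fun p : ℝ × ℝ => f p.1 - g p.2) (by fun_prop)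
    (fun p => sub_ne_zero.2 (hne _ _))
  have hI := Complex.I_ne_zero
  have nz : ∀ s t, f s - g t ≠ 0 := fun s t => sub_ne_zero.2 (hne s t)
  have e1 := side_aux (D := fun s => f s - g 0) (L := fun s => L (s, 0)) (by fun_prop) (by fun_prop)
    (fun s => hL' (s, 0)) Complex.I hI (by intro s; simp; linarith [(h2 s).2]) 0 1
  have e2 := side_aux (D := fun t => f 1 - g t) (L := fun t => L (1, t)) (by fun_prop) (by fun_prop)
    (fun t => hL' (1, t)) 1 one_ne_zero (by intro t; simp; linarith [(h1 t).2]) 0 1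
  have e3 := side_aux (D := fun s => f s - g 1) (L := fun s => L (s, 1)) (by fun_prop) (by fun_prop)
    (fun s => hL' (s, 1)) (-Complex.I) (neg_ne_zero.2 hI) (by intro s; simp; linarith [(h2 s).1]) 1 0
  have e4 := side_aux (D := fun t => f 0 - g t) (L := fun t => L (0, t)) (by fun_prop) (by fun_prop)
    (fun t => hL' (0, t)) (-1) (by simp) (by intro t; simp; linarith [(h1 t).1]) 1 0
  have q1 := log_I_mul (w := 1 * (f 1 - g 0)) (by simpa using nz 1 0) (by simp; linarith [(h1 0).2])
  have q2 := log_I_mul (w := -Complex.I * (f 1 - g 1)) (mul_ne_zero (neg_ne_zero.2 hI) (nz 1 1))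
    (by simp; linarith [(h2 1).1])
  have q3 := log_I_mul (w := -1 * (f 0 - g 1)) (mul_ne_zero (by simp) (nz 0 1))
    (by simp; linarith [(h1 1).1])
  have q4 := log_I_mul (w := Complex.I * (f 0 - g 0)) (mul_ne_zero hI (nz 0 0))
    (by simp; linarith [(h2 0).2])
  have r1 : Complex.I * (1 * (f 1 - g 0)) = Complex.I * (f 1 - g 0) := by ring
  have r2 : Complex.I * (-Complex.I * (f 1 - g 1)) = 1 * (f 1 - g 1) := by
    linear_combination -(f 1 - g 1) * Complex.I_sq
  have r3 : Complex.I * (-1 * (f 0 - g 1)) = -Complex.I * (f 0 - g 1) := by ring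
  have r4 : Complex.I * (Complex.I * (f 0 - g 0)) = -1 * (f 0 - g 0) := by
    linear_combination (f 0 - g 0) * Complex.I_sq
  rw [r1] at q1
  rw [r2] at q2
  rw [r3] at q3
  rw [r4] at q4
  have : (2 * Real.pi * Complex.I : ℂ) = 0 := by
    linear_combination -q1 - q2 - q3 - q4 - e1 - e2 - e3 - e4
  exact Complex.two_pi_I_ne_zero this

/-- determinant -/
def det (v c : ℤ × ℤ) : ℤ := v.1 * c.2 - v.2 * c.1

lemma reach_finite {X : Set (ℤ × ℤ)} {a b : ℤ × ℤ} (ha : a ∈ X) (h : Reach X a b) :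
    ∃ W : Set (ℤ × ℤ), W.Finite ∧ W ⊆ X ∧ a ∈ W ∧ Reach W a b := by
  induction h with
  | refl => exact ⟨{a}, Set.finite_singleton a, by simpa using ha, rfl, Relation.ReflTransGen.refl⟩
  | @tail b c h1 h2 ih =>
    obtain ⟨W, w1, w2, w3, w4⟩ := ih
    refine ⟨insert c W, w1.insert c, Set.insert_subset h2.2.1 w2, Or.inr w3, ?_⟩
    refine Relation.ReflTransGen.tail (w4.mono (Set.subset_insert _ _)) ?_
    exact ⟨Or.inr (w4.mem w3), Or.inl rfl, h2.2.2⟩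

lemma adjConn_periodic {W : Set (ℤ × ℤ)} (hW : AdjConn W) {a v : ℤ × ℤ} (ha : a ∈ W)
    (hb : a + v ∈ W) : AdjConn {x | ∃ k : ℤ, x - k • v ∈ W} := by
  set X0 := {x | ∃ k : ℤ, x - k • v ∈ W} with hX0
  have htr : ∀ (k : ℤ), ∀ x ∈ W, x + k • v ∈ X0 := by
    intro k x hx
    exact ⟨k, by simpa using hx⟩
  have hstep : ∀ k : ℤ, Reach X0 (a + k • v) (a + (k + 1) • v) := by
    intro k
    have := (hW a ha _ hb).translate (k • v) (htr k)
    convert this using 1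
    rw [add_smul, one_smul]; abel
  have hall : ∀ k : ℤ, Reach X0 a (a + k • v) := by
    intro k
    induction k using Int.induction_on with
    | zero => simp only [zero_smul, add_zero]; exact Relation.ReflTransGen.refl
    | succ k ih => exact ih.trans (hstep k)
    | pred k ih =>
      refine ih.trans (Reach.symm ?_)
      have := hstep (-(k:ℤ) - 1)
      simpa using this
  have h2 : ∀ x ∈ X0, Reach X0 a x := by
    rintro x ⟨k, hk⟩
    refine (hall k).trans ?_
    have := (hW a ha _ hk).translate (k • v) (htr k)
    simpa using this
  intro c hc d hd
  exact (h2 c hc).symm.trans (h2 d hd)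

lemma path_in_O {X : Set (ℤ × ℤ)} (hX : AdjConn X) {p q : ℂ} (hp : p ∈ O X) (hq : q ∈ O X) :
    ∃ f : ℝ → ℂ, Continuous f ∧ f 0 = p ∧ f 1 = q ∧ (∀ t, f t ∈ O X) ∧ ∃ B : ℝ, ∀ t, ‖f t‖ ≤ B := by
  have hc : IsPathConnected (O X) := by
    rw [← (isOpen_O X).isConnected_iff_isPathConnected]
    exact ⟨⟨p, hp⟩, O_preconnected hX⟩
  obtain ⟨γ, hγ⟩ := hc.joinedIn p hp q hq
  have hmem : ∀ t, γ.extend t ∈ Set.range γ := by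
    intro t
    rw [← γ.extend_range]
    exact ⟨t, rfl⟩
  refine ⟨γ.extend, γ.continuous_extend, γ.extend_zero, γ.extend_one, ?_, ?_⟩
  · intro t
    obtain ⟨u, hu⟩ := hmem t
    rw [← hu]; exact hγ u
  · obtain ⟨B, hB⟩ := (isCompact_range γ.continuous).isBounded.exists_norm_le
    exact ⟨B, fun t => hB _ (hmem t)⟩

lemma emb_mul_conj (v c : ℤ × ℤ) : (emb c * (starRingEnd ℂ) (emb v)).im = det v c := by
  simp [emb, det]; ring

lemma det_add_smul (v c : ℤ × ℤ) (k : ℤ) : det v (c + k • v) = det v c := by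
  simp [det]; ring

lemma DX {X Y : Set (ℤ × ℤ)} (hX : AdjConn X) (hne : X.Nonempty) {v : ℤ × ℤ} (hv : v ≠ 0)
    (hXv : ∀ x ∈ X, x + v ∈ X) (hXv' : ∀ x ∈ X, x - v ∈ X) (hY : AdjConn Y)
    (hup : ∀ M : ℤ, ∃ y ∈ Y, M < det v y) (hdn : ∀ M : ℤ, ∃ y ∈ Y, det v y < M) :
    ∃ c, c ∈ X ∧ c ∈ Y := by
  obtain ⟨a, ha⟩ := hne
  obtain ⟨W, w1, w2, w3, w4⟩ := reach_finite ha (hX a ha _ (hXv a ha))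
  set W' := comp W a with hW'
  have hW'W : W' ⊆ W := comp_subset w3
  have hfin : W'.Finite := w1.subset hW'W
  set X0 := {x | ∃ k : ℤ, x - k • v ∈ W'} with hX0
  have hX0c : AdjConn X0 := adjConn_periodic (comp_adjConn W a) (self_mem_comp W a) w4
  have hXk : ∀ (k : ℤ), ∀ x ∈ X, x + k • v ∈ X := by
    intro k x hx
    induction k using Int.induction_on with
    | zero => simpa using hx
    | succ k ih => have := hXv _ ih; rwa [add_assoc, ← add_one_zsmul] at this
    | pred k ih => 
      have := hXv' _ ih
      rwa [add_sub_assoc, show -(k:ℤ) • v - v = (-(k:ℤ) - 1) • v by rw [sub_smul, one_smul]] at this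
  have hX0X : X0 ⊆ X := by
    rintro x ⟨k, hk⟩
    have := hXk k _ (w2 (hW'W hk))
    simpa using this
  set u := (starRingEnd ℂ) (emb v) with hu
  -- bound on the height
  obtain ⟨B, hB⟩ : ∃ B : ℝ, ∀ z ∈ O X0, |(z * u).im| ≤ B := by
    obtain ⟨B0, hB0⟩ := (hfin.image (fun w => |(det v w : ℝ)|)).bddAbove
    refine ⟨3 * ‖u‖ + B0, ?_⟩
    intro z hz
    have := interior_subset hz
    simp only [Set.mem_iUnion] at this
    obtain ⟨c, ⟨k, hk⟩, hzc⟩ := this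
    have h1 : (z * u).im = ((z - emb c) * u).im + det v c := by
      rw [← emb_mul_conj, ← hu, ← Complex.add_im]; congr 1; ring
    have h2 : det v c = det v (c - k • v) := by
      conv_lhs => rw [← sub_add_cancel c (k • v)]
      rw [det_add_smul]
    rw [h1, h2]
    refine (abs_add_le _ _).trans (add_le_add ?_ (hB0 ⟨_, hk, rfl⟩))
    refine (Complex.abs_im_le_norm _).trans ?_
    rw [norm_mul]
    gcongr
    exact cell_emb_dist hzc
  -- the path in Y
  have hy : ∀ y ∈ Y, ∀ z ∈ ocell y, |(z * u).im - det v y| ≤ 3 * ‖u‖ := by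
    intro y _ z hz
    rw [← emb_mul_conj, ← hu, ← Complex.sub_im, ← sub_mul]
    refine (Complex.abs_im_le_norm _).trans ?_
    rw [norm_mul]
    gcongr
    exact cell_emb_dist (ocell_subset _ hz)
  obtain ⟨M, hM⟩ := exists_int_gt (B + 3 * ‖u‖)
  obtain ⟨y1, hy1, hy1'⟩ := hup M
  obtain ⟨y2, hy2, hy2'⟩ := hdn (-M)
  obtain ⟨q1, hq1⟩ := ocell_nonempty y1
  obtain ⟨q2, hq2⟩ := ocell_nonempty y2
  obtain ⟨g, g1, g2, g3, g4, S, g5⟩ := path_in_O hY (ocell_subset_O hy1 hq1) (ocell_subset_O hy2 hq2)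
  obtain ⟨p, hp⟩ := ocell_nonempty a
  have hv2 : (1:ℝ) ≤ (emb v * u).re := by
    have h0 : 1 ≤ v.1 * v.1 + v.2 * v.2 := by
      by_contra h
      have h1 : v.1 = 0 := by nlinarith
      have h2 : v.2 = 0 := by nlinarith
      exact hv (Prod.ext h1 h2)
    have : (emb v * u).re = v.1 * v.1 + v.2 * v.2 := by simp [hu, emb]
    rw [this]; exact_mod_cast h0
  obtain ⟨K, hK⟩ := exists_nat_gt (S * ‖u‖ + |(p * u).re|)
  have hpk : ∀ k : ℤ, p + emb (k • v) ∈ O X0 := by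
    intro k
    refine ocell_subset_O (show a + k • v ∈ X0 from ⟨k, by simpa using self_mem_comp W a⟩) ?_
    exact (mem_ocell_add _).2 hp
  have hsm : ∀ k : ℤ, emb (k • v) = k * emb v := by
    intro k; apply Complex.ext <;> simp [emb]
  obtain ⟨f, f1, f2, f3, f4, -⟩ := path_in_O hX0c (hpk (-K)) (hpk K)
  have habs := abs_le.1 (le_refl |(p * u).re|)
  obtain ⟨s, t, hst⟩ := cross (fun s => f s * u) (fun t => g t * u) (by fun_prop) (by fun_prop)
    (by
      intro t
      have h1 : |(g t * u).re| ≤ S * ‖u‖ := by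
        refine (Complex.abs_re_le_norm _).trans ?_
        rw [norm_mul]; gcongr; exact g5 t
      have h2 := abs_le.1 h1
      simp only [f2, f3, hsm]
      have h3 : ∀ k : ℤ, ((p + k * emb v) * u).re = (p * u).re + k * (emb v * u).re := by
        intro k
        rw [show (p + k * emb v) * u = p * u + ((k : ℝ) : ℂ) * (emb v * u) by push_cast; ring,
          Complex.add_re, Complex.re_ofReal_mul]
      rw [h3, h3]
      push_cast
      have hK0 : (0:ℝ) ≤ K := Nat.cast_nonneg K
      have : (K:ℝ) ≤ K * (emb v * u).re := le_mul_of_one_le_right hK0 hv2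
      constructor <;> linarith)
    (by
      intro s
      have h1 := abs_le.1 (hB _ (f4 s))
      have h2 := abs_le.1 (hy y1 hy1 q1 hq1)
      have h3 := abs_le.1 (hy y2 hy2 q2 hq2)
      have h4 : (M : ℝ) < det v y1 := by exact_mod_cast hy1'
      have h5 : (det v y2 : ℝ) < -M := by exact_mod_cast hy2'
      simp only [g2, g3]
      constructor <;> linarith)
  have hu0 : u ≠ 0 := by
    intro h; rw [h] at hv2; simp at hv2; linarith
  have heq := mul_right_cancel₀ hu0 hst
  obtain ⟨c, hc1, hc2⟩ := O_inter (f4 s) (heq ▸ g4 t)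
  exact ⟨c, hX0X hc1, hc2⟩

end FT

namespace FT

/-- standing assumptions on the scaled homeomorphism -/
structure Ok (G : ℂ ≃ₜ ℂ) (N : ℤ) : Prop where
  pos : 0 < N
  per : ∀ z l, G (z + emb (N • l)) = G z + emb (N • l)
  fpf : FPF G
  far : ∀ z, 3 < ‖G z - z‖
  bdd : ∃ M, ∀ z, ‖G z - z‖ ≤ M

lemma Ok.symm {G : ℂ ≃ₜ ℂ} {N : ℤ} (h : Ok G N) : Ok G.symm N where
  pos := h.pos
  per := by
    intro z l
    apply G.injective
    rw [h.per]; simp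
  fpf := h.fpf.symm
  far := by
    intro z
    have := h.far (G.symm z)
    rw [norm_sub_rev]; simpa using this
  bdd := by
    obtain ⟨M, hM⟩ := h.bdd
    refine ⟨M, fun z => ?_⟩
    have := hM (G.symm z)
    rw [norm_sub_rev]; simpa using this

lemma Ok.arrow_free {G : ℂ ≃ₜ ℂ} {N : ℤ} (h : Ok G N) (c : ℤ × ℤ) : ¬ arrow G c c := by
  rintro ⟨z, hz, hz'⟩
  have := cell_dist (ocell_subset _ hz') (ocell_subset _ hz)
  linarith [h.far z]

lemma Ok.arrow_tr {G : ℂ ≃ₜ ℂ} {N : ℤ} (h : Ok G N) {c d : ℤ × ℤ} (l : ℤ × ℤ) (hcd : arrow G c d) :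
    arrow G (c + N • l) (d + N • l) := by
  obtain ⟨z, hz, hz'⟩ := hcd
  refine ⟨z + emb (N • l), (mem_ocell_add _).2 hz, ?_⟩
  rw [h.per]
  exact (mem_ocell_add _).2 hz'

abbrev Br := (ℤ × ℤ) × (ℤ × ℤ)

/-- brick arrows -/
def BA (G : ℂ ≃ₜ ℂ) (k : ℤ × ℤ → Br) (b b' : Br) : Prop :=
  ∃ c d, k c = b ∧ k d = b' ∧ arrow G c d

structure Pre (G : ℂ ≃ₜ ℂ) (N : ℤ) (k : ℤ × ℤ → Br) : Prop where
  eqv : ∀ c l, k (c + N • l) = k c + (0, l)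
  conn : ∀ b, AdjConn {c | k c = b}
  free : ∀ c d, k c = k d → ¬ arrow G c d

structure Brk (G : ℂ ≃ₜ ℂ) (N : ℤ) (k : ℤ × ℤ → Br) : Prop extends Pre G N k where
  merge : ∀ c d, Adj c d → (k c).1 ≠ (k d).1 → BA G k (k c) (k d) ∨ BA G k (k d) (k c)

lemma Pre.fin {G : ℂ ≃ₜ ℂ} {N : ℤ} {k : ℤ × ℤ → Br} (hN : 0 < N) (h : Pre G N k) :
    (Set.range (fun c => (k c).1)).Finite := by
  have hf : ((Set.Icc 0 N ×ˢ Set.Icc 0 N : Set (ℤ × ℤ))).Finite :=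
    (Set.finite_Icc _ _).prod (Set.finite_Icc _ _)
  refine (hf.image (fun c => (k c).1)).subset ?_
  rintro _ ⟨c, rfl⟩
  refine ⟨(c.1 % N, c.2 % N), ⟨⟨Int.emod_nonneg _ hN.ne', (Int.emod_lt_of_pos _ hN).le⟩,
    ⟨Int.emod_nonneg _ hN.ne', (Int.emod_lt_of_pos _ hN).le⟩⟩, ?_⟩
  have h1 := h.eqv (c.1 % N, c.2 % N) (c.1 / N, c.2 / N)
  have h2 : ((c.1 % N, c.2 % N) + N • (c.1 / N, c.2 / N) : ℤ × ℤ) = c := by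
    apply Prod.ext <;> simp [Int.emod_add_mul_ediv]
  rw [h2] at h1
  simp [h1]

lemma pre_exists {G : ℂ ≃ₜ ℂ} {N : ℤ} (h : Ok G N) : ∃ k, Pre G N k := by
  have hN := h.pos
  set k : ℤ × ℤ → Br := fun c => ((c.1 % N, c.2 % N), (c.1 / N, c.2 / N)) with hk
  have inj : ∀ c d, k c = k d → c = d := by
    intro c d hcd
    simp only [hk, Prod.mk.injEq] at hcd
    obtain ⟨⟨h1, h2⟩, h3, h4⟩ := hcd
    apply Prod.ext
    · rw [← Int.emod_add_mul_ediv c.1 N, h1, h3, Int.emod_add_mul_ediv]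
    · rw [← Int.emod_add_mul_ediv c.2 N, h2, h4, Int.emod_add_mul_ediv]
  refine ⟨k, ?_, ?_, ?_⟩
  · intro c l
    simp [hk, Int.add_mul_ediv_left _ _ hN.ne']
    rfl
  · rintro b c hc d hd
    rw [inj c d (by rw [hc, hd])]
    exact Relation.ReflTransGen.refl
  · intro c d hcd
    rw [inj c d hcd]
    exact h.arrow_free d

lemma brk_exists {G : ℂ ≃ₜ ℂ} {N : ℤ} (h : Ok G N) : ∃ k, Brk G N k := by
  classical
  have hex : ∃ n, ∃ k, Pre G N k ∧ (Set.range (fun c => (k c).1)).ncard = n := by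
    obtain ⟨k, hk⟩ := pre_exists h
    exact ⟨_, k, hk, rfl⟩
  obtain ⟨k, hk, hn⟩ := Nat.find_spec hex
  have hmin : ∀ k', Pre G N k' → (Set.range (fun c => (k c).1)).ncard ≤
      (Set.range (fun c => (k' c).1)).ncard := by
    intro k' hk'
    rw [hn]
    exact Nat.find_min' hex ⟨k', hk', rfl⟩
  refine ⟨k, hk, ?_⟩
  intro c d hcd hne
  by_contra hcon
  push Not at hcon
  obtain ⟨hc1, hc2⟩ := hcon
  set i := (k c).1 with hi
  set j := (k d).1 with hj
  set s := (k c).2 - (k d).2 with hs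
  set m : Br → Br := fun b => if b.1 = j then (i, b.2 + s) else b with hm
  have m_add : ∀ b l, m (b + (0, l)) = m b + (0, l) := by
    intro b l
    simp only [hm]
    by_cases hb : b.1 = j
    · simp [hb]; abel
    · simp [hb]
  have hmc : m (k d) = k c := by
    simp only [hm, hj, if_true, hs]
    apply Prod.ext
    · simp [hi]
    · simp
  have m_ne : ∀ b, (m b).1 ≠ j := by
    intro b
    simp only [hm]
    split_ifs with hb
    · exact hne
    · exact hb
  have m_inv : ∀ b b', m b = m b' → b = b' ∨ (∃ l, b = k d + (0, l) ∧ b' = k c + (0, l)) ∨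
      (∃ l, b' = k d + (0, l) ∧ b = k c + (0, l)) := by
    intro b b' hbb
    by_cases h1 : b.1 = j <;> by_cases h2 : b'.1 = j
    · left
      simp only [hm, h1, h2, if_true, Prod.mk.injEq, true_and, add_left_inj] at hbb
      exact Prod.ext (h1.trans h2.symm) hbb
    · right; left
      simp only [hm, h1, h2, if_true, if_false] at hbb
      refine ⟨b.2 - (k d).2, ?_, ?_⟩
      · apply Prod.ext
        · simp [h1, hj]
        · simp
      · rw [← hbb]
        apply Prod.ext
        · simp [hi]
        · simp [hs]; abel
    · right; right
      simp only [hm, h1, h2, if_true, if_false] at hbb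
      refine ⟨b'.2 - (k d).2, ?_, ?_⟩
      · apply Prod.ext
        · simp [h2, hj]
        · simp
      · rw [hbb]
        apply Prod.ext
        · simp [hi]
        · simp [hs]; abel
    · left
      simpa only [hm, h1, h2, if_false] using hbb
  have hback : ∀ x l, k x = k d + (0, l) → k (x + N • (-l)) = k d := by
    intro x l hx
    rw [hk.eqv, hx, add_assoc]; simp
  have hback' : ∀ x l, k x = k c + (0, l) → k (x + N • (-l)) = k c := by
    intro x l hx
    rw [hk.eqv, hx, add_assoc]; simp
  have hpre : Pre G N (m ∘ k) := by
    refine ⟨?_, ?_, ?_⟩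
    · intro x l
      rw [comp_apply, hk.eqv, m_add, comp_apply]
    · intro b x hx y hy
      simp only [Set.mem_ofPred_eq, comp_apply] at hx hy
      have key : ∀ x, m (k x) = b → Reach {x | m (k x) = b} x x := fun x _ => Relation.ReflTransGen.refl
      have same : ∀ x y, m (k x) = b → k x = k y → Reach {x | (m ∘ k) x = b} x y := by
        intro x y hx hxy
        refine Reach.mono ?_ (hk.conn (k x) x rfl y hxy.symm)
        intro z hz
        simp only [Set.mem_ofPred_eq] at hz ⊢
        simp [hz, hx]
      have cross : ∀ x y l, m (k x) = b → k x = k d + (0, l) → k y = k c + (0, l) →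
          Reach {x | (m ∘ k) x = b} x y := by
        intro x y l hx h1 h2
        have e1 : k x = k (d + N • l) := by rw [hk.eqv, h1]
        have e2 : k (c + N • l) = k y := by rw [hk.eqv, h2]
        have f1 : m (k (d + N • l)) = b := by rw [← e1, hx]
        have f2 : m (k (c + N • l)) = b := by
          rw [← f1, hk.eqv, hk.eqv, m_add, m_add, hmc]
          congr 1
          simp only [hm]
          rw [if_neg (show ¬ (k c).1 = j from hne)]
        refine (same _ _ hx e1).trans (Reach.trans ?_ (same _ _ f2 e2))
        exact Relation.ReflTransGen.single ⟨f1, f2, (adj_translate _ hcd).symm⟩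
      rcases m_inv _ _ (hx.trans hy.symm) with h1 | ⟨l, h1, h2⟩ | ⟨l, h1, h2⟩
      · exact same _ _ hx h1
      · exact cross _ _ _ hx h1 h2
      · exact (cross _ _ _ hy h1 h2).symm
    · intro x y hxy har
      rcases m_inv _ _ hxy with h1 | ⟨l, h1, h2⟩ | ⟨l, h1, h2⟩
      · exact hk.free _ _ h1 har
      · exact hc2 ⟨_, _, hback _ _ h1, hback' _ _ h2, h.arrow_tr _ har⟩
      · exact hc1 ⟨_, _, hback' _ _ h2, hback _ _ h1, h.arrow_tr _ har⟩
  have := hmin _ hpre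
  have hlt : (Set.range (fun c => ((m ∘ k) c).1)).ncard < (Set.range (fun c => (k c).1)).ncard := by
    refine Set.ncard_lt_ncard ?_ (hk.fin h.pos)
    refine ⟨?_, ?_⟩
    · rintro _ ⟨x, rfl⟩
      simp only [comp_apply, hm]
      split_ifs
      · exact ⟨c, rfl⟩
      · exact ⟨x, rfl⟩
    · intro hsub
      obtain ⟨x, hx⟩ := hsub ⟨d, rfl⟩
      exact m_ne _ hx
  omega

lemma BA.symm_iff {G : ℂ ≃ₜ ℂ} {k : ℤ × ℤ → Br} {b b' : Br} : BA G.symm k b b' ↔ BA G k b' b := by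
  constructor
  · rintro ⟨c, d, h1, h2, h3⟩; exact ⟨d, c, h2, h1, arrow_symm.1 h3⟩
  · rintro ⟨c, d, h1, h2, h3⟩; exact ⟨d, c, h2, h1, arrow_symm.2 h3⟩

lemma Brk.symm {G : ℂ ≃ₜ ℂ} {N : ℤ} {k : ℤ × ℤ → Br} (h : Brk G N k) : Brk G.symm N k where
  eqv := h.eqv
  conn := h.conn
  free := fun c d hcd har => h.free d c hcd.symm (arrow_symm.1 har)
  merge := by
    intro c d hcd hne
    rw [BA.symm_iff, BA.symm_iff]
    exact (h.merge c d hcd hne).symm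

lemma BA.tr {G : ℂ ≃ₜ ℂ} {N : ℤ} {k : ℤ × ℤ → Br} (ho : Ok G N) (h : Pre G N k) {b b' : Br} (l : ℤ × ℤ)
    (hb : BA G k b b') : BA G k (b + (0, l)) (b' + (0, l)) := by
  obtain ⟨c, d, h1, h2, h3⟩ := hb
  exact ⟨_, _, by rw [h.eqv c l, h1], by rw [h.eqv d l, h2], ho.arrow_tr l h3⟩

lemma Pre.acyclic {G : ℂ ≃ₜ ℂ} {N : ℤ} {k : ℤ × ℤ → Br} (ho : Ok G N) (h : Pre G N k) (b : Br) :
    ¬ Relation.TransGen (BA G k) b b := by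
  intro hb
  refine franks ho.fpf (fun b => O {c | k c = b}) (fun b => isOpen_O _)
    (fun b => O_preconnected (h.conn b)) ?_ ?_ b ?_
  · intro i j hij
    rw [Set.disjoint_left]
    intro z hz hz'
    obtain ⟨c, hc, hc'⟩ := O_inter hz hz'
    exact hij (hc.symm.trans hc')
  · intro i z hz hz'
    obtain ⟨c, hc, d, hd, hcd⟩ := arrow_of_O hz hz'
    exact h.free c d (hc.trans hd.symm) hcd
  · refine Relation.TransGen.mono ?_ _ _ hb
    rintro b b' ⟨c, d, hc, hd, z, hz, hz'⟩
    exact ⟨z, ocell_subset_O hc hz, ocell_subset_O hd hz'⟩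

lemma cell_acyclic {G : ℂ ≃ₜ ℂ} {N : ℤ} (ho : Ok G N) (c : ℤ × ℤ) :
    ¬ Relation.TransGen (arrow G) c c := by
  intro hb
  refine franks ho.fpf ocell isOpen_ocell (fun c => (convex_ocell c).isPreconnected) ?_ ?_ c hb
  · intro i j hij
    rw [Set.disjoint_left]
    intro z hz hz'
    exact hij (cell_eq_of hz (ocell_subset _ hz'))
  · intro i z hz hz'
    exact ho.arrow_free i ⟨z, hz, hz'⟩

lemma finite_cycle {α : Type*} {S : Set α} (hS : S.Finite) (hne : S.Nonempty) (r : α → α → Prop)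
    (hr : ∀ a ∈ S, ∃ b ∈ S, r a b) : ∃ a, Relation.TransGen r a a := by
  obtain ⟨a, ha⟩ := hne
  choose! f hf hf' using hr
  have hmem : ∀ n, f^[n] a ∈ S := by
    intro n
    induction n with
    | zero => exact ha
    | succ n ih => rw [iterate_succ_apply']; exact hf _ ih
  have hch : ∀ m n, Relation.TransGen r (f^[m] a) (f^[m + (n+1)] a) := by
    intro m n
    induction n with
    | zero => rw [zero_add, iterate_succ_apply']; exact .single (hf' _ (hmem _))
    | succ n ih => 
      refine ih.tail ?_
      rw [← add_assoc m (n+1) 1, iterate_succ_apply']; exact hf' _ (hmem _)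
  obtain ⟨m, -, n, -, hmn, he⟩ := Set.infinite_univ.exists_lt_map_eq_of_mapsTo
    (f := fun n : ℕ => f^[n] a) (t := S) (fun n _ => hmem n) hS
  refine ⟨f^[m] a, ?_⟩
  obtain ⟨p, rfl⟩ : ∃ p, n = m + (p + 1) := ⟨n - m - 1, by omega⟩
  have := hch m p
  rwa [← he] at this

end FT

namespace FT

lemma det_add (v c d : ℤ × ℤ) : det v (c + d) = det v c + det v d := by simp [det]; ring
lemma det_sub (v c d : ℤ × ℤ) : det v (c - d) = det v c - det v d := by simp [det]; ring
lemma det_zsmul (v d : ℤ × ℤ) (n : ℤ) : det v (n • d) = n * det v d := by simp [det]; ring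
lemma det_zsmul_left (v d : ℤ × ℤ) (n : ℤ) : det (n • v) d = n * det v d := by simp [det]; ring
lemma det_nsmul (v d : ℤ × ℤ) (n : ℕ) : det v (n • d) = n * det v d := by simp [det]; ring

lemma arrow_det {G : ℂ ≃ₜ ℂ} {N : ℤ} (ho : Ok G N) (v : ℤ × ℤ) :
    ∃ M : ℤ, ∀ c e, arrow G c e → |det v e - det v c| ≤ M := by
  obtain ⟨M, hM⟩ := ho.bdd
  obtain ⟨K, hK⟩ := exists_int_gt ((M + 6) * ‖emb v‖)
  refine ⟨K, ?_⟩
  rintro c e ⟨z, hz, hz'⟩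
  have h1 : ‖emb e - emb c‖ ≤ M + 6 := by
    have e1 := cell_emb_dist (ocell_subset _ hz)
    have e2 := cell_emb_dist (ocell_subset _ hz')
    have e3 := hM z
    have : emb e - emb c = (G z - z) + (z - emb c) - (G z - emb e) := by ring
    rw [this]
    have := norm_sub_le ((G z - z) + (z - emb c)) (G z - emb e)
    have := norm_add_le (G z - z) (z - emb c)
    linarith
  have h2 : |((emb e - emb c) * (starRingEnd ℂ) (emb v)).im| ≤ (M + 6) * ‖emb v‖ := by
    refine (Complex.abs_im_le_norm _).trans ?_
    rw [norm_mul, RCLike.norm_conj]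
    gcongr
  rw [sub_mul, Complex.sub_im, emb_mul_conj, emb_mul_conj] at h2
  have : |((det v e - det v c : ℤ) : ℝ)| < K := by push_cast; linarith
  exact_mod_cast this.le

lemma infinite_pigeon {N : ℤ} (hN : 0 < N) {X : Set (ℤ × ℤ)} (hX : X.Infinite) :
    ∃ x ∈ X, ∃ w, w ≠ 0 ∧ x + N • w ∈ X := by
  have hf : ((Set.Icc 0 N ×ˢ Set.Icc 0 N : Set (ℤ × ℤ))).Finite :=
    (Set.finite_Icc _ _).prod (Set.finite_Icc _ _)
  obtain ⟨x, hx, y, hy, hne, hxy⟩ := hX.exists_ne_map_eq_of_mapsTo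
    (f := fun c => (c.1 % N, c.2 % N)) (t := Set.Icc 0 N ×ˢ Set.Icc 0 N)
    (by
      intro c _
      exact ⟨⟨Int.emod_nonneg _ hN.ne', (Int.emod_lt_of_pos _ hN).le⟩,
        ⟨Int.emod_nonneg _ hN.ne', (Int.emod_lt_of_pos _ hN).le⟩⟩) hf
  simp only [Prod.mk.injEq] at hxy
  have he : x + N • ((y.1 / N, y.2 / N) - (x.1 / N, x.2 / N)) = y := by
    have a1 := Int.emod_add_mul_ediv x.1 N
    have a2 := Int.emod_add_mul_ediv x.2 N
    have a3 := Int.emod_add_mul_ediv y.1 N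
    have a4 := Int.emod_add_mul_ediv y.2 N
    apply Prod.ext
    · simp; linarith [hxy.1]
    · simp; linarith [hxy.2]
  refine ⟨x, hx, (y.1 / N, y.2 / N) - (x.1 / N, x.2 / N), ?_, by rwa [he]⟩
  intro h0
  rw [h0] at he
  exact hne (by simpa using he)

lemma comp_periodic {Z : Set (ℤ × ℤ)} {u : ℤ × ℤ} (hZ : ∀ z ∈ Z, z + u ∈ Z) (hZ' : ∀ z ∈ Z, z - u ∈ Z)
    {c x : ℤ × ℤ} (hx : x ∈ comp Z c) (hxu : x + u ∈ comp Z c) :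
    (∀ z ∈ comp Z c, z + u ∈ comp Z c) ∧ (∀ z ∈ comp Z c, z - u ∈ comp Z c) := by
  constructor
  · intro z hz
    have h1 : Reach Z (c + u) (x + u) := Reach.translate u hZ hx
    have h2 : Reach Z (c + u) (z + u) := Reach.translate u hZ hz
    exact Reach.trans hxu (h1.symm.trans h2)
  · intro z hz
    have hZ'' : ∀ z ∈ Z, z + -u ∈ Z := by simpa [sub_eq_add_neg] using hZ'
    have h1 : Reach Z (c + -u) (x + u + -u) := Reach.translate (-u) hZ'' hxu
    have h2 : Reach Z (c + -u) (z + -u) := Reach.translate (-u) hZ'' hz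
    rw [add_neg_cancel_right] at h1
    rw [sub_eq_add_neg]
    exact Reach.trans hx (h1.symm.trans h2)

lemma closed_nsmul {X : Set (ℤ × ℤ)} {u : ℤ × ℤ} (hX : ∀ z ∈ X, z + u ∈ X) {x : ℤ × ℤ} (hx : x ∈ X) (n : ℕ) :
    x + n • u ∈ X := by
  induction n with
  | zero => simpa using hx
  | succ n ih => rw [succ_nsmul, ← add_assoc]; exact hX _ ih

/-- unboundedness from two periods -/
lemma unbdd_of {X : Set (ℤ × ℤ)} {u v x : ℤ × ℤ} (hX : ∀ z ∈ X, z + u ∈ X) (hX' : ∀ z ∈ X, z - u ∈ X)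
    (hx : x ∈ X) (huv : det v u ≠ 0) :
    (∀ M : ℤ, ∃ y ∈ X, M < det v y) ∧ (∀ M : ℤ, ∃ y ∈ X, det v y < M) := by
  have hX'' : ∀ z ∈ X, z + -u ∈ X := by simpa [sub_eq_add_neg] using hX'
  have key : ∀ u, det v u > 0 → (∀ z ∈ X, z + u ∈ X) → ∀ M : ℤ, ∃ y ∈ X, M < det v y := by
    intro u hu hX M
    refine ⟨x + (|M| + |det v x| + 1).toNat • u, closed_nsmul hX hx _, ?_⟩
    have hnn : 0 ≤ |M| + |det v x| + 1 := by positivity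
    rw [det_add, det_nsmul, Int.toNat_of_nonneg hnn]
    have := le_abs_self M
    have := neg_abs_le (det v x)
    nlinarith
  have key' : ∀ u, det v u < 0 → (∀ z ∈ X, z + u ∈ X) → ∀ M : ℤ, ∃ y ∈ X, det v y < M := by
    intro u hu hX M
    refine ⟨x + (|M| + |det v x| + 1).toNat • u, closed_nsmul hX hx _, ?_⟩
    have hnn : 0 ≤ |M| + |det v x| + 1 := by positivity
    rw [det_add, det_nsmul, Int.toNat_of_nonneg hnn]
    have := neg_abs_le M
    have := le_abs_self (det v x)
    nlinarith
  have hneg : det v (-u) = - det v u := by simp [det]; ring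
  rcases lt_or_gt_of_ne huv with h | h
  · exact ⟨key (-u) (by omega) hX'', key' u h hX⟩
  · exact ⟨key u h hX, key' (-u) (by omega) hX''⟩

lemma ray_exit {X : Set (ℤ × ℤ)} {v c e : ℤ × ℤ} (hc : c ∈ X) {M : ℤ} (hM : ∀ x ∈ X, |det v x| ≤ M)
    (he : det v e ≠ 0) : ∃ n : ℕ, c + n • e ∈ X ∧ ∀ m : ℕ, n < m → c + m • e ∉ X := by
  have hfin : {n : ℕ | c + n • e ∈ X}.Finite := by
    refine (Set.finite_Iic (2 * M).toNat).subset ?_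
    intro n hn
    have h1 := hM _ hn
    have h2 := hM _ hc
    rw [det_add, det_nsmul] at h1
    rw [abs_le] at h1 h2
    have h3 : 1 ≤ |det v e| := Int.one_le_abs he
    have h4 : |(n : ℤ) * det v e| ≤ 2 * M := by rw [abs_le]; constructor <;> linarith
    rw [abs_mul, Nat.abs_cast] at h4
    have : (n : ℤ) ≤ 2 * M := by nlinarith
    simp only [Set.mem_Iic]; omega
  obtain ⟨n, hn, hmax⟩ := hfin.exists_maximal ⟨0, by simpa using hc⟩
  refine ⟨n, hn, ?_⟩
  intro m hm hmX
  have := hmax hmX hm.le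
  omega

lemma ray_conn {c e : ℤ × ℤ} (hadj : ∀ c, Adj c (c + e)) (n : ℕ) :
    AdjConn {x | ∃ m : ℕ, n < m ∧ x = c + m • e} := by
  have key : ∀ m : ℕ, Reach {x | ∃ m : ℕ, n < m ∧ x = c + m • e} (c + (n+1) • e) (c + (n+1+m) • e) := by
    intro m
    induction m with
    | zero => exact Relation.ReflTransGen.refl
    | succ m ih =>
      refine ih.trans (Relation.ReflTransGen.single ⟨⟨_, by omega, rfl⟩, ⟨_, by omega, rfl⟩, ?_⟩)
      rw [← add_assoc (n+1) m 1, succ_nsmul, ← add_assoc]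
      exact hadj _
  have key' : ∀ x ∈ {x | ∃ m : ℕ, n < m ∧ x = c + m • e},
      Reach {x | ∃ m : ℕ, n < m ∧ x = c + m • e} (c + (n+1) • e) x := by
    rintro x ⟨m, hm, rfl⟩
    have := key (m - n - 1)
    rwa [show n + 1 + (m - n - 1) = m by omega] at this
  intro x hx y hy
  exact (key' x hx).symm.trans (key' y hy)

lemma reach_exit {Y X : Set (ℤ × ℤ)} {a b : ℤ × ℤ} (h : Reach Y a b) (haX : a ∈ X)
    (hbX : b ∉ X) : ∃ x ∈ X, ∃ r, r ∉ X ∧ r ∈ Y ∧ Adj x r := by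
  induction h with
  | refl => exact absurd haX hbX
  | @tail p q _ hpq ih =>
    by_cases hp : p ∈ X
    · exact ⟨p, hp, q, hbX, hpq.2.1, hpq.2.2⟩
    · exact ih hp

lemma finite_case {G : ℂ ≃ₜ ℂ} {N : ℤ} {k : ℤ × ℤ → Br} (ho : Ok G N) (h : Pre G N k)
    {X : Set (ℤ × ℤ)} (hne : X.Nonempty) (hfin : X.Finite)
    (hstar : ∀ c' ∈ X, ∀ e, arrow G c' e → e ∉ X ∧ ∀ x ∈ X, ¬ Adj x e)
    (hR : ∀ r, r ∉ X → ∀ x ∈ X, Adj x r → ∃ r' x', k r' = k r ∧ x' ∈ X ∧ arrow G r' x') : False := by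
  set R := {r | r ∉ X ∧ ∃ x ∈ X, Adj x r} with hRdef
  have hRfin : R.Finite := by
    have : (⋃ x ∈ X, (Set.Icc (x.1 - 1) (x.1 + 1) ×ˢ Set.Icc (x.2 - 1) (x.2 + 1) : Set (ℤ × ℤ))).Finite :=
      hfin.biUnion (fun x _ => (Set.finite_Icc _ _).prod (Set.finite_Icc _ _))
    refine this.subset ?_
    rintro r ⟨-, x, hx, hxr⟩
    simp only [Set.mem_iUnion]
    refine ⟨x, hx, ?_⟩
    have := adj_norm hxr
    rw [abs_le, abs_le] at this
    refine ⟨⟨?_, ?_⟩, ⟨?_, ?_⟩⟩ <;> omega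
  have hRne : R.Nonempty := by
    obtain ⟨c, hc⟩ := hne
    obtain ⟨M, hM⟩ := (hfin.image (fun x => |det (0, -1) x|)).bddAbove
    obtain ⟨n, hn, hn'⟩ := ray_exit (v := (0, -1)) (e := (1, 0)) hc (M := M) (fun x hx => hM ⟨x, hx, rfl⟩) (by simp [det])
    refine ⟨c + (n+1) • (1, 0), hn' _ (by omega), _, hn, ?_⟩
    rw [succ_nsmul, ← add_assoc]
    exact adj_right _
  obtain ⟨b, hb⟩ := finite_cycle (hRfin.image k) (hRne.image k) (BA G k) (by
    rintro _ ⟨r, ⟨hr, x, hx, hxr⟩, rfl⟩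
    obtain ⟨r', x', h1, h2, h3⟩ := hR r hr x hx hxr
    have hcn := Phi_adjConn G (h.conn (k r))
    obtain ⟨t, ht, ht'⟩ := hxr.2
    obtain ⟨e0, he0, he0'⟩ := arrow_of_cell G ht'
    obtain ⟨e1, he1, he1'⟩ := arrow_of_cell G ht
    have he0X : e0 ∉ X := by
      intro hX
      obtain ⟨h4, h5⟩ := hstar x hx e1 he1
      refine h5 e0 hX ⟨?_, _, he0', he1'⟩
      rintro rfl
      exact h4 hX
    obtain ⟨y, hy, q, hq, hqY, hyq⟩ := reach_exit (hcn x' ⟨r', h1, h3⟩ e0 ⟨r, rfl, he0⟩) h2 he0X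
    obtain ⟨r2, hr2, har⟩ := hqY
    exact ⟨k q, ⟨q, ⟨hq, y, hy, hyq⟩, rfl⟩, r2, q, hr2, rfl, har⟩)
  exact h.acyclic ho b hb

end FT

namespace FT

lemma br_zero (b : Br) : b + ((0 : ℤ × ℤ), (0 : ℤ × ℤ)) = b := add_zero b

lemma infinite_case {G : ℂ ≃ₜ ℂ} {N : ℤ} {k : ℤ × ℤ → Br} (ho : Ok G N) (h : Pre G N k)
    {X : Set (ℤ × ℤ)} (hconn : AdjConn X) (hinf : X.Infinite)
    (hbr : ∀ x ∈ X, ∀ y, k y = k x → y ∈ X)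
    (hper : ∀ x ∈ X, ∀ w, x + N • w ∈ X → (∀ z ∈ X, z + N • w ∈ X) ∧ (∀ z ∈ X, z - N • w ∈ X))
    (hstar : ∀ c' ∈ X, ∀ e, arrow G c' e → e ∉ X ∧ ∀ x ∈ X, ¬ Adj x e)
    (hR : ∀ r, r ∉ X → ∀ x ∈ X, Adj x r → ∃ r' x', k r' = k r ∧ x' ∈ X ∧ arrow G r' x') : False := by
  obtain ⟨x, hx, w, hw, hxw⟩ := infinite_pigeon ho.pos hinf
  obtain ⟨hp, hp'⟩ := hper x hx w hxw
  have hNw : N • w ≠ 0 := smul_ne_zero ho.pos.ne' hw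
  by_cases hcase : ∃ y ∈ X, ∃ w', det w w' ≠ 0 ∧ y + N • w' ∈ X
  · obtain ⟨y, hy, w', hd, hyw⟩ := hcase
    obtain ⟨hq, hq'⟩ := hper y hy w' hyw
    have hd' : det (N • w) (N • w') ≠ 0 := by
      rw [det_zsmul, det_zsmul_left]
      exact mul_ne_zero ho.pos.ne' (mul_ne_zero ho.pos.ne' hd)
    obtain ⟨u1, u2⟩ := unbdd_of hq hq' hx hd'
    obtain ⟨M, hM⟩ := arrow_det ho (N • w)
    obtain ⟨c, hcX, c', hc', har⟩ := DX hconn ⟨x, hx⟩ hNw hp hp' (Phi_adjConn G hconn)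
      (by
        intro K
        obtain ⟨y, hy, hy'⟩ := u1 (K + M)
        obtain ⟨e, he⟩ := exists_arrow G y
        have := abs_le.1 (hM _ _ he)
        exact ⟨e, ⟨y, hy, he⟩, by linarith⟩)
      (by
        intro K
        obtain ⟨y, hy, hy'⟩ := u2 (K - M)
        obtain ⟨e, he⟩ := exists_arrow G y
        have := abs_le.1 (hM _ _ he)
        exact ⟨e, ⟨y, hy, he⟩, by linarith⟩)
    exact (hstar _ hc' _ har).1 hcX
  · push Not at hcase
    -- heights are bounded
    obtain ⟨M, hM⟩ : ∃ M : ℤ, ∀ x ∈ X, |det (N • w) x| ≤ M := by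
      have hfin : ((fun x => |det (N • w) x|) '' X).Finite := by
        by_contra hinf'
        have hinf' : ((fun x => |det (N • w) x|) '' X).Infinite := hinf'
        obtain ⟨S, hSX, hSi⟩ := Set.exists_subset_bijOn X (fun x => |det (N • w) x|)
        have hS : S.Infinite := by
          intro hSf
          rw [← hSi.image_eq] at hinf'
          exact hinf' (hSf.image _)
        obtain ⟨y, hy, w', hw', hyw'⟩ := infinite_pigeon ho.pos hS
        have h0 : det w w' = 0 := by
          by_contra h0
          exact hcase y (hSX hy) w' h0 (hSX hyw')
        have : y + N • w' = y := by
          apply hSi.injOn hyw' hy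
          simp only [det_add, det_zsmul, det_zsmul_left, h0]
          simp
        exact smul_ne_zero ho.pos.ne' hw' (by simpa using this)
      obtain ⟨M, hM⟩ := hfin.bddAbove
      exact ⟨M, fun x hx => hM ⟨x, hx, rfl⟩⟩
    obtain ⟨e, he, ha, ha'⟩ : ∃ e, 0 < det (N • w) e ∧ (∀ c, Adj c (c + e)) ∧ (∀ c, Adj c (c + -e)) := by
      have sw : ∀ e, (∀ c, Adj c (c + e)) → (∀ c, Adj c (c + -e)) := by
        intro e h c
        have := (h (c + -e)).symm
        rwa [neg_add_cancel_right] at this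
      have hh : det (N • w) (1, 0) ≠ 0 ∨ det (N • w) (0, 1) ≠ 0 := by
        by_contra hcon
        push Not at hcon
        simp only [det] at hcon
        apply hNw
        apply Prod.ext
        · simpa using hcon.2
        · simpa using hcon.1
      have fin : ∀ e, det (N • w) e ≠ 0 → (∀ c, Adj c (c + e)) →
          ∃ e, 0 < det (N • w) e ∧ (∀ c, Adj c (c + e)) ∧ (∀ c, Adj c (c + -e)) := by
        intro e he ha
        rcases lt_or_gt_of_ne he with h | h
        · refine ⟨-e, ?_, sw e ha, by simpa using ha⟩
          have : det (N • w) (-e) = - det (N • w) e := by simp [det]; ring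
          omega
        · exact ⟨e, h, ha, sw e ha⟩
      rcases hh with hh | hh
      · exact fin _ hh adj_right
      · exact fin _ hh adj_up
    have hne' : det (N • w) (-e) = - det (N • w) e := by simp [det]; ring
    obtain ⟨n, hn, hn'⟩ := ray_exit hx hM he.ne'
    obtain ⟨m, hm, hm'⟩ := ray_exit (e := -e) hx hM (by omega)
    -- the two rays
    set R1 := {y | ∃ m : ℕ, n < m ∧ y = x + m • e} with hR1
    set R2 := {y | ∃ p : ℕ, m < p ∧ y = x + p • -e} with hR2
    set r1 := x + (n+1) • e with hr1
    set r2 := x + (m+1) • -e with hr2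
    have hr1X : r1 ∉ X := hn' _ (by omega)
    have hr2X : r2 ∉ X := hm' _ (by omega)
    obtain ⟨q1, x1, hq1, hx1, har1⟩ := hR r1 hr1X _ hn (by
      rw [hr1, succ_nsmul, ← add_assoc]; exact ha _)
    obtain ⟨q2, x2, hq2, hx2, har2⟩ := hR r2 hr2X _ hm (by
      rw [hr2, succ_nsmul, ← add_assoc]; exact ha' _)
    have c1 : AdjConn (Phi G.symm X) := Phi_adjConn _ hconn
    have c2 := AdjConn.union (h.conn (k r1)) (ray_conn (c := x) ha n) (x := r1) (y := r1) rfl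
      ⟨n+1, by omega, rfl⟩ (Or.inl rfl)
    have c3 := AdjConn.union (h.conn (k r2)) (ray_conn (c := x) ha' m) (x := r2) (y := r2) rfl
      ⟨m+1, by omega, rfl⟩ (Or.inl rfl)
    have c4 := AdjConn.union c1 c2 (x := q1) (y := q1) ⟨x1, hx1, arrow_symm.2 har1⟩ (Or.inl hq1) (Or.inl rfl)
    have c5 := AdjConn.union c4 c3 (x := q2) (y := q2) (Or.inl ⟨x2, hx2, arrow_symm.2 har2⟩) (Or.inl hq2) (Or.inl rfl)
    obtain ⟨y, hyX, hyY⟩ := DX hconn ⟨x, hx⟩ hNw hp hp' c5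
      (by
        intro K
        refine ⟨x + (|K| + |det (N • w) x| + 1 + n).toNat • e, Or.inl (Or.inr (Or.inr ⟨_, ?_, rfl⟩)), ?_⟩
        · have := abs_nonneg K
          have := abs_nonneg (det (N • w) x)
          omega
        · rw [det_add, det_nsmul, Int.toNat_of_nonneg (by positivity)]
          have := le_abs_self K
          have := neg_abs_le (det (N • w) x)
          have := abs_nonneg K
          have := abs_nonneg (det (N • w) x)
          nlinarith)
      (by
        intro K
        refine ⟨x + (|K| + |det (N • w) x| + 1 + m).toNat • -e, Or.inr (Or.inr ⟨_, ?_, rfl⟩), ?_⟩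
        · have := abs_nonneg K
          have := abs_nonneg (det (N • w) x)
          omega
        · rw [det_add, det_nsmul, Int.toNat_of_nonneg (by positivity), hne']
          have := neg_abs_le K
          have := le_abs_self (det (N • w) x)
          have := abs_nonneg K
          have := abs_nonneg (det (N • w) x)
          nlinarith)
    rcases hyY with (⟨z, hz, hzy⟩ | hy | ⟨p, hp1, hp2⟩) | hy | ⟨p, hp1, hp2⟩
    · exact (hstar y hyX z (arrow_symm.1 hzy)).1 hz
    · exact hr1X (hbr y hyX r1 hy.symm)
    · exact hn' p hp1 (hp2 ▸ hyX)
    · exact hr2X (hbr y hyX r2 hy.symm)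
    · exact hm' p hp1 (hp2 ▸ hyX)

/-- cells whose brick is above b modulo translations -/
def Ahat (G : ℂ ≃ₜ ℂ) (k : ℤ × ℤ → Br) (b : Br) : Set (ℤ × ℤ) :=
  {e | ∃ w : ℤ × ℤ, Relation.ReflTransGen (BA G k) b (k e + (0, w))}

lemma RT.tr {G : ℂ ≃ₜ ℂ} {N : ℤ} {k : ℤ × ℤ → Br} (ho : Ok G N) (h : Pre G N k) {b b' : Br} (l : ℤ × ℤ)
    (hb : Relation.ReflTransGen (BA G k) b b') :
    Relation.ReflTransGen (BA G k) (b + (0, l)) (b' + (0, l)) :=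
  Relation.ReflTransGen.lift (fun b => b + (0, l)) (fun _ _ h1 => BA.tr ho h l h1) _ _ hb

lemma TG.tr {G : ℂ ≃ₜ ℂ} {N : ℤ} {k : ℤ × ℤ → Br} (ho : Ok G N) (h : Pre G N k) {b b' : Br} (l : ℤ × ℤ)
    (hb : Relation.TransGen (BA G k) b b') :
    Relation.TransGen (BA G k) (b + (0, l)) (b' + (0, l)) :=
  Relation.TransGen.lift (fun b => b + (0, l)) (fun _ _ h1 => BA.tr ho h l h1) _ _ hb

lemma Ahat_tr {G : ℂ ≃ₜ ℂ} {N : ℤ} {k : ℤ × ℤ → Br} (h : Pre G N k) {b : Br} {e : ℤ × ℤ}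
    (he : e ∈ Ahat G k b) (l : ℤ × ℤ) : e + N • l ∈ Ahat G k b := by
  obtain ⟨w, hw⟩ := he
  refine ⟨w - l, ?_⟩
  rw [h.eqv, add_assoc]
  simpa using hw

lemma Ahat_tr' {G : ℂ ≃ₜ ℂ} {N : ℤ} {k : ℤ × ℤ → Br} (h : Pre G N k) {b : Br} {e : ℤ × ℤ}
    (he : e ∈ Ahat G k b) (l : ℤ × ℤ) : e - N • l ∈ Ahat G k b := by
  have := Ahat_tr h he (-l)
  rwa [smul_neg, ← sub_eq_add_neg] at this

lemma Ahat_mono {G : ℂ ≃ₜ ℂ} {k : ℤ × ℤ → Br} {b b' : Br} (hb : Relation.ReflTransGen (BA G k) b b') :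
    Ahat G k b' ⊆ Ahat G k b := by
  rintro e ⟨w, hw⟩
  exact ⟨w, hb.trans hw⟩

lemma touch {G : ℂ ≃ₜ ℂ} {N : ℤ} {k : ℤ × ℤ → Br} (ho : Ok G N) (h : Brk G N k) (c : ℤ × ℤ) :
    ∃ c' e e' x, k c' = k c ∧ arrow G c' e ∧ k e' = k e ∧ x ∈ comp {z | (k z).1 = (k c).1} c ∧
      (x = e' ∨ Adj x e') := by
  by_contra hcon
  push Not at hcon
  set Z := {z | (k z).1 = (k c).1} with hZ
  have hZp : ∀ w, ∀ z ∈ Z, z + N • w ∈ Z := by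
    intro w z hz
    simp only [hZ, Set.mem_ofPred_eq] at hz ⊢
    rw [h.eqv]; simpa using hz
  have hZm : ∀ w, ∀ z ∈ Z, z - N • w ∈ Z := by
    intro w z hz
    have := hZp (-w) z hz
    rwa [smul_neg, ← sub_eq_add_neg] at this
  set X := comp Z c with hX
  have hXZ : X ⊆ Z := comp_subset (show c ∈ Z from rfl)
  have hper : ∀ x ∈ X, ∀ w, x + N • w ∈ X → (∀ z ∈ X, z + N • w ∈ X) ∧ (∀ z ∈ X, z - N • w ∈ X) :=
    fun x hx w hxw => comp_periodic (hZp w) (hZm w) hx hxw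
  have hbr : ∀ x ∈ X, ∀ y, k y = k x → y ∈ X := by
    intro x hx y hy
    refine Reach.trans hx (Reach.mono ?_ (h.conn (k x) x rfl y hy))
    intro z hz
    have := hXZ hx
    simp only [hZ, Set.mem_ofPred_eq] at hz this ⊢
    rw [hz, this]
  have hstar : ∀ c' ∈ X, ∀ e, arrow G c' e → ∀ e', k e' = k e → e' ∉ X ∧ ∀ x ∈ X, ¬ Adj x e' := by
    intro c' hc' e har e' he'
    have h1 : (k c').1 = (k c).1 := hXZ hc'
    set w := (k c').2 - (k c).2 with hw
    have h2 : k (c' - N • w) = k c := by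
      rw [sub_eq_add_neg, ← smul_neg, h.eqv]
      apply Prod.ext
      · simpa using h1
      · simp [hw]
    have h3 : c' - N • w ∈ X := hbr c (self_mem_comp Z c) _ h2
    obtain ⟨-, hpm⟩ := hper _ h3 w (by rwa [sub_add_cancel])
    have har' : arrow G (c' - N • w) (e - N • w) := by
      have := ho.arrow_tr (-w) har
      rwa [smul_neg, ← sub_eq_add_neg, ← sub_eq_add_neg] at this
    have he2 : k (e' - N • w) = k (e - N • w) := by
      rw [sub_eq_add_neg, ← smul_neg, h.eqv, he', sub_eq_add_neg, ← smul_neg, h.eqv]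
    constructor
    · intro hX'
      exact (hcon _ _ _ _ h2 har' he2 (hpm _ hX')).1 rfl
    · intro x hx hadj
      refine (hcon _ _ _ _ h2 har' he2 (hpm _ hx)).2 ?_
      rw [sub_eq_add_neg, sub_eq_add_neg]
      exact adj_translate _ hadj
  have hR : ∀ r, r ∉ X → ∀ x ∈ X, Adj x r → ∃ r' x', k r' = k r ∧ x' ∈ X ∧ arrow G r' x' := by
    intro r hr x hx hxr
    have hne : (k x).1 ≠ (k r).1 := by
      intro he
      apply hr
      have hxZ : (k x).1 = (k c).1 := hXZ hx
      exact Reach.trans hx (Relation.ReflTransGen.single ⟨hXZ hx, he.symm.trans hxZ, hxr⟩)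
    rcases h.merge x r hxr hne with ⟨p, q, h1, h2, h3⟩ | ⟨p, q, h1, h2, h3⟩
    · exact absurd hxr ((hstar p (hbr x hx p h1) q h3 r h2.symm).2 x hx)
    · exact ⟨p, q, h1, hbr x hx q h2, h3⟩
  have hstar' : ∀ c' ∈ X, ∀ e, arrow G c' e → e ∉ X ∧ ∀ x ∈ X, ¬ Adj x e :=
    fun c' hc' e he => hstar c' hc' e he e rfl
  by_cases hfin : X.Finite
  · exact finite_case ho h.toPre ⟨c, self_mem_comp Z c⟩ hfin hstar' hR
  · exact infinite_case ho h.toPre (comp_adjConn Z c) hfin hbr hper hstar' hR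

lemma FP1 {G : ℂ ≃ₜ ℂ} {N : ℤ} {k : ℤ × ℤ → Br} (ho : Ok G N) (h : Brk G N k) {b b' : Br} (hb : BA G k b b')
    {c d : ℤ × ℤ} (hc : k c = b) (hd : k d = b') : Reach (Ahat G k b) c d := by
  obtain ⟨c', e, e', x, h1, h2, h3, h4, h5⟩ := touch ho h c
  obtain ⟨c0, d0, hc0, hd0, hcd0⟩ := hb
  have hbrick : ∀ b'', Relation.ReflTransGen (BA G k) b b'' → {z | k z = b''} ⊆ Ahat G k b := by
    intro b'' hb z hz
    refine ⟨0, ?_⟩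
    have hz : k z = b'' := hz
    rw [hz, br_zero]; exact hb
  have hPhi : Phi G {z | k z = b} ⊆ Ahat G k b := by
    rintro z ⟨y, hy, hyz⟩
    exact hbrick (k z) (.single ⟨y, z, hy, rfl, hyz⟩) rfl
  have hZ : {z | (k z).1 = (k c).1} ⊆ Ahat G k b := by
    intro z hz
    refine ⟨(k c).2 - (k z).2, ?_⟩
    have : k z + (0, (k c).2 - (k z).2) = b := by
      rw [← hc]
      apply Prod.ext
      · simpa using hz
      · simp
    rw [this]
  have hbe : BA G k b (k e) := ⟨c', e, h1.trans hc, rfl, h2⟩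
  have hx' : x ∈ {z | (k z).1 = (k c).1} := comp_subset (show c ∈ {z | (k z).1 = (k c).1} from rfl) h4
  have s1 : Reach (Ahat G k b) c x := Reach.mono hZ h4
  have s2 : Reach (Ahat G k b) x e' := by
    rcases h5 with rfl | h5
    · exact Relation.ReflTransGen.refl
    · exact Relation.ReflTransGen.single ⟨hZ hx', hbrick _ (.single hbe) h3, h5⟩
  have s3 : Reach (Ahat G k b) e' e := Reach.mono (hbrick _ (.single hbe)) (h.conn (k e) e' h3 e rfl)
  have s4 : Reach (Ahat G k b) e d0 := Reach.mono hPhi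
    (Phi_adjConn G (h.conn b) e ⟨c', h1.trans hc, h2⟩ d0 ⟨c0, hc0, hcd0⟩)
  have s5 : Reach (Ahat G k b) d0 d := Reach.mono (hbrick b' (.single ⟨c0, d0, hc0, hd0, hcd0⟩))
    (h.conn b' d0 hd0 d hd)
  exact s1.trans (s2.trans (s3.trans (s4.trans s5)))

lemma FP {G : ℂ ≃ₜ ℂ} {N : ℤ} {k : ℤ × ℤ → Br} (ho : Ok G N) (h : Brk G N k) {b b' : Br}
    (hb : Relation.TransGen (BA G k) b b')
    {c d : ℤ × ℤ} (hc : k c = b) (hd : k d = b') : Reach (Ahat G k b) c d := by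
  induction hb generalizing d with
  | single h1 => exact FP1 ho h h1 hc hd
  | @tail p q h1 h2 ih =>
    obtain ⟨c0, d0, hc0, hd0, hcd0⟩ := h2
    exact (ih hc0).trans ((FP1 ho h ⟨c0, d0, hc0, hd0, hcd0⟩ hc0 hd).mono (Ahat_mono h1.to_reflTransGen))

/-- translation semigroup of a brick -/
def SB (G : ℂ ≃ₜ ℂ) (k : ℤ × ℤ → Br) (b : Br) : Set (ℤ × ℤ) :=
  {l | Relation.TransGen (BA G k) b (b + (0, l))}

lemma RT_symm {G : ℂ ≃ₜ ℂ} {k : ℤ × ℤ → Br} {b b' : Br} :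
    Relation.ReflTransGen (BA G.symm k) b b' ↔ Relation.ReflTransGen (BA G k) b' b := by
  rw [← Relation.reflTransGen_swap]
  have : BA G.symm k = Function.swap (BA G k) := by
    funext a b; exact propext BA.symm_iff
  rw [this]

lemma TG_symm {G : ℂ ≃ₜ ℂ} {k : ℤ × ℤ → Br} {b b' : Br} :
    Relation.TransGen (BA G.symm k) b b' ↔ Relation.TransGen (BA G k) b' b := by
  rw [← Relation.transGen_swap]
  have : BA G.symm k = Function.swap (BA G k) := by
    funext a b; exact propext BA.symm_iff
  rw [this]

lemma SB_comp {G : ℂ ≃ₜ ℂ} {N : ℤ} {k : ℤ × ℤ → Br} (ho : Ok G N) (h : Brk G N k) {b : Br} {l : ℤ × ℤ}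
    (hl : l ∈ SB G k b) {c : ℤ × ℤ} (hc : k c = b) :
    (∀ z ∈ comp (Ahat G k b) c, z + N • l ∈ comp (Ahat G k b) c) ∧
    (∀ z ∈ comp (Ahat G k b) c, z - N • l ∈ comp (Ahat G k b) c) := by
  refine comp_periodic (fun z hz => Ahat_tr h.toPre hz l) (fun z hz => Ahat_tr' h.toPre hz l)
    (self_mem_comp _ _) ?_
  exact FP ho h hl hc (by rw [h.eqv, hc])

lemma MR {G : ℂ ≃ₜ ℂ} {N : ℤ} {k : ℤ × ℤ → Br} (ho : Ok G N) (h : Brk G N k) {b b' : Br} {l m : ℤ × ℤ}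
    (hl : l ∈ SB G k b) (hm : m ∈ SB G k b') (hd : det l m ≠ 0) :
    ∃ w : ℤ × ℤ, Relation.ReflTransGen (BA G k) b (b' + (0, w)) := by
  have ne : ∀ b l, l ∈ SB G k b → ∃ c, k c = b := by
    intro b l hl
    obtain ⟨b1, ⟨c, -, hc, -, -⟩, -⟩ := Relation.TransGen.head'_iff.1 hl
    exact ⟨c, hc⟩
  obtain ⟨c, hc⟩ := ne _ _ hl
  obtain ⟨c', hc'⟩ := ne _ _ hm
  have hm' : -m ∈ SB G.symm k b' := by
    have := TG.tr ho h.toPre (-m) hm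
    rw [add_assoc] at this
    exact TG_symm.2 (by simpa [br_zero] using this)
  obtain ⟨p1, p2⟩ := SB_comp ho h hl hc
  obtain ⟨q1, q2⟩ := SB_comp ho.symm h.symm hm' hc'
  have hl0 : l ≠ 0 := by rintro rfl; simp [det] at hd
  have hdd : det (N • l) (N • -m) ≠ 0 := by
    have : det l (-m) = - det l m := by simp [det]; ring
    rw [det_zsmul, det_zsmul_left, this]
    exact mul_ne_zero ho.pos.ne' (mul_ne_zero ho.pos.ne' (neg_ne_zero.2 hd))
  obtain ⟨u1, u2⟩ := unbdd_of q1 q2 (self_mem_comp _ _) hdd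
  obtain ⟨e, he, he'⟩ := DX (comp_adjConn _ _) ⟨c, self_mem_comp _ _⟩ (smul_ne_zero ho.pos.ne' hl0) p1 p2
    (comp_adjConn _ _) u1 u2
  have hcA : c ∈ Ahat G k b := ⟨0, by rw [hc, br_zero]⟩
  have hcA' : c' ∈ Ahat G.symm k b' := ⟨0, by rw [hc', br_zero]⟩
  obtain ⟨w, hw⟩ := comp_subset hcA he
  obtain ⟨w', hw'⟩ := comp_subset hcA' he'
  have hw' := RT.tr ho h.toPre (w - w') (RT_symm.1 hw')
  refine ⟨w - w', hw.trans ?_⟩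
  rw [add_assoc] at hw'
  simpa using hw'

end FT

namespace FT

/-- real linear functional on the lattice -/
def lin (p : ℝ × ℝ) (x : ℤ × ℤ) : ℝ := p.1 * x.1 + p.2 * x.2

lemma lin_add (p : ℝ × ℝ) (x y : ℤ × ℤ) : lin p (x + y) = lin p x + lin p y := by simp [lin]; ring
lemma lin_nsmul (p : ℝ × ℝ) (x : ℤ × ℤ) (n : ℕ) : lin p (n • x) = n * lin p x := by simp [lin]; ring

lemma semi_zsmul {S : Set (ℤ × ℤ)} (hadd : ∀ a ∈ S, ∀ b ∈ S, a + b ∈ S) {a : ℤ × ℤ} (ha : a ∈ S) {n : ℤ}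
    (hn : 0 < n) : n • a ∈ S := by
  obtain ⟨m, rfl⟩ : ∃ m : ℕ, n = m + 1 := ⟨(n - 1).toNat, by omega⟩
  clear hn
  induction m with
  | zero => simpa using ha
  | succ m ih =>
    have := hadd _ ih _ ha
    push_cast
    rwa [← add_one_zsmul] at this

/-- dot product -/
def dot (v c : ℤ × ℤ) : ℤ := v.1 * c.1 + v.2 * c.2

lemma dot_self_pos {v : ℤ × ℤ} (hv : v ≠ 0) : 0 < dot v v := by
  by_contra h
  simp only [dot] at h
  have h1 : v.1 = 0 := by nlinarith
  have h2 : v.2 = 0 := by nlinarith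
  exact hv (Prod.ext h1 h2)

lemma semi_collinear {S : Set (ℤ × ℤ)} (hadd : ∀ a ∈ S, ∀ b ∈ S, a + b ∈ S) (h0 : (0 : ℤ × ℤ) ∉ S)
    {v x : ℤ × ℤ} (hv : v ∈ S) (hx : x ∈ S) (hd : det v x = 0) : 0 < dot v x := by
  have hv0 : v ≠ 0 := by rintro rfl; exact h0 hv
  have hx0 : x ≠ 0 := by rintro rfl; exact h0 hx
  have hp := dot_self_pos hv0
  have e : dot v v • x = dot v x • v := by
    simp only [det] at hd
    apply Prod.ext
    · simp [dot]; linear_combination (-v.2) * hd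
    · simp [dot]; linear_combination (v.1) * hd
  by_contra hcon
  rcases eq_or_lt_of_le (not_lt.1 hcon) with h1 | h1
  · rw [h1, zero_smul] at e
    exact smul_ne_zero hp.ne' hx0 e
  · have := hadd _ (semi_zsmul hadd hx hp) _ (semi_zsmul hadd hv (neg_pos.2 h1))
    rw [e, neg_smul, add_neg_cancel] at this
    exact h0 this

lemma semi_triple {S : Set (ℤ × ℤ)} (hadd : ∀ a ∈ S, ∀ b ∈ S, a + b ∈ S) (h0 : (0 : ℤ × ℤ) ∉ S)
    {a b c : ℤ × ℤ} (ha : a ∈ S) (hb : b ∈ S) (hc : c ∈ S) (h1 : 0 < det a b) (h2 : 0 < det b c)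
    (h3 : 0 < det c a) : False := by
  have := hadd _ (hadd _ (semi_zsmul hadd ha h2) _ (semi_zsmul hadd hb h3)) _ (semi_zsmul hadd hc h1)
  apply h0
  convert this using 1
  apply Prod.ext
  · simp [det]; ring
  · simp [det]; ring

lemma semigroup_lemma {S : Set (ℤ × ℤ)} (hadd : ∀ a ∈ S, ∀ b ∈ S, a + b ∈ S) (h0 : (0 : ℤ × ℤ) ∉ S)
    (hne : S.Nonempty) : ∃ p : ℝ × ℝ, (∀ x ∈ S, 0 ≤ lin p x) ∧ ∃ x ∈ S, 0 < lin p x := by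
  obtain ⟨v, hv⟩ := hne
  have hv0 : v ≠ 0 := by rintro rfl; exact h0 hv
  have hp := dot_self_pos hv0
  have edet : ∀ x, lin (-v.2, v.1) x = det v x := by intro x; simp [lin, det]; ring
  have edet' : ∀ x, lin (v.2, -v.1) x = - det v x := by intro x; simp [lin, det]; ring
  by_cases hA : ∃ a ∈ S, 0 < det v a
  · obtain ⟨a, ha, hda⟩ := hA
    by_cases hB : ∃ b ∈ S, det v b < 0
    · obtain ⟨b, hb, hdb⟩ := hB
      have key : ∀ a ∈ S, 0 < det v a → ∀ b ∈ S, det v b < 0 →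
          (dot v b : ℝ) / det v b ≤ (dot v a : ℝ) / det v a := by
        intro a ha hda b hb hdb
        have h1 : det a b ≤ 0 := by
          by_contra h1
          refine semi_triple hadd h0 hv ha hb hda (not_le.1 h1) ?_
          have : det b v = - det v b := by simp [det]; ring
          omega
        have h2 : dot v a * det v b - det v a * dot v b = dot v v * det a b := by
          simp only [dot, det]; ring
        have h3 : dot v a * det v b ≤ det v a * dot v b := by nlinarith
        have h3' : (dot v a : ℝ) * det v b ≤ det v a * dot v b := by exact_mod_cast h3
        have hda' : (0:ℝ) < det v a := by exact_mod_cast hda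
        have hdb' : (det v b : ℝ) < 0 := by exact_mod_cast hdb
        rw [div_le_iff_of_neg hdb', div_mul_eq_mul_div, div_le_iff₀ hda']
        linarith
      set T := {t : ℝ | ∃ b ∈ S, det v b < 0 ∧ t = (dot v b : ℝ) / det v b} with hT
      have hTne : T.Nonempty := ⟨_, b, hb, hdb, rfl⟩
      have hTb : BddAbove T := ⟨_, by rintro _ ⟨b, hb, hdb, rfl⟩; exact key a ha hda b hb hdb⟩
      set θ := sSup T with hθ
      have elin : ∀ x, lin (v.1 + θ * v.2, v.2 - θ * v.1) x = dot v x - θ * det v x := by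
        intro x; simp [lin, dot, det]; ring
      refine ⟨(v.1 + θ * v.2, v.2 - θ * v.1), ?_, v, hv, ?_⟩
      · intro x hx
        rw [elin]
        rcases lt_trichotomy (det v x) 0 with h | h | h
        · have h1 : (dot v x : ℝ) / det v x ≤ θ := le_csSup hTb ⟨x, hx, h, rfl⟩
          have h' : (det v x : ℝ) < 0 := by exact_mod_cast h
          rw [div_le_iff_of_neg h'] at h1
          linarith
        · have := semi_collinear hadd h0 hv hx h
          rw [h]
          have : (0:ℝ) < dot v x := by exact_mod_cast this
          simp; linarith
        · have h1 : θ ≤ (dot v x : ℝ) / det v x := csSup_le hTne (by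
            rintro _ ⟨b, hb, hdb, rfl⟩; exact key x hx h b hb hdb)
          have h' : (0:ℝ) < det v x := by exact_mod_cast h
          rw [le_div_iff₀ h'] at h1
          linarith
      · rw [elin]
        have : det v v = 0 := by simp [det]; ring
        rw [this]
        have : (0:ℝ) < dot v v := by exact_mod_cast hp
        simpa using this
    · push Not at hB
      refine ⟨(-v.2, v.1), ?_, a, ha, ?_⟩
      · intro x hx
        rw [edet]; exact_mod_cast hB x hx
      · rw [edet]; exact_mod_cast hda
  · push Not at hA
    by_cases hB : ∃ b ∈ S, det v b < 0
    · obtain ⟨b, hb, hdb⟩ := hB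
      refine ⟨(v.2, -v.1), ?_, b, hb, ?_⟩
      · intro x hx
        rw [edet']
        have : (det v x : ℝ) ≤ 0 := by exact_mod_cast hA x hx
        linarith
      · rw [edet']
        have : (det v b : ℝ) < 0 := by exact_mod_cast hdb
        linarith
    · push Not at hB
      have e : ∀ x, lin (v.1, v.2) x = dot v x := by intro x; simp [lin, dot]
      refine ⟨(v.1, v.2), ?_, v, hv, ?_⟩
      · intro x hx
        rw [e]
        exact_mod_cast (semi_collinear hadd h0 hv hx (le_antisymm (hA x hx) (hB x hx))).le
      · rw [e]; exact_mod_cast hp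

lemma SB_add {G : ℂ ≃ₜ ℂ} {N : ℤ} {k : ℤ × ℤ → Br} (ho : Ok G N) (h : Pre G N k) {b : Br} {l m : ℤ × ℤ}
    (hl : l ∈ SB G k b) (hm : m ∈ SB G k b) : l + m ∈ SB G k b := by
  have h1 := TG.tr ho h m hl
  have h2 : b + (0, l) + (0, m) = b + (0, l + m) := by rw [add_assoc]; simp
  rw [h2] at h1
  exact Relation.TransGen.trans hm h1

lemma half_plane {G : ℂ ≃ₜ ℂ} {N : ℤ} (ho : Ok G N) :
    ∃ p : ℝ × ℝ, p ≠ 0 ∧ ∀ c l, Relation.TransGen (arrow G) c (c + N • l) → 0 ≤ lin p l := by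
  obtain ⟨k, h⟩ := brk_exists ho
  by_contra hcon
  push Not at hcon
  have hcon' : ∀ p : ℝ × ℝ, p ≠ 0 → ∃ b l, l ∈ SB G k b ∧ lin p l < 0 := by
    intro p hp
    obtain ⟨c, l, h1, h2⟩ := hcon p hp
    refine ⟨k c, l, ?_, h2⟩
    show Relation.TransGen (BA G k) _ _
    rw [← h.eqv]
    exact Relation.TransGen.lift k (fun a b hab => ⟨a, b, rfl, rfl, hab⟩) _ _ h1
  obtain ⟨b0, l0, hl0, -⟩ := hcon' (1, 0) (by simp)
  have h00 : ∀ b, (0 : ℤ × ℤ) ∉ SB G k b := by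
    intro b hb
    apply h.toPre.acyclic ho b
    have hb : Relation.TransGen (BA G k) b (b + (0, 0)) := hb
    rwa [br_zero] at hb
  obtain ⟨p, hp1, x, hx, hpx⟩ := semigroup_lemma (S := SB G k b0) (fun a ha b hb => SB_add ho h.toPre ha hb)
    (h00 b0) ⟨l0, hl0⟩
  have hp0 : p ≠ 0 := by rintro rfl; simp [lin] at hpx
  obtain ⟨b1, l1, hl1, hlt⟩ := hcon' p hp0
  -- mutual reachability
  have hreach : (∃ w, Relation.ReflTransGen (BA G k) b0 (b1 + (0, w))) ∧
      (∃ w, Relation.ReflTransGen (BA G k) b1 (b0 + (0, w))) := by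
    by_cases hd : det x l1 = 0
    · have hl10 : l1 ≠ 0 := by rintro rfl; exact h00 _ hl1
      obtain ⟨b2, l2, hl2, hlt2⟩ := hcon' (-l1.2, l1.1) (by
        intro he
        apply hl10
        rw [Prod.ext_iff] at he ⊢
        simp at he ⊢
        exact ⟨he.2, he.1⟩)
      have e2 : lin (-l1.2, l1.1) l2 = det l1 l2 := by simp [lin, det]; ring
      have d1 : det l1 l2 ≠ 0 := by
        intro h; rw [e2, h] at hlt2; simp at hlt2
      have d2 : det l2 l1 ≠ 0 := by
        have : det l2 l1 = - det l1 l2 := by simp [det]; ring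
        omega
      have hx0 : x ≠ 0 := by rintro rfl; exact h00 _ hx
      have d3 : det x l2 ≠ 0 := by
        intro h3
        have e : dot x x * det l1 l2 = 0 := by
          have : dot x x * det l1 l2 = dot x l1 * det x l2 - det x l1 * dot x l2 := by
            simp only [dot, det]; ring
          rw [this, h3, hd]; ring
        rcases mul_eq_zero.1 e with e | e
        · exact (dot_self_pos hx0).ne' e
        · exact d1 e
      have d4 : det l2 x ≠ 0 := by
        have : det l2 x = - det x l2 := by simp [det]; ring
        omega
      have trans : ∀ a b c : Br, (∃ w, Relation.ReflTransGen (BA G k) a (b + (0, w))) →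
          (∃ w, Relation.ReflTransGen (BA G k) b (c + (0, w))) →
          ∃ w, Relation.ReflTransGen (BA G k) a (c + (0, w)) := by
        rintro a b c ⟨w, hw⟩ ⟨w', hw'⟩
        refine ⟨w' + w, hw.trans ?_⟩
        have := RT.tr ho h.toPre w hw'
        rw [add_assoc] at this
        simpa using this
      exact ⟨trans _ _ _ (MR ho h hx hl2 d3) (MR ho h hl2 hl1 d2),
        trans _ _ _ (MR ho h hl1 hl2 d1) (MR ho h hl2 hx d4)⟩
    · have hd' : det l1 x ≠ 0 := by
        have : det l1 x = - det x l1 := by simp [det]; ring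
        omega
      exact ⟨MR ho h hx hl1 hd, MR ho h hl1 hx hd'⟩
  obtain ⟨⟨w, hw⟩, w', hw'⟩ := hreach
  have hall : ∀ n : ℕ, w + w' + (n + 1) • l1 ∈ SB G k b0 := by
    intro n
    have hn : (n + 1) • l1 ∈ SB G k b1 := by
      induction n with
      | zero => simpa using hl1
      | succ n ih => rw [succ_nsmul]; exact SB_add ho h.toPre ih hl1
    have h1 := TG.tr ho h.toPre w hn
    have h2 := RT.tr ho h.toPre (w + (n + 1) • l1) hw'
    have e1 : b1 + (0, (n + 1) • l1) + (0, w) = b1 + (0, w + (n + 1) • l1) := by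
      rw [add_assoc]; congr 1; rw [Prod.mk_add_mk, add_zero, add_comm]
    have e2 : b0 + (0, w') + (0, w + (n + 1) • l1) = b0 + (0, w + w' + (n + 1) • l1) := by
      rw [add_assoc]; congr 1; rw [Prod.mk_add_mk, add_zero]; congr 1; abel
    rw [e1] at h1
    rw [e2] at h2
    exact (Relation.TransGen.trans_right hw h1).trans_left h2
  obtain ⟨n, hn⟩ := exists_nat_gt (lin p (w + w') / (- lin p l1))
  have h1 := hp1 _ (hall n)
  rw [div_lt_iff₀ (by linarith)] at hn
  rw [lin_add, lin_nsmul] at h1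
  push_cast at h1
  nlinarith

end FT

namespace FT

open scoped Pointwise Classical in
lemma run_lemma {C : Set ℂ} (hC : Convex ℝ C) (hne : C.Nonempty) (x : ℕ → ℂ) (J : ℕ → Prop) (X : ℕ → ℕ)
    (hmono : Monotone X) (hX : ∀ k, J k → ¬ J (k + 1) → X k + 1 ≤ X (k + 1)) {ε K : ℝ} (hK : 0 ≤ K) (hε : 0 ≤ ε) (M : ℕ)
    (hyp : ∀ a b : ℕ, a ≤ b → b ≤ M → ∃ y ∈ ((b : ℝ) - a) • C, ‖x b - x a - y‖ ≤ ε * (b - a) + K) :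
    ∃ y ∈ (∑ k ∈ Finset.range M, if J k then (1 : ℝ) else 0) • C,
      ‖(∑ k ∈ Finset.range M, if J k then x (k + 1) - x k else 0) - y‖ ≤
        ε * (∑ k ∈ Finset.range M, if J k then (1 : ℝ) else 0) + K * (X M + 1) := by
  set T : ℕ → ℝ := fun m => ∑ k ∈ Finset.range m, if J k then (1 : ℝ) else 0 with hT
  set E : ℕ → ℂ := fun m => ∑ k ∈ Finset.range m, if J k then x (k + 1) - x k else 0 with hE
  have hT0 : ∀ m, 0 ≤ T m := fun m => Finset.sum_nonneg (fun k _ => by split_ifs <;> norm_num)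
  have inv : ∀ m, m ≤ M → ∃ a j : ℕ, a ≤ m ∧ (a < m → J (m - 1)) ∧ j ≤ X m ∧ (∀ n, a ≤ n → n + 1 = m → j ≤ X n) ∧
      E m - E a = x m - x a ∧ T m = T a + (m - a) ∧ ∃ y ∈ T a • C, ‖E a - y‖ ≤ ε * T a + K * j := by
    intro m
    induction m with
    | zero =>
      intro _
      refine ⟨0, 0, le_rfl, by simp, by simp, by simp, by simp, by simp, 0, ?_, ?_⟩
      · simp only [hT, Finset.range_zero, Finset.sum_empty]
        rw [Set.zero_smul_set hne]; simp
      · simp [hE, hT]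
    | succ m ih =>
      intro hm
      obtain ⟨a, j, h1, h2, h3, h4, h5, h6, y, hy, hy'⟩ := ih (by omega)
      by_cases hJ : J m
      · have e1 : E (m + 1) = E m + (x (m+1) - x m) := by simp [hE, Finset.sum_range_succ, hJ]
        have e2 : T (m + 1) = T m + 1 := by simp only [hT, Finset.sum_range_succ, hJ, if_true]
        refine ⟨a, j, by omega, fun _ => by simpa using hJ, h3.trans (hmono (by omega)), ?_, ?_, ?_, y, hy, hy'⟩
        · intro n han hn
          obtain rfl : n = m := by omega
          exact h3
        · rw [e1, add_sub_right_comm, h5]; ring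
        · rw [e2, h6]; push_cast; ring
      · have e1 : E (m + 1) = E m := by simp [hE, Finset.sum_range_succ, hJ]
        have e2 : T (m + 1) = T m := by simp only [hT, Finset.sum_range_succ, hJ, if_false, add_zero]
        rcases eq_or_lt_of_le h1 with rfl | hlt
        · refine ⟨a + 1, j, le_rfl, by simp, h3.trans (hmono (by omega)), by intro n; omega, by simp, by simp, ?_⟩
          rw [e1, e2]
          exact ⟨y, hy, hy'⟩
        · obtain ⟨n, rfl⟩ : ∃ n, m = n + 1 := ⟨m - 1, by omega⟩
          have hj1 : j + 1 ≤ X (n + 1) :=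
            (Nat.succ_le_succ (h4 n (by omega) rfl)).trans (hX n (by simpa using h2 hlt) hJ)
          refine ⟨n + 1 + 1, j + 1, le_rfl, by simp, hj1.trans (hmono (by omega)), by intro n; omega, by simp,
            by simp, ?_⟩
          rw [e1, e2]
          obtain ⟨y2, hy2, hy2'⟩ := hyp a (n+1) h1 (by omega)
          have hge : (0:ℝ) ≤ ((n+1 : ℕ) : ℝ) - a := by
            have : (a : ℝ) ≤ (n+1 : ℕ) := by exact_mod_cast h1
            linarith
          refine ⟨y + y2, ?_, ?_⟩
          · rw [h6, hC.add_smul (hT0 a) hge]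
            exact Set.add_mem_add hy hy2
          · have : E (n+1) - (y + y2) = (E a - y) + (x (n+1) - x a - y2) := by
              rw [← h5]; ring
            rw [this, h6]
            refine (norm_add_le _ _).trans ?_
            push_cast at hy2' ⊢
            nlinarith
  obtain ⟨a, j, h1, h2, h3, h4, h5, h6, y, hy, hy'⟩ := inv M le_rfl
  obtain ⟨y2, hy2, hy2'⟩ := hyp a M h1 le_rfl
  have hge : (0:ℝ) ≤ (M : ℝ) - a := by
    have : (a : ℝ) ≤ M := by exact_mod_cast h1
    linarith
  refine ⟨y + y2, ?_, ?_⟩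
  · show y + y2 ∈ T M • C
    rw [h6, hC.add_smul (hT0 a) hge]
    exact Set.add_mem_add hy hy2
  · show ‖E M - (y + y2)‖ ≤ ε * T M + K * (X M + 1)
    have : E M - (y + y2) = (E a - y) + (x M - x a - y2) := by
      rw [← h5]; ring
    rw [this, h6]
    refine (norm_add_le _ _).trans ?_
    have : (j : ℝ) ≤ X M := by exact_mod_cast h3
    nlinarith

open scoped Classical in
/-- entries into a set are bounded by bad steps -/
lemma entries_le (A B : ℕ → Prop) (hAB : ∀ k, A k → ¬ A (k + 1) → B k) (M : ℕ) :
    (∑ k ∈ Finset.range M, if (¬ A k ∧ A (k + 1)) then (1 : ℝ) else 0) ≤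
      1 + ∑ k ∈ Finset.range M, if B k then (1 : ℝ) else 0 := by
  have h1 : ∑ k ∈ Finset.range M, ((if A (k+1) then (1:ℝ) else 0) - if A k then (1:ℝ) else 0) =
      (if A M then (1:ℝ) else 0) - if A 0 then (1:ℝ) else 0 := Finset.sum_range_sub (fun k => if A k then (1:ℝ) else 0) M
  have h2 : ∀ k ∈ Finset.range M, (if (¬ A k ∧ A (k + 1)) then (1 : ℝ) else 0) ≤
      ((if A (k+1) then (1:ℝ) else 0) - if A k then (1:ℝ) else 0) + if B k then (1 : ℝ) else 0 := by
    intro k _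
    have := hAB k
    by_cases a1 : A k <;> by_cases a2 : A (k+1) <;> by_cases a3 : B k <;> simp_all
  refine (Finset.sum_le_sum h2).trans ?_
  rw [Finset.sum_add_distrib, h1]
  have : (if A M then (1:ℝ) else 0) - (if A 0 then (1:ℝ) else 0) ≤ 1 := by split_ifs <;> norm_num
  linarith

open scoped Classical in
/-- Abel summation with few switches -/
lemma abel_le (J B : ℕ → Prop) (hJB : ∀ k, ¬ B k → (J k ↔ J (k + 1))) (φ : ℕ → ℝ) {b : ℝ} (hφ : ∀ k, |φ k| ≤ b)
    (M : ℕ) :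
    |∑ k ∈ Finset.range M, if J k then φ (k+1) - φ k else 0| ≤
      2 * b + b * ∑ k ∈ Finset.range M, if B k then (1 : ℝ) else 0 := by
  have hb : 0 ≤ b := (abs_nonneg _).trans (hφ 0)
  have h1 := Finset.sum_range_sub (fun k => if J k then φ k else 0) M
  have h2 : ∀ k, (if J k then φ (k+1) - φ k else 0) =
      ((if J (k+1) then φ (k+1) else 0) - if J k then φ k else 0) +
        ((if J k then φ (k+1) else 0) - if J (k+1) then φ (k+1) else 0) := by
    intro k
    by_cases a1 : J k <;> by_cases a2 : J (k+1) <;> simp [a1, a2] <;> ring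
  rw [Finset.sum_congr rfl (fun k _ => h2 k), Finset.sum_add_distrib, h1]
  have h3 : |∑ k ∈ Finset.range M, ((if J k then φ (k+1) else 0) - if J (k+1) then φ (k+1) else 0)| ≤
      b * ∑ k ∈ Finset.range M, if B k then (1 : ℝ) else 0 := by
    refine (Finset.abs_sum_le_sum_abs _ _).trans ?_
    rw [Finset.mul_sum]
    refine Finset.sum_le_sum ?_
    intro k _
    have := hJB k
    have := hφ (k+1)
    by_cases a1 : J k <;> by_cases a2 : J (k+1) <;> by_cases a3 : B k <;> simp_all
  have h4 : |(if J M then φ M else 0) - if J 0 then φ 0 else 0| ≤ 2 * b := by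
    have e1 : |if J M then φ M else 0| ≤ b := by split_ifs; exact hφ _; simpa using hb
    have e2 : |if J 0 then φ 0 else 0| ≤ b := by split_ifs; exact hφ _; simpa using hb
    have := abs_sub (if J M then φ M else 0) (if J 0 then φ 0 else 0)
    linarith
  exact (abs_add_le _ _).trans (by linarith)

end FT

namespace FT

/-- edges modulo the lattice -/
def edge (N : ℤ) (c d : ℤ × ℤ) : (ℤ × ℤ) × (ℤ × ℤ) := ((c.1 % N, c.2 % N), d - c)

lemma edge_tr (N : ℤ) (c d l : ℤ × ℤ) : edge N (c + N • l) (d + N • l) = edge N c d := by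
  simp only [edge, Prod.mk.injEq]
  refine ⟨⟨?_, ?_⟩, ?_⟩
  · simp
  · simp
  · abel

lemma res_eq {N : ℤ} {c d : ℤ × ℤ} (h1 : c.1 % N = d.1 % N) (h2 : c.2 % N = d.2 % N) :
    ∃ l : ℤ × ℤ, d = c + N • l := by
  refine ⟨(d.1 / N, d.2 / N) - (c.1 / N, c.2 / N), ?_⟩
  have a1 := Int.emod_add_mul_ediv c.1 N
  have a2 := Int.emod_add_mul_ediv c.2 N
  have a3 := Int.emod_add_mul_ediv d.1 N
  have a4 := Int.emod_add_mul_ediv d.2 N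
  apply Prod.ext
  · simp; linarith
  · simp; linarith

lemma edge_eq {N : ℤ} {c d c' d' : ℤ × ℤ} (h : edge N c d = edge N c' d') :
    ∃ l : ℤ × ℤ, c' = c + N • l ∧ d' = d + N • l := by
  simp only [edge, Prod.mk.injEq] at h
  obtain ⟨⟨h1, h2⟩, h3⟩ := h
  obtain ⟨l, hl⟩ := res_eq h1 h2
  refine ⟨l, hl, ?_⟩
  have : d' = d - c + c' := by rw [h3]; abel
  rw [this, hl]; abel

lemma periodic_bdd {N : ℤ} (hN : 0 < N) (φ : ℤ × ℤ → ℝ) (hφ : ∀ x l, φ (x + N • l) = φ x) :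
    ∃ b, ∀ x, |φ x| ≤ b := by
  have hf : ((Set.Icc 0 N ×ˢ Set.Icc 0 N : Set (ℤ × ℤ))).Finite :=
    (Set.finite_Icc _ _).prod (Set.finite_Icc _ _)
  obtain ⟨b, hb⟩ := (hf.image (fun x => |φ x|)).bddAbove
  refine ⟨b, fun x => ?_⟩
  obtain ⟨l, hl⟩ := res_eq (N := N) (c := (x.1 % N, x.2 % N)) (d := x) (by simp) (by simp)
  have : φ x = φ (x.1 % N, x.2 % N) := by
    conv_lhs => rw [hl]
    rw [hφ]
  rw [this]
  exact hb ⟨(x.1 % N, x.2 % N), ⟨⟨Int.emod_nonneg _ hN.ne', (Int.emod_lt_of_pos _ hN).le⟩,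
        ⟨Int.emod_nonneg _ hN.ne', (Int.emod_lt_of_pos _ hN).le⟩⟩, rfl⟩

lemma arrow_disp {G : ℂ ≃ₜ ℂ} {N : ℤ} (ho : Ok G N) :
    ∃ M : ℝ, 0 ≤ M ∧ ∀ c e, arrow G c e → ‖emb e - emb c‖ ≤ M := by
  obtain ⟨M, hM⟩ := ho.bdd
  refine ⟨M + 6, by linarith [(norm_nonneg _).trans (hM 0)], ?_⟩
  rintro c e ⟨z, hz, hz'⟩
  have e1 := cell_emb_dist (ocell_subset _ hz)
  have e2 := cell_emb_dist (ocell_subset _ hz')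
  have e3 := hM z
  have : emb e - emb c = (G z - z) + (z - emb c) - (G z - emb e) := by ring
  rw [this]
  have := norm_sub_le ((G z - z) + (z - emb c)) (G z - emb e)
  have := norm_add_le (G z - z) (z - emb c)
  linarith

lemma edges_finite {G : ℂ ≃ₜ ℂ} {N : ℤ} (ho : Ok G N) :
    {e | ∃ c d, arrow G c d ∧ edge N c d = e}.Finite := by
  obtain ⟨M, -, hM⟩ := arrow_disp ho
  have hN := ho.pos
  have hf : (((Set.Icc 0 N ×ˢ Set.Icc 0 N) ×ˢ {c : ℤ × ℤ | ‖(0 : ℂ) - emb c‖ ≤ M} : Set ((ℤ × ℤ) × (ℤ × ℤ)))).Finite :=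
    ((Set.finite_Icc _ _).prod (Set.finite_Icc _ _)).prod (finite_emb M 0)
  refine hf.subset ?_
  rintro _ ⟨c, d, hcd, rfl⟩
  refine ⟨⟨⟨Int.emod_nonneg _ hN.ne', (Int.emod_lt_of_pos _ hN).le⟩,
        ⟨Int.emod_nonneg _ hN.ne', (Int.emod_lt_of_pos _ hN).le⟩⟩, ?_⟩
  show ‖(0 : ℂ) - emb (d - c)‖ ≤ M
  rw [zero_sub, norm_neg, sub_eq_add_neg, emb_add, emb_neg, ← sub_eq_add_neg]
  exact hM _ _ hcd

/-- relation of good edges -/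
def rH (N : ℤ) (H : Set ((ℤ × ℤ) × (ℤ × ℤ))) (c d : ℤ × ℤ) : Prop := edge N c d ∈ H

lemma rH_tr {N : ℤ} {H : Set ((ℤ × ℤ) × (ℤ × ℤ))} {c d : ℤ × ℤ} (l : ℤ × ℤ) (h : rH N H c d) :
    rH N H (c + N • l) (d + N • l) := by
  unfold rH; rw [edge_tr]; exact h

lemma rHR_tr {N : ℤ} {H : Set ((ℤ × ℤ) × (ℤ × ℤ))} {c d : ℤ × ℤ} (l : ℤ × ℤ)
    (h : Relation.ReflTransGen (rH N H) c d) : Relation.ReflTransGen (rH N H) (c + N • l) (d + N • l) :=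
  Relation.ReflTransGen.lift (fun x => x + N • l) (fun _ _ h => rH_tr l h) _ _ h

lemma rHT_tr {N : ℤ} {H : Set ((ℤ × ℤ) × (ℤ × ℤ))} {c d : ℤ × ℤ} (l : ℤ × ℤ)
    (h : Relation.TransGen (rH N H) c d) : Relation.TransGen (rH N H) (c + N • l) (d + N • l) :=
  Relation.TransGen.lift (fun x => x + N • l) (fun _ _ h => rH_tr l h) _ _ h

/-- cells reachable modulo the lattice -/
def JJ (N : ℤ) (H : Set ((ℤ × ℤ) × (ℤ × ℤ))) (c0 : ℤ × ℤ) : Set (ℤ × ℤ) :=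
  {x | ∃ w : ℤ × ℤ, Relation.ReflTransGen (rH N H) c0 (x + N • w)}

lemma JJ_self (N : ℤ) (H : Set ((ℤ × ℤ) × (ℤ × ℤ))) (c0 : ℤ × ℤ) : c0 ∈ JJ N H c0 :=
  ⟨0, by rw [smul_zero, add_zero]⟩

lemma JJ_tr {N : ℤ} {H : Set ((ℤ × ℤ) × (ℤ × ℤ))} {c0 x : ℤ × ℤ} (l : ℤ × ℤ) :
    x + N • l ∈ JJ N H c0 ↔ x ∈ JJ N H c0 := by
  constructor
  · rintro ⟨w, hw⟩
    exact ⟨l + w, by rwa [smul_add, ← add_assoc]⟩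
  · rintro ⟨w, hw⟩
    refine ⟨w - l, ?_⟩
    rwa [add_assoc, ← smul_add, add_sub_cancel]

lemma JJ_step {N : ℤ} {H : Set ((ℤ × ℤ) × (ℤ × ℤ))} {c0 x y : ℤ × ℤ} (hx : x ∈ JJ N H c0) (h : rH N H x y) :
    y ∈ JJ N H c0 := by
  obtain ⟨w, hw⟩ := hx
  exact ⟨w, hw.tail (rH_tr w h)⟩

lemma rtg_sym {N : ℤ} {H : Set ((ℤ × ℤ) × (ℤ × ℤ))}
    (hsym : ∀ c d, rH N H c d → ∃ w : ℤ × ℤ, Relation.ReflTransGen (rH N H) d (c + N • w)) {c d : ℤ × ℤ}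
    (h : Relation.ReflTransGen (rH N H) c d) : ∃ w : ℤ × ℤ, Relation.ReflTransGen (rH N H) d (c + N • w) := by
  induction h with
  | refl => exact ⟨0, by rw [smul_zero, add_zero]⟩
  | @tail p q h1 h2 ih =>
    obtain ⟨w, hw⟩ := ih
    obtain ⟨w', hw'⟩ := hsym _ _ h2
    refine ⟨w + w', hw'.trans ?_⟩
    rw [smul_add, ← add_assoc]
    exact rHR_tr w' hw

lemma potential {N : ℤ} (hN : 0 < N) {H : Set ((ℤ × ℤ) × (ℤ × ℤ))} {c0 : ℤ × ℤ}
    (hsym : ∀ c d, rH N H c d → ∃ w : ℤ × ℤ, Relation.ReflTransGen (rH N H) d (c + N • w))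
    (hac : ¬ Relation.TransGen (rH N H) c0 c0) {d0 : ℤ × ℤ} (hd0 : rH N H c0 d0) :
    ∃ (p : ℝ × ℝ) (φ : ℤ × ℤ → ℝ), (∀ x l, φ (x + N • l) = φ x) ∧
      (∀ x y, x ∈ JJ N H c0 → rH N H x y → 0 ≤ φ y - φ x + lin p (y - x) / N) ∧
      ∃ x y, x ∈ JJ N H c0 ∧ rH N H x y ∧ 0 < φ y - φ x + lin p (y - x) / N := by
  classical
  have hNR : (N : ℝ) ≠ 0 := by exact_mod_cast hN.ne'
  set S := {l : ℤ × ℤ | Relation.TransGen (rH N H) c0 (c0 + N • l)} with hS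
  have hSadd : ∀ a ∈ S, ∀ b ∈ S, a + b ∈ S := by
    intro a ha b hb
    have := rHT_tr a hb
    rw [add_assoc, ← smul_add, add_comm b a] at this
    exact Relation.TransGen.trans ha this
  have hS0 : (0 : ℤ × ℤ) ∉ S := by
    intro h
    have h : Relation.TransGen (rH N H) c0 (c0 + N • 0) := h
    rw [smul_zero, add_zero] at h
    exact hac h
  have hSne : S.Nonempty := by
    obtain ⟨w, hw⟩ := hsym _ _ hd0
    exact ⟨w, Relation.TransGen.head' hd0 hw⟩
  obtain ⟨p, hp1, x0, hx0, hpx0⟩ := semigroup_lemma hSadd hS0 hSne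
  have lin_neg : ∀ l, lin p (-l) = - lin p l := by intro l; simp [lin]; ring
  set L : ℤ × ℤ → Set ℝ := fun x => {t | ∃ l : ℤ × ℤ, Relation.ReflTransGen (rH N H) (c0 + N • l) x ∧ t = lin p l}
    with hL
  set f : ℤ × ℤ → ℝ := fun x => sSup (L x) with hf
  have hne : ∀ x ∈ JJ N H c0, (L x).Nonempty := by
    rintro x ⟨w, hw⟩
    refine ⟨_, -w, ?_, rfl⟩
    have := rHR_tr (-w) hw
    rwa [add_assoc x, ← smul_add, add_neg_cancel, smul_zero, add_zero] at this
  have hbd : ∀ x ∈ JJ N H c0, BddAbove (L x) := by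
    rintro x ⟨w, hw⟩
    obtain ⟨w', hw'⟩ := rtg_sym hsym hw
    have h1 := rHR_tr (-w) hw'
    rw [add_assoc x, ← smul_add, add_neg_cancel, smul_zero, add_zero, add_assoc, ← smul_add] at h1
    refine ⟨lin p (w' + -w), ?_⟩
    rintro _ ⟨l, hl, rfl⟩
    have h2 := rHR_tr (-l) (hl.trans h1)
    rw [add_assoc c0, ← smul_add, add_neg_cancel, smul_zero, add_zero, add_assoc, ← smul_add] at h2
    rcases Relation.reflTransGen_iff_eq_or_transGen.1 h2 with h3 | h3
    · have : (w' + -w + -l) = 0 := by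
        by_contra hne
        exact smul_ne_zero hN.ne' hne (by simpa using h3)
      have : l = w' + -w := by rw [← sub_eq_zero, ← neg_eq_zero, ← this]; abel
      rw [this]
    · have := hp1 _ h3
      rw [lin_add, lin_neg l] at this
      linarith
  have hf1 : ∀ x ∈ JJ N H c0, ∀ l, f x + lin p l ≤ f (x + N • l) := by
    intro x hx l
    have : f x ≤ f (x + N • l) - lin p l := by
      apply csSup_le (hne x hx)
      rintro _ ⟨l', hl', rfl⟩
      have : lin p (l' + l) ≤ f (x + N • l) := le_csSup (hbd _ ((JJ_tr l).2 hx)) ⟨l' + l, by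
        have := rHR_tr l hl'
        rwa [add_assoc, ← smul_add] at this, rfl⟩
      rw [lin_add] at this
      linarith
    linarith
  have hf2 : ∀ x ∈ JJ N H c0, ∀ l, f (x + N • l) = f x + lin p l := by
    intro x hx l
    refine le_antisymm ?_ (hf1 x hx l)
    have := hf1 (x + N • l) ((JJ_tr l).2 hx) (-l)
    rw [add_assoc x, ← smul_add, add_neg_cancel, smul_zero, add_zero, lin_neg] at this
    linarith
  have hf3 : ∀ x ∈ JJ N H c0, ∀ y, rH N H x y → f x ≤ f y := by
    intro x hx y hxy
    refine csSup_le_csSup (hbd y (JJ_step hx hxy)) (hne x hx) ?_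
    rintro _ ⟨l, hl, rfl⟩
    exact ⟨l, hl.tail hxy, rfl⟩
  have lin_zs : ∀ l, lin p (N • l) = N * lin p l := by intro l; simp [lin]; ring
  have lin_sub : ∀ a b, lin p (a - b) = lin p a - lin p b := by intro a b; simp [lin]; ring
  set φ : ℤ × ℤ → ℝ := fun x => if x ∈ JJ N H c0 then f x - lin p x / N else 0 with hφ
  have hD : ∀ x y, x ∈ JJ N H c0 → rH N H x y → φ y - φ x + lin p (y - x) / N = f y - f x := by
    intro x y hx hxy
    simp only [hφ, hx, JJ_step hx hxy, if_true, lin_sub]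
    ring
  refine ⟨p, φ, ?_, ?_, ?_⟩
  · intro x l
    simp only [hφ, JJ_tr]
    by_cases hx : x ∈ JJ N H c0
    · simp only [hx, if_true, hf2 x hx l, lin_add, lin_zs]
      field_simp; ring
    · simp only [hx, if_false]
  · intro x y hx hxy
    rw [hD x y hx hxy]
    linarith [hf3 x hx y hxy]
  · by_contra hcon
    push Not at hcon
    have hconst : ∀ x, Relation.ReflTransGen (rH N H) c0 x → x ∈ JJ N H c0 ∧ f x ≤ f c0 := by
      intro x hx
      induction hx with
      | refl => exact ⟨JJ_self _ _ _, le_rfl⟩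
      | @tail a b _ hab ih =>
        have := hcon a b ih.1 hab
        rw [hD a b ih.1 hab] at this
        exact ⟨JJ_step ih.1 hab, by linarith [ih.2]⟩
    have h1 := (hconst _ (Relation.TransGen.to_reflTransGen hx0)).2
    rw [hf2 _ (JJ_self _ _ _)] at h1
    linarith

end FT

namespace FT
open Filter Topology

/-- occurrence counts -/
noncomputable def cnt (P : ℕ → Prop) (M : ℕ) : ℝ :=
  open scoped Classical in ∑ k ∈ Finset.range M, if P k then (1 : ℝ) else 0

lemma cnt_nonneg (P : ℕ → Prop) (M : ℕ) : 0 ≤ cnt P M :=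
  Finset.sum_nonneg (fun k _ => by split_ifs <;> norm_num)

lemma cnt_mono {P Q : ℕ → Prop} {M : ℕ} (h : ∀ k < M, P k → Q k) : cnt P M ≤ cnt Q M := by
  classical
  refine Finset.sum_le_sum (fun k hk => ?_)
  have := h k (Finset.mem_range.1 hk)
  by_cases h1 : P k
  · simp [h1, this h1]
  · simp only [h1, if_false]; split_ifs <;> norm_num

lemma cnt_compl (P : ℕ → Prop) (M : ℕ) : cnt P M + cnt (fun k => ¬ P k) M = M := by
  classical
  unfold cnt
  rw [← Finset.sum_add_distrib]
  refine (Finset.sum_congr rfl (g := fun _ => (1:ℝ)) ?_).trans (by simp)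
  intro k _
  by_cases h : P k <;> simp [h]

/-- small sequences along an ultrafilter -/
def Sm (U : Ultrafilter ℕ) (m : ℕ → ℕ) (a : ℕ → ℝ) : Prop := ∀ δ > 0, ∀ᶠ i in (U : Filter ℕ), a i ≤ δ * m i

lemma Sm.mono {U : Ultrafilter ℕ} {m : ℕ → ℕ} {a b : ℕ → ℝ} (h : Sm U m b) (hab : ∀ i, a i ≤ b i) : Sm U m a :=
  fun δ hδ => (h δ hδ).mono (fun i hi => (hab i).trans hi)

lemma Sm.add {U : Ultrafilter ℕ} {m : ℕ → ℕ} {a b : ℕ → ℝ} (ha : Sm U m a) (hb : Sm U m b) :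
    Sm U m (fun i => a i + b i) := by
  intro δ hδ
  filter_upwards [ha (δ/2) (by linarith), hb (δ/2) (by linarith)] with i h1 h2
  linarith

lemma Sm.mul {U : Ultrafilter ℕ} {m : ℕ → ℕ} {a : ℕ → ℝ} (ha : Sm U m a) {b : ℝ} (hb : 0 ≤ b) :
    Sm U m (fun i => b * a i) := by
  intro δ hδ
  filter_upwards [ha (δ/(b+1)) (by positivity)] with i h1
  have h2 : b * a i ≤ b * (δ/(b+1) * m i) := mul_le_mul_of_nonneg_left h1 hb
  have h3 : b * (δ/(b+1) * m i) = (b/(b+1)) * (δ * m i) := by ring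
  have h4 : b/(b+1) ≤ 1 := by rw [div_le_one (by linarith)]; linarith
  have h5 : 0 ≤ δ * m i := by positivity
  nlinarith

lemma Sm.const {U : Ultrafilter ℕ} {m : ℕ → ℕ} (hm : Tendsto m U atTop) (b : ℝ) : Sm U m (fun _ => b) := by
  intro δ hδ
  obtain ⟨n, hn⟩ := exists_nat_ge (b / δ)
  filter_upwards [hm.eventually_ge_atTop n] with i hi
  rw [div_le_iff₀ hδ] at hn
  have : (n : ℝ) ≤ m i := by exact_mod_cast hi
  nlinarith

lemma bad_small {α : Type*} {U : Ultrafilter ℕ} {m : ℕ → ℕ} (e : ℕ → ℕ → α) {S : Set α} (hSf : S.Finite)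
    (hS : ∀ i k, k < m i → e i k ∈ S) {H : Set α}
    (hH : ∀ a, a ∉ H → ∀ δ > 0, ¬ ∀ᶠ i in (U : Filter ℕ), δ * m i ≤ cnt (fun k => e i k = a) (m i)) :
    Sm U m (fun i => cnt (fun k => e i k ∉ H) (m i)) := by
  classical
  intro δ hδ
  set s := hSf.toFinset with hs
  set δ' := δ / (s.card + 1) with hδ'
  have hδ'0 : 0 < δ' := by positivity
  have h1 : ∀ a ∈ s, ∀ᶠ i in (U : Filter ℕ), a ∉ H → cnt (fun k => e i k = a) (m i) ≤ δ' * m i := by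
    intro a _
    by_cases ha : a ∈ H
    · exact Eventually.of_forall (fun i h => absurd ha h)
    · have := Ultrafilter.eventually_not.2 (hH a ha δ' hδ'0)
      filter_upwards [this] with i hi _
      exact (not_le.1 hi).le
  have h2 := (Filter.eventually_all_finset s).2 h1
  filter_upwards [h2] with i hi
  have h3 : cnt (fun k => e i k ∉ H) (m i) ≤ ∑ a ∈ s, if a ∈ H then 0 else cnt (fun k => e i k = a) (m i) := by
    have : ∀ a ∈ s, (if a ∈ H then (0:ℝ) else cnt (fun k => e i k = a) (m i)) =
        ∑ k ∈ Finset.range (m i), if a ∉ H ∧ e i k = a then (1:ℝ) else 0 := by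
      intro a _
      by_cases ha : a ∈ H
      · simp [ha]
      · simp only [ha, if_false, not_false_eq_true, true_and, cnt]
    rw [Finset.sum_congr rfl this, Finset.sum_comm]
    refine Finset.sum_le_sum (fun k hk => ?_)
    split_ifs with h
    · have hk' : e i k ∈ s := hSf.mem_toFinset.2 (hS i k (Finset.mem_range.1 hk))
      calc (1 : ℝ) = if e i k ∉ H ∧ e i k = e i k then (1:ℝ) else 0 := by simp [h]
        _ ≤ _ := Finset.single_le_sum (f := fun a => if a ∉ H ∧ e i k = a then (1:ℝ) else 0)
              (fun a _ => by split_ifs <;> norm_num) hk'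
    · exact Finset.sum_nonneg (fun a _ => by split_ifs <;> norm_num)
  have h4 : ∑ a ∈ s, (if a ∈ H then 0 else cnt (fun k => e i k = a) (m i)) ≤ ∑ a ∈ s, δ' * m i := by
    refine Finset.sum_le_sum (fun a ha => ?_)
    split_ifs with h
    · positivity
    · exact hi a ha h
  rw [Finset.sum_const, nsmul_eq_mul] at h4
  have h5 : (s.card : ℝ) * (δ' * m i) ≤ δ * m i := by
    have h6 : δ' * (s.card + 1) = δ := (eq_div_iff (by positivity)).1 hδ'
    have : 0 ≤ δ' * m i := by positivity
    nlinarith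
  linarith

lemma ext_limit {C : Set ℂ} (hCc : IsCompact C) (h0 : (0:ℂ) ∈ C.extremePoints ℝ) {U : Ultrafilter ℕ} {m : ℕ → ℕ}
    (hm : Tendsto m U atTop) {T T' : ℕ → ℝ} (hT' : ∀ i, 0 ≤ T' i) (hTT : ∀ i, T i + T' i = m i)
    {E E' : ℕ → ℂ}
    (hE : ∀ ε > 0, ∀ᶠ i in (U : Filter ℕ), ∃ y ∈ C, ‖E i - T i • y‖ ≤ ε * m i)
    (hE' : ∀ ε > 0, ∀ᶠ i in (U : Filter ℕ), ∃ y ∈ C, ‖E' i - T' i • y‖ ≤ ε * m i)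
    (hEE : Sm U m (fun i => ‖E i + E' i‖)) {δ : ℝ} (hδ : 0 < δ) (hδT : ∀ᶠ i in (U : Filter ℕ), δ * m i ≤ T i) :
    Sm U m (fun i => ‖E i‖) := by
  have hne : C.Nonempty := ⟨0, h0.1⟩
  have hm0 : ∀ᶠ i in (U : Filter ℕ), (0:ℝ) < m i := by
    filter_upwards [hm.eventually_gt_atTop 0] with i hi
    exact_mod_cast hi
  have key : ∀ (A : ℕ → ℝ) (B : ℕ → ℂ), (∀ ε > 0, ∀ᶠ i in (U : Filter ℕ), ∃ y ∈ C, ‖B i - A i • y‖ ≤ ε * m i) →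
      ∃ y : ℕ → ℂ, (∀ i, y i ∈ C) ∧ (∃ l ∈ C, Tendsto y U (𝓝 l)) ∧
        Tendsto (fun i => (1 / (m i : ℝ)) • B i - (A i / m i) • y i) U (𝓝 0) := by
    intro A B h
    have : ∀ i, ∃ y ∈ C, ∀ z ∈ C, ‖B i - A i • y‖ ≤ ‖B i - A i • z‖ := by
      intro i
      obtain ⟨y, hy, hy'⟩ := hCc.exists_isMinOn hne (f := fun y => ‖B i - A i • y‖) (by fun_prop)
      exact ⟨y, hy, fun z hz => hy' hz⟩
    choose y hy hy' using this
    refine ⟨y, hy, ?_, ?_⟩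
    · have := isCompact_iff_ultrafilter_le_nhds'.1 hCc (U.map y) (by
        rw [Ultrafilter.mem_map]; exact Filter.univ_mem' hy)
      exact this
    · rw [Metric.tendsto_nhds]
      intro ε hε
      filter_upwards [h (ε/2) (by linarith), hm0] with i hi hmi
      obtain ⟨z, hz, hz'⟩ := hi
      have h1 := (hy' i z hz).trans hz'
      rw [dist_zero_right]
      have : (1 / (m i : ℝ)) • B i - (A i / m i) • y i = (1 / (m i : ℝ)) • (B i - A i • y i) := by
        rw [smul_sub, smul_smul]; congr 2; ring
      rw [this, norm_smul, Real.norm_of_nonneg (by positivity), one_div, inv_mul_lt_iff₀ hmi]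
      nlinarith
  obtain ⟨y, hy, ⟨l, hl, hyl⟩, hlim⟩ := key T E hE
  obtain ⟨y', hy', ⟨l', hl', hyl'⟩, hlim'⟩ := key T' E' hE'
  have ht : ∀ᶠ i in (U : Filter ℕ), T i / m i ∈ Set.Icc δ 1 := by
    filter_upwards [hm0, hδT] with i h1 h2
    refine ⟨by rwa [le_div_iff₀ h1], ?_⟩
    rw [div_le_one h1]
    linarith [hTT i, hT' i]
  obtain ⟨t, htm, htl⟩ := isCompact_iff_ultrafilter_le_nhds'.1 (isCompact_Icc (a := δ) (b := (1:ℝ)))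
    (U.map (fun i => T i / m i)) ht
  have htl : Tendsto (fun i => T i / m i) U (𝓝 t) := htl
  have htl' : Tendsto (fun i => T' i / m i) U (𝓝 (1 - t)) := by
    refine (tendsto_const_nhds.sub htl).congr' ?_
    filter_upwards [hm0] with i hi
    have : T' i = m i - T i := by linarith [hTT i]
    rw [this]; field_simp
  have hEl : Tendsto (fun i => (1 / (m i : ℝ)) • E i) U (𝓝 (t • l)) := by
    have := hlim.add (htl.smul hyl)
    simpa using this
  have hEl' : Tendsto (fun i => (1 / (m i : ℝ)) • E' i) U (𝓝 ((1 - t) • l')) := by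
    have := hlim'.add (htl'.smul hyl')
    simpa using this
  have hsum : Tendsto (fun i => (1 / (m i : ℝ)) • E i + (1 / (m i : ℝ)) • E' i) U (𝓝 0) := by
    rw [Metric.tendsto_nhds]
    intro ε hε
    filter_upwards [hEE (ε/2) (by linarith), hm0] with i hi hmi
    rw [dist_zero_right, ← smul_add, norm_smul, Real.norm_of_nonneg (by positivity), one_div, inv_mul_lt_iff₀ hmi]
    nlinarith
  have hzero : t • l + (1 - t) • l' = 0 := tendsto_nhds_unique (hEl.add hEl') hsum
  have ht0 : 0 < t := lt_of_lt_of_le hδ htm.1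
  have hl0 : l = 0 := by
    rcases eq_or_lt_of_le htm.2 with h | h
    · rw [h] at hzero; simpa using hzero
    · have := h0.2 hl hl' ⟨t, 1 - t, ht0, by linarith, by ring, hzero⟩
      exact this
  rw [hl0, smul_zero, Metric.tendsto_nhds] at hEl
  intro ε hε
  filter_upwards [hEl ε hε, hm0] with i hi hmi
  rw [dist_zero_right, norm_smul, Real.norm_of_nonneg (by positivity), one_div, inv_mul_lt_iff₀ hmi] at hi
  linarith

end FT

namespace FT
open Filter Topology

open scoped Pointwise Classical in
lemma run_small {C : Set ℂ} (hCv : Convex ℝ C) (hne : C.Nonempty) {U : Ultrafilter ℕ} {m : ℕ → ℕ}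
    (hm : Tendsto m U atTop) (x : ℕ → ℕ → ℂ)
    (hC : ∀ ε > 0, ∃ K : ℝ, ∀ i a b, a ≤ b → b ≤ m i → ∃ y ∈ ((b:ℝ)-a)•C, ‖x i b - x i a - y‖ ≤ ε*(b-a)+K)
    (J B : ℕ → ℕ → Prop) (hB : Sm U m (fun i => cnt (B i) (m i)))
    (hJB : ∀ i k, J i k → ¬ J i (k+1) → B i k) :
    ∀ ε > 0, ∀ᶠ i in (U : Filter ℕ), ∃ y ∈ C,
      ‖(∑ k ∈ Finset.range (m i), if J i k then x i (k + 1) - x i k else 0) - cnt (J i) (m i) • y‖ ≤ ε * m i := by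
  intro ε hε
  obtain ⟨K0, hK0⟩ := hC (ε/2) (by linarith)
  set K := max K0 0
  have hK : 0 ≤ K := le_max_right _ _
  have hsm := ((hB.add (Sm.const hm 1)).mul hK) (ε/2) (by linarith)
  filter_upwards [hsm] with i hi
  set X : ℕ → ℕ := fun n => ∑ k ∈ Finset.range n, if B i k then 1 else 0 with hX
  have hXc : ∀ n, (X n : ℝ) = cnt (B i) n := by
    intro n
    simp only [hX, cnt]
    rw [Nat.cast_sum]
    refine Finset.sum_congr rfl (fun k _ => ?_)
    split_ifs <;> simp
  obtain ⟨y, hy, hy'⟩ := run_lemma hCv hne (x i) (J i) X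
    (monotone_nat_of_le_succ (fun n => by simp only [hX, Finset.sum_range_succ]; omega))
    (fun k h1 h2 => by simp only [hX, Finset.sum_range_succ, hJB i k h1 h2, if_true]; omega)
    hK (by linarith : 0 ≤ ε/2) (m i) (fun a b hab hb => by
      obtain ⟨y, hy, hy'⟩ := hK0 i a b hab hb
      exact ⟨y, hy, hy'.trans (by linarith [le_max_left K0 0])⟩)
  obtain ⟨z, hz, rfl⟩ := Set.mem_smul_set.1 hy
  refine ⟨z, hz, ?_⟩
  have h1 : cnt (J i) (m i) ≤ m i := by linarith [cnt_compl (J i) (m i), cnt_nonneg (fun k => ¬ J i k) (m i)]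
  rw [hXc] at hy'
  have h2 : (ε/2) * cnt (J i) (m i) ≤ ε/2 * m i := mul_le_mul_of_nonneg_left h1 (by linarith)
  refine hy'.trans ?_
  show (ε/2) * cnt (J i) (m i) + _ ≤ _
  linarith

open scoped Pointwise Classical in
lemma ext_core {G : ℂ ≃ₜ ℂ} {N : ℤ} (ho : Ok G N) {C : Set ℂ} (hCc : IsCompact C) (hCv : Convex ℝ C)
    (h0 : (0:ℂ) ∈ C.extremePoints ℝ) (c : ℕ → ℕ → ℤ × ℤ) (m : ℕ → ℕ)
    (hpath : ∀ i k, k < m i → arrow G (c i k) (c i (k+1))) (hm : Tendsto m atTop atTop)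
    (hdisp : ∀ ε > 0, ∀ᶠ i in atTop, ‖emb (c i (m i)) - emb (c i 0)‖ ≤ ε * m i)
    (hC : ∀ ε > 0, ∃ K : ℝ, ∀ i a b, a ≤ b → b ≤ m i →
      ∃ y ∈ ((b:ℝ)-a)•C, ‖emb (c i b) - emb (c i a) - y‖ ≤ ε*(b-a)+K) : False := by
  have hN := ho.pos
  have hNR : (0:ℝ) < N := by exact_mod_cast hN
  set U : Ultrafilter ℕ := Filter.hyperfilter ℕ with hU
  have hUle : (U : Filter ℕ) ≤ atTop := by
    rw [← Nat.cofinite_eq_atTop]; exact Filter.hyperfilter_le_cofinite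
  have hmU : Tendsto m U atTop := hm.mono_left hUle
  have hm0 : ∀ᶠ i in (U : Filter ℕ), (0:ℝ) < m i := by
    filter_upwards [hmU.eventually_gt_atTop 0] with i hi
    exact_mod_cast hi
  set e : ℕ → ℕ → (ℤ × ℤ) × (ℤ × ℤ) := fun i k => edge N (c i k) (c i (k+1)) with he
  set H : Set ((ℤ × ℤ) × (ℤ × ℤ)) := {a | ∃ δ > 0, ∀ᶠ i in (U : Filter ℕ), δ * m i ≤ cnt (fun k => e i k = a) (m i)} with hH
  have hbad : Sm U m (fun i => cnt (fun k => e i k ∉ H) (m i)) := by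
    refine bad_small e (edges_finite ho) (fun i k hk => ⟨_, _, hpath i k hk, rfl⟩) ?_
    intro a ha δ hδ h
    exact ha ⟨δ, hδ, h⟩
  -- a sequence which is both positive density and small
  have hcontra : ∀ a : ℕ → ℝ, Sm U m a → ∀ δ > 0, (∀ᶠ i in (U : Filter ℕ), δ * m i ≤ a i) → False := by
    intro a ha δ hδ h
    have h3 : ∀ᶠ i in (U : Filter ℕ), False := by
      filter_upwards [ha (δ/2) (by linarith), h, hm0] with i h1 h2 h3
      nlinarith
    obtain ⟨_, h4⟩ := h3.exists
    exact h4
  have hedge : ∀ a ∈ H, ∃ i k, k < m i ∧ e i k = a := by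
    rintro a ⟨δ, hδ, h⟩
    by_contra hcon
    push Not at hcon
    refine hcontra _ (Sm.const hmU 0) δ hδ ?_
    filter_upwards [h] with i hi
    refine hi.trans ((cnt_mono (Q := fun _ => False) (fun k hk h => hcon i k hk h)).trans ?_)
    simp [cnt]
  have hrH : ∀ x y, rH N H x y → arrow G x y := by
    intro x y hxy
    obtain ⟨i, k, hk, hik⟩ := hedge _ hxy
    obtain ⟨l, h1, h2⟩ := edge_eq hik
    rw [h1, h2]
    exact ho.arrow_tr l (hpath i k hk)
  have hsym : ∀ x y, rH N H x y → ∃ w : ℤ × ℤ, Relation.ReflTransGen (rH N H) y (x + N • w) := by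
    intro x y hxy
    by_contra hcon
    have hxA : x ∉ JJ N H y := hcon
    obtain ⟨δ, hδ, h⟩ := id hxy
    refine hcontra _ ((Sm.const hmU 1).add hbad) δ hδ ?_
    filter_upwards [h] with i hi
    have h1 := entries_le (fun k => c i k ∈ JJ N H y) (fun k => e i k ∉ H)
      (fun k h1 h2 h3 => h2 (JJ_step h1 h3)) (m i)
    refine hi.trans (le_trans (cnt_mono (P := fun k => e i k = edge N x y)
      (Q := fun k => ¬ c i k ∈ JJ N H y ∧ c i (k+1) ∈ JJ N H y) ?_) (le_trans (le_of_eq ?_) h1))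
    swap
    · unfold cnt
      refine Finset.sum_congr rfl (fun k _ => ?_)
      congr 1
    intro k hk hek
    obtain ⟨l, h1, h2⟩ := edge_eq hek.symm
    rw [h1, h2, JJ_tr, JJ_tr]
    exact ⟨hxA, JJ_self _ _ _⟩
  have hHne : ∃ a, a ∈ H := by
    by_contra hcon
    push Not at hcon
    refine hcontra _ hbad 1 one_pos ?_
    filter_upwards with i
    have := cnt_compl (fun k => e i k ∈ H) (m i)
    have h2 : cnt (fun k => e i k ∈ H) (m i) = 0 := by simp [cnt, hcon]
    linarith
  obtain ⟨a, ha⟩ := hHne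
  obtain ⟨i0, k0, hk0, hik0⟩ := hedge a ha
  set c0 := c i0 k0
  set d0 := c i0 (k0+1)
  have hd0 : rH N H c0 d0 := by
    show e i0 k0 ∈ H
    rw [hik0]; exact ha
  have hac : ¬ Relation.TransGen (rH N H) c0 c0 := fun h =>
    cell_acyclic ho c0 (Relation.TransGen.mono hrH _ _ h)
  obtain ⟨p, φ, hφ, hD, x0, y0, hx0, hxy0, hD0⟩ := potential hN hsym hac hd0
  set J := JJ N H c0 with hJ
  have hJiff : ∀ x y, rH N H x y → (x ∈ J ↔ y ∈ J) := by
    intro x y hxy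
    refine ⟨fun h => JJ_step h hxy, ?_⟩
    rintro ⟨w, hw⟩
    obtain ⟨w', hw'⟩ := hsym x y hxy
    refine ⟨w' + w, ?_⟩
    have := hw.trans (rHR_tr w hw')
    rwa [add_assoc, ← smul_add] at this
  have hJe : ∀ i k, ¬ (e i k ∉ H) → (c i k ∈ J ↔ c i (k+1) ∈ J) := fun i k h => hJiff _ _ (not_not.1 h)
  obtain ⟨δ, hδ, hcnt⟩ := id hxy0
  set E : ℕ → ℂ := fun i => ∑ k ∈ Finset.range (m i), if c i k ∈ J then emb (c i (k+1)) - emb (c i k) else 0 with hE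
  set E' : ℕ → ℂ := fun i => ∑ k ∈ Finset.range (m i), if ¬ c i k ∈ J then emb (c i (k+1)) - emb (c i k) else 0 with hE'
  have hne : C.Nonempty := ⟨0, h0.1⟩
  have hEsm : Sm U m (fun i => ‖E i‖) := by
    refine ext_limit hCc h0 hmU (T := fun i => cnt (fun k => c i k ∈ J) (m i))
      (T' := fun i => cnt (fun k => ¬ c i k ∈ J) (m i)) (fun i => cnt_nonneg _ _) (fun i => cnt_compl _ _) (E := E) (E' := E')
      ?_ ?_ ?_ hδ ?_
    · exact run_small hCv hne hmU (fun i k => emb (c i k)) hC (fun i k => c i k ∈ J) (fun i k => e i k ∉ H) hbad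
        (fun i k h1 h2 => by
          by_contra h3
          exact h2 ((hJe i k (not_not.2 h3)).1 h1))
    · have := run_small hCv hne hmU (fun i k => emb (c i k)) hC (fun i k => ¬ c i k ∈ J) (fun i k => e i k ∉ H) hbad
        (fun i k h1 h2 => by
          by_contra h3
          exact h1 ((hJe i k (not_not.2 h3)).2 (not_not.1 h2)))
      convert this
    · intro ε hε
      filter_upwards [hUle (hdisp ε hε)] with i hi
      have : E i + E' i = emb (c i (m i)) - emb (c i 0) := by
        rw [← Finset.sum_range_sub (fun k => emb (c i k)), hE, hE']
        simp only []
        rw [← Finset.sum_add_distrib]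
        refine Finset.sum_congr rfl (fun k _ => ?_)
        by_cases h : c i k ∈ J <;> simp [h]
      rw [this]; exact hi
    · filter_upwards [hcnt] with i hi
      refine hi.trans (cnt_mono ?_)
      intro k hk hek
      obtain ⟨l, h1, h2⟩ := edge_eq hek.symm
      rw [h1, hJ, JJ_tr]; exact hx0
  -- the potential
  obtain ⟨b, hb⟩ := periodic_bdd hN φ hφ
  have hb0 : 0 ≤ b := (abs_nonneg _).trans (hb 0)
  obtain ⟨M, hM0, hM⟩ := arrow_disp ho
  set L : ℂ →ₗ[ℝ] ℝ := p.1 • Complex.reLm + p.2 • Complex.imLm with hL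
  have hLemb : ∀ x y : ℤ × ℤ, lin p (y - x) = L (emb y - emb x) := by
    intro x y; simp [lin, hL, emb]
  set P := |p.1| + |p.2| with hP
  have hP0 : 0 ≤ P := by positivity
  have hLb : ∀ z, |L z| ≤ P * ‖z‖ := by
    intro z
    have : L z = p.1 * z.re + p.2 * z.im := by simp [hL]
    rw [this, hP, add_mul]
    refine (abs_add_le _ _).trans ?_
    rw [abs_mul, abs_mul]
    gcongr
    · exact Complex.abs_re_le_norm z
    · exact Complex.abs_im_le_norm z
  set D : ℤ × ℤ → ℤ × ℤ → ℝ := fun x y => φ y - φ x + lin p (y - x) / N with hDd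
  set B := 2 * b + P * M / N with hB
  have hB0 : 0 ≤ B := by positivity
  have hDB : ∀ x y, arrow G x y → |D x y| ≤ B := by
    intro x y hxy
    simp only [hDd, hLemb]
    have h1 := (hLb (emb y - emb x)).trans (mul_le_mul_of_nonneg_left (hM x y hxy) hP0)
    have h2 : |L (emb y - emb x) / N| ≤ P * M / N := by
      rw [abs_div, abs_of_pos hNR]; gcongr
    have h3 := abs_add_le (φ y - φ x) (L (emb y - emb x) / N)
    have h4 := abs_sub (φ y) (φ x)
    linarith [hb y, hb x]
  set S : ℕ → ℝ := fun i => ∑ k ∈ Finset.range (m i), if c i k ∈ J then D (c i k) (c i (k+1)) else 0 with hS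
  have hSup : Sm U m S := by
    have h1 : Sm U m (fun i => (2 * b + b * cnt (fun k => e i k ∉ H) (m i)) + P / N * ‖E i‖) :=
      ((Sm.const hmU (2*b)).add (hbad.mul hb0)).add (hEsm.mul (by positivity))
    refine h1.mono (fun i => ?_)
    have h2 := (le_abs_self _).trans (abel_le (fun k => c i k ∈ J) (fun k => e i k ∉ H) (hJe i) (fun k => φ (c i k)) (b := b)
      (fun k => hb _) (m i))
    have h3 : S i = (∑ k ∈ Finset.range (m i), if c i k ∈ J then φ (c i (k+1)) - φ (c i k) else 0) + L (E i) / N := by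
      rw [hS, hE, map_sum, Finset.sum_div, ← Finset.sum_add_distrib]
      refine Finset.sum_congr rfl (fun k _ => ?_)
      by_cases h : c i k ∈ J
      · simp only [h, if_true, hDd, hLemb]
      · simp [h]
    have h4 : L (E i) / N ≤ P / N * ‖E i‖ := by
      rw [div_mul_eq_mul_div]
      gcongr
      exact (le_abs_self _).trans (hLb _)
    rw [h3]
    exact add_le_add h2 h4
  have hSlow : ∀ i, D x0 y0 * cnt (fun k => e i k = edge N x0 y0) (m i) ≤ S i + B * cnt (fun k => e i k ∉ H) (m i) := by
    intro i
    simp only [hS, cnt, Finset.mul_sum]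
    rw [← Finset.sum_add_distrib]
    refine Finset.sum_le_sum (fun k hk => ?_)
    by_cases h1 : e i k ∉ H
    · have h2 : e i k ≠ edge N x0 y0 := fun h => h1 (by rw [h]; exact hxy0)
      have h3 := abs_le.1 (hDB _ _ (hpath i k (Finset.mem_range.1 hk)))
      simp only [h1, h2, if_false, if_true, not_false_eq_true]
      split_ifs <;> linarith
    · have h1' : rH N H (c i k) (c i (k+1)) := not_not.1 h1
      simp only [h1, if_false]
      by_cases h2 : c i k ∈ J
      · simp only [h2, if_true]
        by_cases h3 : e i k = edge N x0 y0
        · simp only [h3, if_true]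
          obtain ⟨l, h4, h5⟩ := edge_eq h3.symm
          have : D (c i k) (c i (k+1)) = D x0 y0 := by
            simp only [hDd, h4, h5, hφ]
            congr 3; abel
          rw [this]; linarith
        · simp only [h3, if_false]
          have := hD _ _ h2 h1'
          simp only [hDd]; linarith
      · have h3 : e i k ≠ edge N x0 y0 := by
          intro h3
          obtain ⟨l, h4, h5⟩ := edge_eq h3.symm
          apply h2
          rw [h4, hJ, JJ_tr]; exact hx0
        simp [h2, h3]
  refine hcontra _ (hSup.add (hbad.mul hB0)) (D x0 y0 * δ) (mul_pos hD0 hδ) ?_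
  filter_upwards [hcnt] with i hi
  refine le_trans ?_ (hSlow i)
  rw [mul_assoc]
  exact mul_le_mul_of_nonneg_left hi hD0.le

end FT

namespace FT
open Filter Topology

lemma itinerary (G : ℂ ≃ₜ ℂ) (x : ℂ) (n : ℕ) : ∃ (z : ℂ) (c : ℕ → ℤ × ℤ),
    (∀ k, G^[k] z ∈ ocell (c k)) ∧ ∀ k ≤ n, ‖G^[k] z - G^[k] x‖ ≤ 1 := by
  set D : Set ℂ := ⋃ c, ocell c with hD
  have hDo : IsOpen D := isOpen_iUnion isOpen_ocell
  have hDd : Dense D := by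
    rw [dense_iff_inter_open]
    rintro N hN ⟨z, hz⟩
    obtain ⟨c, hc⟩ := cell_cover z
    obtain ⟨y, hy⟩ := cell_meets hc hN hz
    first
    | exact ⟨y, hy.2, Set.mem_iUnion.2 ⟨c, hy.1⟩⟩
    | exact ⟨y, hy.1, Set.mem_iUnion.2 ⟨c, hy.2⟩⟩
  have hcont : ∀ k, Continuous (G^[k]) := fun k => G.continuous.iterate k
  have hd : Dense (⋂ k : ℕ, G^[k] ⁻¹' D) :=
    dense_iInter_of_isOpen_nat (fun k => hDo.preimage (hcont k))
      (fun k => hDd.preimage (by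
        induction k with
        | zero => exact IsOpenMap.id
        | succ k ih => exact ih.comp G.isOpenMap))
  have hV : IsOpen (⋂ k ∈ Finset.range (n+1), G^[k] ⁻¹' Metric.ball (G^[k] x) 1) :=
    isOpen_biInter_finset (fun k _ => Metric.isOpen_ball.preimage (hcont k))
  obtain ⟨z, hz1, hz2⟩ := dense_iff_inter_open.1 hd _ hV ⟨x, by simp⟩
  have : ∀ k, ∃ c, G^[k] z ∈ ocell c := by
    intro k
    exact Set.mem_iUnion.1 (Set.mem_iInter.1 hz2 k)
  choose c hc using this
  refine ⟨z, c, hc, fun k hk => ?_⟩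
  have := Set.mem_iInter₂.1 hz1 k (Finset.mem_range.2 (by omega))
  rw [Set.mem_preimage, Metric.mem_ball, dist_eq_norm] at this
  exact this.le

lemma itinerary_arrow {G : ℂ ≃ₜ ℂ} {z : ℂ} {c : ℕ → ℤ × ℤ} (h : ∀ k, G^[k] z ∈ ocell (c k)) (k : ℕ) :
    arrow G (c k) (c (k+1)) :=
  ⟨_, h k, by rw [← Function.iterate_succ_apply' (⇑G)]; exact h (k+1)⟩

lemma path_lower {G : ℂ ≃ₜ ℂ} {N : ℤ} {p : ℝ × ℝ}
    (hp : ∀ c l, Relation.TransGen (arrow G) c (c + N • l) → 0 ≤ lin p l) (hN : 0 < N) {B : ℝ}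
    (hB : ∀ c d, arrow G c d → -B ≤ lin p (d - c)) (hB0 : 0 ≤ B) (n : ℕ) :
    ∀ (s : Finset (ℤ × ℤ)), s.card = n → ∀ (m : ℕ) (c : ℕ → ℤ × ℤ), (∀ k < m, arrow G (c k) (c (k+1))) →
      (∀ k ≤ m, ((c k).1 % N, (c k).2 % N) ∈ s) → -(B * n) ≤ lin p (c m - c 0) := by
  classical
  have lin_zs : ∀ l, lin p (N • l) = N * lin p l := by intro l; simp [lin]; ring
  have hNR : (0:ℝ) < N := by exact_mod_cast hN
  induction n with
  | zero =>
    intro s hs m c _ h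
    rw [Finset.card_eq_zero] at hs
    have := h 0 (by omega)
    rw [hs] at this
    simp at this
  | succ n ih =>
    intro s hs m c hc h
    set P : ℕ → Prop := fun j => ((c j).1 % N, (c j).2 % N) = ((c 0).1 % N, (c 0).2 % N) with hP
    set j := Nat.findGreatest P m with hj
    have hjm : j ≤ m := Nat.findGreatest_le m
    have hPj : P j := Nat.findGreatest_spec (P := P) (Nat.zero_le m) rfl
    have hreach : ∀ i ≤ m, Relation.ReflTransGen (arrow G) (c 0) (c i) := by
      intro i
      induction i with
      | zero => intro _; exact Relation.ReflTransGen.refl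
      | succ i ih2 => intro hi; exact (ih2 (by omega)).tail (hc i (by omega))
    have h1 : 0 ≤ lin p (c j - c 0) := by
      simp only [hP, Prod.mk.injEq] at hPj
      obtain ⟨l, hl⟩ := res_eq hPj.1.symm hPj.2.symm
      rcases Relation.reflTransGen_iff_eq_or_transGen.1 (hreach j hjm) with h3 | h3
      · rw [h3]; simp [lin]
      · rw [hl] at h3 ⊢
        rw [add_sub_cancel_left, lin_zs]
        exact mul_nonneg hNR.le (hp _ _ h3)
    have lin_split : ∀ a b d : ℤ × ℤ, lin p (a - d) = lin p (a - b) + lin p (b - d) := by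
      intro a b d; simp [lin]; ring
    push_cast
    rcases eq_or_lt_of_le hjm with h2 | h2
    · rw [h2] at h1
      have : 0 ≤ B * (n + 1) := by positivity
      linarith
    · have h3 := ih (s.erase ((c 0).1 % N, (c 0).2 % N)) (by
          rw [Finset.card_erase_of_mem (h 0 (by omega)), hs]; rfl) (m - (j+1)) (fun k => c (j + 1 + k))
        (fun k hk => hc (j+1+k) (by omega)) (fun k hk => by
          refine Finset.mem_erase.2 ⟨?_, h _ (by omega)⟩
          exact Nat.findGreatest_is_greatest (P := P) (n := m) (k := j+1+k) (by omega) (by omega))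
      have h4 := hB _ _ (hc j h2)
      have e1 : j + 1 + (m - (j+1)) = m := by omega
      simp only [e1, add_zero] at h3
      rw [lin_split (c m) (c (j+1)) (c 0), lin_split (c (j+1)) (c j) (c 0)]
      linarith

lemma lower {G : ℂ ≃ₜ ℂ} {N : ℤ} (ho : Ok G N) : ∃ p : ℝ × ℝ, p ≠ 0 ∧ ∃ K : ℝ, ∀ (m : ℕ) (x : ℂ),
    -K ≤ p.1 * (G^[m] x - x).re + p.2 * (G^[m] x - x).im := by
  classical
  obtain ⟨p, hp0, hp⟩ := half_plane ho
  obtain ⟨M, hM0, hM⟩ := arrow_disp ho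
  have hN := ho.pos
  set P := |p.1| + |p.2| with hP
  have hP0 : 0 ≤ P := by positivity
  have hLb : ∀ z : ℂ, |p.1 * z.re + p.2 * z.im| ≤ P * ‖z‖ := by
    intro z
    rw [hP, add_mul]
    refine (abs_add_le _ _).trans ?_
    rw [abs_mul, abs_mul]
    gcongr
    · exact Complex.abs_re_le_norm z
    · exact Complex.abs_im_le_norm z
  have hlin : ∀ c d : ℤ × ℤ, lin p (d - c) = p.1 * (emb d - emb c).re + p.2 * (emb d - emb c).im := by
    intro c d; simp [lin, emb]
  have hB : ∀ c d, arrow G c d → -(P * M) ≤ lin p (d - c) := by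
    intro c d h
    rw [hlin]
    have := (hLb (emb d - emb c)).trans (mul_le_mul_of_nonneg_left (hM _ _ h) hP0)
    exact (abs_le.1 this).1
  set s : Finset (ℤ × ℤ) := Finset.Ico 0 N ×ˢ Finset.Ico 0 N with hs
  refine ⟨p, hp0, P * M * s.card + P * 8, fun m x => ?_⟩
  obtain ⟨z, c, hc, hzx⟩ := itinerary G x m
  have h1 := path_lower hp hN hB (by positivity) s.card s rfl m c (fun k _ => itinerary_arrow hc k) (fun k _ => by
    simp [hs, Int.emod_nonneg _ hN.ne', Int.emod_lt_of_pos _ hN])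
  rw [hlin] at h1
  have e1 := hzx m le_rfl
  have e2 := hzx 0 (by omega)
  have e3 := cell_emb_dist (ocell_subset _ (hc m))
  have e4 := cell_emb_dist (ocell_subset _ (hc 0))
  simp only [Function.iterate_zero, id] at e2 e4
  set w := (emb (c m) - emb (c 0)) - (G^[m] x - x) with hw
  have e5 : ‖w‖ ≤ 8 := by
    have : w = (G^[m] z - G^[m] x) - (G^[m] z - emb (c m)) - (z - x) + (z - emb (c 0)) := by rw [hw]; ring
    rw [this]
    refine (norm_add_le _ _).trans ?_
    have := norm_sub_le ((G^[m] z - G^[m] x) - (G^[m] z - emb (c m))) (z - x)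
    have := norm_sub_le (G^[m] z - G^[m] x) (G^[m] z - emb (c m))
    linarith
  have e6 := (abs_le.1 ((hLb w).trans (mul_le_mul_of_nonneg_left e5 hP0))).2
  have e7 : emb (c m) - emb (c 0) = w + (G^[m] x - x) := by rw [hw]; ring
  rw [e7, Complex.add_re, Complex.add_im] at h1
  linarith

end FT

namespace FT
open Filter Topology

lemma compact_hull {s : Set ℂ} (hs : IsCompact s) : IsCompact (convexHull ℝ s) := by
  classical
  set f : ((ℂ × ℂ × ℂ) × ℝ × ℝ) → ℂ := fun q =>
    (1 - q.2.1) • q.1.1 + q.2.1 • ((1 - q.2.2) • q.1.2.1 + q.2.2 • q.1.2.2) with hf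
  have hfc : Continuous f := by rw [hf]; fun_prop
  have : convexHull ℝ s = f '' ((s ×ˢ s ×ˢ s) ×ˢ (Set.Icc 0 1 ×ˢ Set.Icc 0 1)) := by
    apply Set.Subset.antisymm
    · intro x hx
      rw [convexHull_eq_union] at hx
      simp only [Set.mem_iUnion] at hx
      obtain ⟨t, hts, hai, hx⟩ := hx
      have hcard : t.card ≤ 3 := by
        have := hai.card_le_finrank_succ
        have h2 : Module.finrank ℝ (vectorSpan ℝ (Set.range ((↑) : t → ℂ))) ≤ 2 := by
          rw [← Complex.finrank_real_complex]; exact Submodule.finrank_le _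
        rw [Fintype.card_coe] at this
        omega
      have hne : t.card ≠ 0 := by
        intro h
        rw [Finset.card_eq_zero] at h
        rw [h] at hx; simp at hx
      have h3 : ∃ a b c, t = {a, b, c} := by
        have : t.card = 1 ∨ t.card = 2 ∨ t.card = 3 := by omega
        rcases this with h | h | h
        · obtain ⟨a, rfl⟩ := Finset.card_eq_one.1 h
          exact ⟨a, a, a, by simp⟩
        · obtain ⟨a, b, _, rfl⟩ := Finset.card_eq_two.1 h
          exact ⟨a, b, b, by simp⟩
        · obtain ⟨a, b, c, _, _, _, rfl⟩ := Finset.card_eq_three.1 h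
          exact ⟨a, b, c, rfl⟩
      obtain ⟨a, b, c, rfl⟩ := h3
      have ha : a ∈ s := hts (by simp)
      have hb : b ∈ s := hts (by simp)
      have hc : c ∈ s := hts (by simp)
      have e : ((({a, b, c} : Finset ℂ)) : Set ℂ) = insert a {b, c} := by simp
      rw [e, convexHull_insert ⟨b, by simp⟩, convexHull_pair] at hx
      obtain ⟨a', ha', y, hy, hx⟩ := mem_convexJoin.1 hx
      rw [Set.mem_singleton_iff] at ha'; subst ha'
      obtain ⟨u1, v1, h1, h2, h3, rfl⟩ := hy
      obtain ⟨u2, v2, h4, h5, h6, rfl⟩ := hx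
      refine ⟨((a', b, c), v2, v1), ⟨⟨ha, hb, hc⟩, ⟨h5, by linarith⟩, h2, by linarith⟩, ?_⟩
      simp only [hf]
      rw [show 1 - v2 = u2 by linarith, show 1 - v1 = u1 by linarith]
    · rintro _ ⟨⟨⟨a, b, c⟩, u, v⟩, ⟨⟨ha, hb, hc⟩, ⟨h1, h2⟩, h3, h4⟩, rfl⟩
      have hv := convex_convexHull ℝ s
      have ha := subset_convexHull ℝ s ha
      have hb := subset_convexHull ℝ s hb
      have hc := subset_convexHull ℝ s hc
      exact hv ha (hv hb hc (by simpa using h4) h3 (by simp)) (by simpa using h2) h1 (by simp)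
  rw [this]
  exact ((hs.prod (hs.prod hs)).prod (isCompact_Icc.prod isCompact_Icc)).image hfc

lemma fund_domain (z : ℂ) : ∃ (l : ℤ × ℤ) (z0 : ℂ), ‖z0‖ ≤ 3 ∧ z = z0 + emb l := by
  obtain ⟨c, hc⟩ := cell_cover z
  exact ⟨c, z - emb c, cell_emb_dist hc, by ring⟩

/-- lifts to the plane -/
def Lift (F : ℂ ≃ₜ ℂ) : Prop := ∀ z l, F (z + emb l) = F z + emb l

lemma Lift.iter {F : ℂ ≃ₜ ℂ} (h : Lift F) (n : ℕ) (z : ℂ) (l : ℤ × ℤ) : F^[n] (z + emb l) = F^[n] z + emb l := by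
  induction n generalizing z with
  | zero => rfl
  | succ n ih => rw [Function.iterate_succ_apply, Function.iterate_succ_apply, h, ih]

lemma Lift.bdd {F : ℂ ≃ₜ ℂ} (h : Lift F) : ∃ M, 0 ≤ M ∧ ∀ z, ‖F z - z‖ ≤ M := by
  obtain ⟨M, hM⟩ := (isCompact_closedBall (0:ℂ) 3).exists_bound_of_continuousOn (f := fun z => F z - z)
    (F.continuous.sub continuous_id).continuousOn
  have : ∀ z, ‖F z - z‖ ≤ M := by
    intro z
    obtain ⟨l, z0, h0, rfl⟩ := fund_domain z
    have := hM z0 (by simpa using h0)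
    rw [h, add_sub_add_right_eq_sub]; exact this
  exact ⟨M, (norm_nonneg _).trans (this 0), this⟩

lemma Lift.gap {F : ℂ ≃ₜ ℂ} (h : Lift F) (hf : ∀ z, F z ≠ z) : ∃ η > 0, ∀ z, η ≤ ‖F z - z‖ := by
  obtain ⟨y, hy, hmin⟩ := (isCompact_closedBall (0:ℂ) 3).exists_isMinOn ⟨0, by simp⟩ (f := fun z => ‖F z - z‖)
    (F.continuous.sub continuous_id).norm.continuousOn
  refine ⟨‖F y - y‖, norm_pos_iff.2 (sub_ne_zero.2 (hf y)), fun z => ?_⟩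
  obtain ⟨l, z0, h0, rfl⟩ := fund_domain z
  have : ‖F y - y‖ ≤ ‖F z0 - z0‖ := hmin (by simpa using h0 : z0 ∈ Metric.closedBall (0:ℂ) 3)
  rw [h, add_sub_add_right_eq_sub]; exact this

lemma iter_bdd {F : ℂ → ℂ} {M : ℝ} (hM : ∀ z, ‖F z - z‖ ≤ M) (n : ℕ) (z : ℂ) : ‖F^[n] z - z‖ ≤ n * M := by
  induction n with
  | zero => simp
  | succ n ih =>
    rw [Function.iterate_succ_apply']
    have : F (F^[n] z) - z = (F (F^[n] z) - F^[n] z) + (F^[n] z - z) := by ring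
    rw [this]
    refine (norm_add_le _ _).trans ?_
    push_cast
    linarith [hM (F^[n] z)]

/-- average displacements -/
def tail (F : ℂ → ℂ) (m : ℕ) : Set ℂ := closure {y | ∃ n x, m < n ∧ y = (1 / (n:ℝ)) • (F^[n] x - x)}

/-- rotation set -/
def rho (F : ℂ → ℂ) : Set ℂ := ⋂ m, tail F m

lemma tail_compact {F : ℂ → ℂ} {M : ℝ} (hM : ∀ z, ‖F z - z‖ ≤ M) (m : ℕ) : IsCompact (tail F m) := by
  refine (isCompact_closedBall (0:ℂ) M).of_isClosed_subset isClosed_closure ?_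
  refine closure_minimal ?_ Metric.isClosed_closedBall
  rintro _ ⟨n, x, hn, rfl⟩
  have hn' : (0:ℝ) < n := by exact_mod_cast (by omega : 0 < n)
  rw [mem_closedBall_zero_iff, norm_smul, Real.norm_of_nonneg (by positivity), one_div, inv_mul_le_iff₀ hn']
  exact iter_bdd hM n x

lemma tail_anti (F : ℂ → ℂ) : Antitone (tail F) := by
  intro a b hab
  refine closure_mono ?_
  rintro _ ⟨n, x, hn, rfl⟩
  exact ⟨n, x, by omega, rfl⟩

lemma rho_compact {F : ℂ → ℂ} {M : ℝ} (hM : ∀ z, ‖F z - z‖ ≤ M) : IsCompact (rho F) :=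
  (tail_compact hM 0).of_isClosed_subset (isClosed_iInter (fun _ => isClosed_closure)) (Set.iInter_subset _ 0)

lemma rho_near {F : ℂ → ℂ} {M : ℝ} (hM : ∀ z, ‖F z - z‖ ≤ M) {ε : ℝ} (hε : 0 < ε) :
    ∃ n0, ∀ n > n0, ∀ x, ∃ y ∈ rho F, ‖F^[n] x - x - (n:ℝ) • y‖ ≤ ε * n := by
  obtain ⟨n0, hn0⟩ := exists_subset_nhds_of_isCompact (V := tail F) (tail_anti F).directed_ge
    (tail_compact hM) (U := Metric.thickening ε (rho F))
    (fun x hx => Metric.isOpen_thickening.mem_nhds (Metric.self_subset_thickening hε _ hx))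
  refine ⟨n0, fun n hn x => ?_⟩
  obtain ⟨y, hy, hd⟩ := Metric.mem_thickening_iff.1 (hn0 (subset_closure ⟨n, x, hn, rfl⟩))
  refine ⟨y, hy, ?_⟩
  have hn' : (0:ℝ) < n := by exact_mod_cast (by omega : 0 < n)
  have : F^[n] x - x - (n:ℝ) • y = (n:ℝ) • ((1 / (n:ℝ)) • (F^[n] x - x) - y) := by
    rw [smul_sub, smul_smul, mul_one_div_cancel hn'.ne', one_smul]
  rw [this, norm_smul, Real.norm_of_nonneg hn'.le, ← dist_eq_norm, mul_comm]
  exact mul_le_mul_of_nonneg_right hd.le hn'.le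

lemma rho_approx {F : ℂ → ℂ} {w : ℂ} (hw : w ∈ rho F) (m : ℕ) {ε : ℝ} (hε : 0 < ε) :
    ∃ n > m, ∃ x, ‖F^[n] x - x - (n:ℝ) • w‖ ≤ ε * n := by
  have h := Set.mem_iInter.1 hw m
  obtain ⟨_, ⟨n, x, hn, rfl⟩, hd⟩ := Metric.mem_closure_iff.1 h ε hε
  refine ⟨n, hn, x, ?_⟩
  have hn' : (0:ℝ) < n := by exact_mod_cast (by omega : 0 < n)
  have : F^[n] x - x - (n:ℝ) • w = (n:ℝ) • ((1 / (n:ℝ)) • (F^[n] x - x) - w) := by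
    rw [smul_sub, smul_smul, mul_one_div_cancel hn'.ne', one_smul]
  rw [this, norm_smul, Real.norm_of_nonneg hn'.le, ← dist_eq_norm, mul_comm, dist_comm]
  exact mul_le_mul_of_nonneg_right hd.le hn'.le

lemma hull_near {F : ℂ → ℂ} {M : ℝ} (hM : ∀ z, ‖F z - z‖ ≤ M) {w : ℂ} (hw : w ∈ convexHull ℝ (rho F))
    {ε : ℝ} (hε : 0 < ε) :
    ∃ K, ∀ n x, ∃ y ∈ convexHull ℝ (rho F), ‖F^[n] x - x - (n:ℝ) • y‖ ≤ ε * n + K := by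
  obtain ⟨n0, hn0⟩ := rho_near hM hε
  have hM0 : 0 ≤ M := (norm_nonneg _).trans (hM 0)
  refine ⟨n0 * (M + ‖w‖), fun n x => ?_⟩
  by_cases hn : n0 < n
  · obtain ⟨y, hy, h⟩ := hn0 n hn x
    exact ⟨y, subset_convexHull ℝ _ hy, h.trans (le_add_of_nonneg_right (by positivity))⟩
  · refine ⟨w, hw, (norm_sub_le _ _).trans ?_⟩
    have h1 := iter_bdd hM n x
    rw [norm_smul, Real.norm_of_nonneg (Nat.cast_nonneg n)]
    have h2 : (n:ℝ) ≤ n0 := by exact_mod_cast not_lt.1 hn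
    have h3 : (n:ℝ) * (M + ‖w‖) ≤ n0 * (M + ‖w‖) := mul_le_mul_of_nonneg_right h2 (by positivity)
    have h4 : 0 ≤ ε * n := by positivity
    linarith

lemma periodic_mem {F : ℂ ≃ₜ ℂ} (h : Lift F) {q : ℕ} (hq : 0 < q) {l : ℤ × ℤ} {x : ℂ} (hx : F^[q] x = x + emb l) :
    (1 / (q:ℝ)) • emb l ∈ rho F := by
  have key : ∀ k : ℕ, F^[q * k] x = x + (k:ℝ) • emb l := by
    intro k
    induction k with
    | zero => simp
    | succ k ih =>
      have e : (k:ℝ) • emb l = emb (k • l) := by apply Complex.ext <;> simp [emb]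
      rw [mul_add, mul_one, add_comm, Function.iterate_add_apply, ih, e, h.iter, hx, ← e]
      push_cast
      rw [add_smul, one_smul]; ring
  refine Set.mem_iInter.2 (fun m => subset_closure ⟨q * (m+1), x, by nlinarith, ?_⟩)
  rw [key, add_sub_cancel_left, smul_smul]
  congr 1
  have : (q:ℝ) ≠ 0 := by exact_mod_cast hq.ne'
  push_cast
  field_simp

end FT

namespace FT
open Filter Topology

lemma iter_homeo (F : ℂ ≃ₜ ℂ) (q : ℕ) : ∃ Fq : ℂ ≃ₜ ℂ, ∀ z, Fq z = F^[q] z := by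
  induction q with
  | zero => exact ⟨Homeomorph.refl ℂ, fun z => rfl⟩
  | succ q ih =>
    obtain ⟨A, hA⟩ := ih
    exact ⟨F.trans A, fun z => by rw [Homeomorph.trans_apply, hA, Function.iterate_succ_apply]⟩

lemma exists_G {F : ℂ ≃ₜ ℂ} (hF : Lift F) {q : ℕ} {l : ℤ × ℤ} (hno : ∀ x, F^[q] x ≠ x + emb l) :
    ∃ (N : ℤ) (G : ℂ ≃ₜ ℂ), Ok G N ∧
      ∀ (m : ℕ) x, G^[m] ((N:ℝ) • x) = (N:ℝ) • (F^[q * m] x - (m:ℝ) • emb l) := by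
  obtain ⟨Fq, hFq⟩ := iter_homeo F q
  set G0 : ℂ ≃ₜ ℂ := Fq.trans (Homeomorph.addRight (-emb l)) with hG0
  have hG0a : ∀ z, G0 z = F^[q] z - emb l := by
    intro z; simp [hG0, hFq, sub_eq_add_neg]
  have hG0L : Lift G0 := by
    intro z k
    rw [hG0a, hG0a, hF.iter]; ring
  obtain ⟨η, hη, hgap⟩ := hG0L.gap (fun z h => hno z (by rw [hG0a] at h; rw [← sub_eq_iff_eq_add]; exact h))
  obtain ⟨M, hM0, hM⟩ := hG0L.bdd
  obtain ⟨n, hn⟩ := exists_nat_gt (3 / η)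
  have hn0 : (0:ℝ) < n := lt_trans (by positivity) hn
  have hnC : (n:ℂ) ≠ 0 := by
    have : (n:ℝ) ≠ 0 := hn0.ne'
    exact_mod_cast this
  set S := Homeomorph.mulLeft₀ (n:ℂ) hnC with hS
  set G : ℂ ≃ₜ ℂ := (S.symm.trans G0).trans S with hG
  have hSa : ∀ x, S x = (n:ℝ) • x := by intro x; simp [hS]
  have hGa : ∀ x, G ((n:ℝ) • x) = (n:ℝ) • G0 x := by
    intro x
    rw [← hSa, ← hSa]
    simp [hG]
  have hsur : ∀ z : ℂ, ∃ x : ℂ, z = (n:ℝ) • x := fun z => ⟨S.symm z, by rw [← hSa]; simp⟩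
  have hnorm : ∀ x, ‖G ((n:ℝ) • x) - (n:ℝ) • x‖ = n * ‖G0 x - x‖ := by
    intro x
    rw [hGa, ← smul_sub, norm_smul, Real.norm_of_nonneg hn0.le]
  have hfar : ∀ z, 3 < ‖G z - z‖ := by
    intro z
    obtain ⟨x, rfl⟩ := hsur z
    rw [hnorm]
    rw [div_lt_iff₀ hη] at hn
    have := hgap x
    nlinarith
  have hbdd : ∀ z, ‖G z - z‖ ≤ n * M := by
    intro z
    obtain ⟨x, rfl⟩ := hsur z
    rw [hnorm]
    exact mul_le_mul_of_nonneg_left (hM x) hn0.le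
  refine ⟨n, G, ⟨?_, ?_, ⟨OP.of_bdd G _ hbdd, ?_⟩, hfar, _, hbdd⟩, ?_⟩
  · exact_mod_cast hn0
  · intro z k
    obtain ⟨x, rfl⟩ := hsur z
    have e : emb (((n:ℕ):ℤ) • k) = (n:ℝ) • emb k := by apply Complex.ext <;> simp [emb]
    rw [e, ← smul_add, hGa, hGa, hG0L, smul_add]
  · intro z h
    have := hfar z
    rw [h, sub_self, norm_zero] at this
    linarith
  · intro m x
    simp only [Int.cast_natCast]
    induction m with
    | zero => simp
    | succ m ih =>
      rw [Function.iterate_succ_apply', ih, hGa, hG0a]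
      have e : F^[q * m] x - (m:ℝ) • emb l = F^[q * m] x + emb (-((m:ℤ) • l)) := by
        rw [sub_eq_add_neg, emb_neg]
        congr 2
        apply Complex.ext <;> simp [emb]
      have e2 : emb (-((m:ℤ) • l)) = - (m:ℝ) • emb l := by
        apply Complex.ext <;> simp [emb]
      rw [e, hF.iter, mul_add, mul_one, add_comm (q * m), Function.iterate_add_apply, e2]
      congr 1
      push_cast
      rw [add_smul, one_smul, neg_smul]; ring

lemma cut {F : ℂ → ℂ} {M : ℝ} (hM : ∀ z, ‖F z - z‖ ≤ M) {q : ℕ} (hq : 0 < q) (w : ℂ) (n : ℕ) (x : ℂ) :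
    ‖(F^[n] x - x - (n:ℝ) • w) - (F^[q * (n / q)] x - x - ((q * (n / q) : ℕ) : ℝ) • w)‖ ≤ q * (M + ‖w‖) := by
  have hM0 : 0 ≤ M := (norm_nonneg _).trans (hM 0)
  set k := q * (n / q) with hk
  set r := n % q with hr
  have hn : n = r + k := (Nat.mod_add_div n q).symm
  have hrq : (r:ℝ) ≤ q := by exact_mod_cast (Nat.mod_lt n hq).le
  have e1 : F^[n] x = F^[r] (F^[k] x) := by rw [← Function.iterate_add_apply, ← hn]
  have e2 : (F^[n] x - x - (n:ℝ) • w) - (F^[k] x - x - (k : ℝ) • w) = (F^[r] (F^[k] x) - F^[k] x) - (r:ℝ) • w := by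
    rw [e1]
    have : (n:ℝ) = r + k := by exact_mod_cast hn
    rw [this, add_smul]; ring
  rw [e2]
  refine (norm_sub_le _ _).trans ?_
  have h1 := iter_bdd hM r (F^[k] x)
  rw [norm_smul, Real.norm_of_nonneg (Nat.cast_nonneg r)]
  have : (r:ℝ) * (M + ‖w‖) ≤ q * (M + ‖w‖) := mul_le_mul_of_nonneg_right hrq (by positivity)
  linarith

lemma support {F : ℂ ≃ₜ ℂ} (hF : Lift F) {q : ℕ} (hq : 0 < q) {l : ℤ × ℤ} (hno : ∀ x, F^[q] x ≠ x + emb l) :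
    ∃ p : ℝ × ℝ, p ≠ 0 ∧ ∀ y ∈ convexHull ℝ (rho F),
      0 ≤ p.1 * (y - (1 / (q:ℝ)) • emb l).re + p.2 * (y - (1 / (q:ℝ)) • emb l).im := by
  obtain ⟨N, G, ho, hG⟩ := exists_G hF hno
  obtain ⟨p, hp0, K, hK⟩ := lower ho
  obtain ⟨M, hM0, hM⟩ := hF.bdd
  have hN : (0:ℝ) < N := by exact_mod_cast ho.pos
  have hqR : (0:ℝ) < q := by exact_mod_cast hq
  set w := (1 / (q:ℝ)) • emb l with hw
  set L : ℂ →ₗ[ℝ] ℝ := p.1 • Complex.reLm + p.2 • Complex.imLm with hL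
  have hLz : ∀ z, p.1 * z.re + p.2 * z.im = L z := by intro z; simp [hL]
  set P := |p.1| + |p.2| with hP
  have hP0 : 0 ≤ P := by positivity
  have hLb : ∀ z, |L z| ≤ P * ‖z‖ := by
    intro z
    rw [← hLz, hP, add_mul]
    refine (abs_add_le _ _).trans ?_
    rw [abs_mul, abs_mul]
    gcongr
    · exact Complex.abs_re_le_norm z
    · exact Complex.abs_im_le_norm z
  have h1 : ∀ (m : ℕ) x, -(K / N) ≤ L (F^[q * m] x - x - ((q * m : ℕ) : ℝ) • w) := by
    intro m x
    have h2 := hK m ((N:ℝ) • x)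
    rw [hLz, hG] at h2
    have e : (N:ℝ) • (F^[q * m] x - (m:ℝ) • emb l) - (N:ℝ) • x =
        (N:ℝ) • (F^[q * m] x - x - ((q * m : ℕ) : ℝ) • w) := by
      rw [← smul_sub, hw, smul_smul]
      congr 1
      have : ((q * m : ℕ) : ℝ) * (1 / q) = m := by push_cast; field_simp
      rw [this]; ring
    rw [e, map_smul, smul_eq_mul] at h2
    rw [neg_le, ← neg_le_neg_iff, neg_neg]
    rw [← neg_div, div_le_iff₀ hN]
    linarith
  set K2 := K / N + P * (q * (M + ‖w‖)) with hK2
  have h2 : ∀ (n : ℕ) x, -K2 ≤ L (F^[n] x - x - (n:ℝ) • w) := by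
    intro n x
    have h3 := cut hM hq w n x
    have h4 := (abs_le.1 ((hLb _).trans (mul_le_mul_of_nonneg_left h3 hP0))).1
    rw [map_sub] at h4
    have := h1 (n/q) x
    linarith
  have h3 : ∀ y ∈ rho F, 0 ≤ L (y - w) := by
    intro y hy
    by_contra hneg
    push Not at hneg
    set t := - L (y - w) with ht
    have ht0 : 0 < t := by linarith
    obtain ⟨m, hm⟩ := exists_nat_gt (2 * K2 / t)
    obtain ⟨n, hn, x, hx⟩ := rho_approx hy m (ε := t / (2 * (P + 1))) (by positivity)
    have h4 := (abs_le.1 ((hLb _).trans (mul_le_mul_of_nonneg_left hx hP0))).2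
    have h5 := h2 n x
    have e : F^[n] x - x - (n:ℝ) • w = (F^[n] x - x - (n:ℝ) • y) + (n:ℝ) • (y - w) := by
      rw [smul_sub]; ring
    rw [e, map_add, map_smul, smul_eq_mul] at h5
    have hn' : (m:ℝ) < n := by exact_mod_cast hn
    have h6 : P * (t / (2 * (P + 1)) * n) ≤ t / 2 * n := by
      have : P * (t / (2 * (P + 1)) * n) = (P / (P+1)) * (t / 2 * n) := by field_simp
      rw [this]
      refine mul_le_of_le_one_left (by positivity) ?_
      rw [div_le_one (by linarith)]; linarith
    have h7 : (n:ℝ) * L (y - w) = - (n * t) := by rw [ht]; ring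
    have h8 : 2 * K2 < n * t := by
      rw [div_lt_iff₀ ht0] at hm
      nlinarith
    linarith
  refine ⟨p, hp0, fun y hy => ?_⟩
  rw [hLz]
  have hsub : convexHull ℝ (rho F) ⊆ {y | L w ≤ L y} := by
    refine convexHull_min ?_ (convex_halfSpace_ge L.isLinear _)
    intro y hy
    have := h3 y hy
    rw [map_sub] at this
    show L w ≤ L y
    linarith
  have : L w ≤ L y := hsub hy
  rw [map_sub]; linarith

end FT

namespace FT
open Filter Topology

open scoped Pointwise in
lemma not_extreme {F : ℂ ≃ₜ ℂ} (hF : Lift F) {q : ℕ} (hq : 0 < q) {l : ℤ × ℤ} (hno : ∀ x, F^[q] x ≠ x + emb l) :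
    (1 / (q:ℝ)) • emb l ∉ (convexHull ℝ (rho F)).extremePoints ℝ := by
  intro hext
  obtain ⟨N, G, ho, hG⟩ := exists_G hF hno
  obtain ⟨M, hM0, hM⟩ := hF.bdd
  have hN : (0:ℝ) < N := by exact_mod_cast ho.pos
  have hqR : (0:ℝ) < q := by exact_mod_cast hq
  set w := (1 / (q:ℝ)) • emb l with hw
  have hwr : w ∈ rho F := extremePoints_convexHull_subset hext
  have hwC : w ∈ convexHull ℝ (rho F) := hext.1
  have hcomp : IsCompact (convexHull ℝ (rho F)) := compact_hull (rho_compact hM)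
  set C := convexHull ℝ (rho F) with hC
  have hCv : Convex ℝ C := convex_convexHull ℝ _
  set κ : ℝ := N * q with hκ
  have hκ0 : 0 < κ := by positivity
  set C' : Set ℂ := (fun y => κ • (y - w)) '' C with hC'
  have hC'c : IsCompact C' := hcomp.image (by fun_prop)
  have hC'v : Convex ℝ C' := by
    rintro _ ⟨y1, h1, rfl⟩ _ ⟨y2, h2, rfl⟩ a b ha hb hab
    refine ⟨a • y1 + b • y2, hCv h1 h2 ha hb hab, ?_⟩
    have e : w = a • w + b • w := by rw [← add_smul, hab, one_smul]
    simp only []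
    nth_rewrite 1 [e]
    simp only [Complex.real_smul]; ring
  have hC'e : (0:ℂ) ∈ C'.extremePoints ℝ := by
    refine ⟨⟨w, hwC, by simp⟩, ?_⟩
    rintro _ ⟨y1, h1, rfl⟩ _ ⟨y2, h2, rfl⟩ ⟨a, b, ha, hb, hab, h⟩
    have e : w = a • w + b • w := by rw [← add_smul, hab, one_smul]
    have e2 : κ • (a • y1 + b • y2 - w) = 0 := by
      rw [← h]
      nth_rewrite 1 [e]
      simp only [Complex.real_smul]; ring
    have e3 : a • y1 + b • y2 = w := by
      rcases smul_eq_zero.1 e2 with h3 | h3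
      · exact absurd h3 hκ0.ne'
      · exact sub_eq_zero.1 h3
    have := hext.2 h1 h2 ⟨a, b, ha, hb, hab, e3⟩
    simp [this]
  have hGd : ∀ (m : ℕ) x, G^[m] ((N:ℝ) • x) - (N:ℝ) • x = (N:ℝ) • (F^[q * m] x - x - ((q * m : ℕ) : ℝ) • w) := by
    intro m x
    rw [hG, ← smul_sub, hw, smul_smul]
    congr 1
    have : ((q * m : ℕ) : ℝ) * (1 / q) = m := by push_cast; field_simp
    rw [this]; ring
  have hseq : ∀ i : ℕ, ∃ n > q * i, ∃ x, ‖F^[n] x - x - (n:ℝ) • w‖ ≤ (1 / ((i:ℝ) + 1)) * n := fun i =>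
    rho_approx hwr (q * i) (by positivity)
  choose n hn x hx using hseq
  set m : ℕ → ℕ := fun i => n i / q with hm
  have hmi : ∀ i, i ≤ m i := fun i => by
    rw [hm, Nat.le_div_iff_mul_le hq, mul_comm]
    exact (hn i).le
  choose z c hzc hzx using fun i => itinerary G ((N:ℝ) • x i) (m i)
  set K1 := q * (M + ‖w‖) with hK1
  have hK10 : 0 ≤ K1 := by positivity
  refine ext_core ho hC'c hC'v hC'e c m (fun i k _ => itinerary_arrow (hzc i) k)
    (tendsto_atTop_mono hmi tendsto_id) ?_ ?_
  · intro ε hε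
    set A := 8 + N * (K1 + q) with hA
    obtain ⟨I, hI⟩ := exists_nat_ge (2 * A / ε + 2 * κ / ε)
    filter_upwards [eventually_ge_atTop I] with i hi
    have hiR : 2 * A / ε + 2 * κ / ε ≤ i := hI.trans (by exact_mod_cast hi)
    have hA0 : 0 ≤ A := by positivity
    have ha1 : 2 * A / ε ≤ i := le_trans (le_add_of_nonneg_right (by positivity)) hiR
    have ha2 : 2 * κ / ε ≤ i := le_trans (le_add_of_nonneg_left (by positivity)) hiR
    rw [div_le_iff₀ hε] at ha1 ha2
    have hmR : (i:ℝ) ≤ m i := by exact_mod_cast hmi i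
    have e1 := hzx i (m i) le_rfl
    have e2 := hzx i 0 (by omega)
    have e3 := cell_emb_dist (ocell_subset _ (hzc i (m i)))
    have e4 := cell_emb_dist (ocell_subset _ (hzc i 0))
    simp only [Function.iterate_zero, id] at e2 e4
    have e5 := cut hM hq w (n i) (x i)
    have e6 : ‖F^[q * m i] (x i) - x i - ((q * m i : ℕ) : ℝ) • w‖ ≤ K1 + (1 / ((i:ℝ) + 1)) * n i := by
      have := norm_sub_le (F^[n i] (x i) - x i - (n i:ℝ) • w)
        ((F^[n i] (x i) - x i - (n i:ℝ) • w) - (F^[q * m i] (x i) - x i - ((q * m i : ℕ) : ℝ) • w))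
      rw [sub_sub_cancel] at this
      refine this.trans ?_
      rw [add_comm]
      exact add_le_add e5 (hx i)
    have e7 : ‖G^[m i] ((N:ℝ) • x i) - (N:ℝ) • x i‖ ≤ N * (K1 + (1 / ((i:ℝ) + 1)) * n i) := by
      rw [hGd, norm_smul, Real.norm_of_nonneg hN.le]
      exact mul_le_mul_of_nonneg_left e6 hN.le
    have e8 : (n i : ℝ) ≤ q * m i + q := by
      have h1 := Nat.mod_add_div (n i) q
      have h2 := (Nat.mod_lt (n i) hq).le
      have : n i ≤ q * m i + q := by
        show n i ≤ q * (n i / q) + q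
        omega
      exact_mod_cast this
    have e9 : (1 / ((i:ℝ) + 1)) * n i ≤ (1 / ((i:ℝ) + 1)) * (q * m i) + q := by
      have h1 : (1 / ((i:ℝ) + 1)) * n i ≤ (1 / ((i:ℝ) + 1)) * (q * m i + q) :=
        mul_le_mul_of_nonneg_left e8 (by positivity)
      have h2 : (1 / ((i:ℝ) + 1)) * q ≤ q := by
        refine mul_le_of_le_one_left hqR.le ?_
        rw [div_le_one (by positivity)]
        linarith [(Nat.cast_nonneg i : (0:ℝ) ≤ i)]
      linarith
    have e10 : N * ((1 / ((i:ℝ) + 1)) * (q * m i)) ≤ ε / 2 * m i := by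
      have : N * ((1 / ((i:ℝ) + 1)) * (q * m i)) = (κ / (i + 1)) * m i := by rw [hκ]; field_simp
      rw [this]
      refine mul_le_mul_of_nonneg_right ?_ (Nat.cast_nonneg _)
      rw [div_le_iff₀ (by positivity)]
      linarith
    have e11 : emb (c i (m i)) - emb (c i 0) = (G^[m i] ((N:ℝ) • x i) - (N:ℝ) • x i) +
        (G^[m i] (z i) - G^[m i] ((N:ℝ) • x i)) - (G^[m i] (z i) - emb (c i (m i))) -
          (z i - (N:ℝ) • x i) + (z i - emb (c i 0)) := by ring
    have e12 : ‖emb (c i (m i)) - emb (c i 0)‖ ≤ N * (K1 + (1 / ((i:ℝ) + 1)) * n i) + 8 := by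
      rw [e11]
      refine (norm_add_le _ _).trans ?_
      refine (add_le_add_left ((norm_sub_le _ _).trans (add_le_add_left ((norm_sub_le _ _).trans
        (add_le_add_left (norm_add_le _ _) _)) _)) _).trans ?_
      linarith
    have e13 : N * (K1 + (1 / ((i:ℝ) + 1)) * n i) ≤ N * (K1 + ((1 / ((i:ℝ) + 1)) * (q * m i) + q)) :=
      mul_le_mul_of_nonneg_left (by linarith) hN.le
    have e14 : A ≤ ε / 2 * m i := by nlinarith
    rw [hA] at e14
    linarith
  · intro ε hε
    obtain ⟨K, hK⟩ := hull_near hM hwC (ε := ε / κ) (by positivity)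
    refine ⟨N * K + 6, fun i a b hab hb => ?_⟩
    obtain ⟨x', hx'⟩ : ∃ x' : ℂ, G^[a] (z i) = (N:ℝ) • x' := ⟨(N:ℝ)⁻¹ • G^[a] (z i), by
      rw [smul_smul, mul_inv_cancel₀ hN.ne', one_smul]⟩
    obtain ⟨d, rfl⟩ := Nat.exists_eq_add_of_le' hab
    obtain ⟨y, hy, hy'⟩ := hK (q * d) x'
    have hd : ((d + a : ℕ) : ℝ) - a = d := by push_cast; ring
    rw [hd]
    refine ⟨(d:ℝ) • (κ • (y - w)), Set.smul_mem_smul_set ⟨y, hy, rfl⟩, ?_⟩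
    have e3 := cell_emb_dist (ocell_subset _ (hzc i (d + a)))
    have e4 := cell_emb_dist (ocell_subset _ (hzc i a))
    have e5 : G^[d + a] (z i) - G^[a] (z i) - (d:ℝ) • (κ • (y - w)) =
        (N:ℝ) • (F^[q * d] x' - x' - ((q * d : ℕ) : ℝ) • y) := by
      rw [Function.iterate_add_apply, hx', hGd, hκ]
      push_cast
      simp only [Complex.real_smul]
      push_cast
      ring
    have e6 : ‖G^[d + a] (z i) - G^[a] (z i) - (d:ℝ) • (κ • (y - w))‖ ≤ ε * d + N * K := by
      rw [e5, norm_smul, Real.norm_of_nonneg hN.le]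
      refine (mul_le_mul_of_nonneg_left hy' hN.le).trans (le_of_eq ?_)
      rw [hκ]
      push_cast
      field_simp
    have e7 : emb (c i (d + a)) - emb (c i a) - (d:ℝ) • (κ • (y - w)) =
        (G^[d + a] (z i) - G^[a] (z i) - (d:ℝ) • (κ • (y - w))) - (G^[d + a] (z i) - emb (c i (d + a))) +
          (G^[a] (z i) - emb (c i a)) := by ring
    rw [e7]
    refine (norm_add_le _ _).trans ?_
    have := norm_sub_le (G^[d + a] (z i) - G^[a] (z i) - (d:ℝ) • (κ • (y - w))) (G^[d + a] (z i) - emb (c i (d + a)))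
    linarith

lemma main_C {F : ℂ ≃ₜ ℂ} (hF : Lift F) : ∃ C : Set ℂ, IsCompact C ∧ Convex ℝ C ∧
    (∀ (q : ℕ) (l : ℤ × ℤ) (x : ℂ), 0 < q → F^[q] x = x + emb l → (1 / (q:ℝ)) • emb l ∈ C) ∧
    (∀ (q : ℕ) (l : ℤ × ℤ), 0 < q → (∀ x, F^[q] x ≠ x + emb l) → (1 / (q:ℝ)) • emb l ∈ C →
      ∃ u v : ℂ, u ≠ v ∧ segment ℝ u v ⊆ frontier C ∧ (1 / (q:ℝ)) • emb l ∈ openSegment ℝ u v) := by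
  obtain ⟨M, hM0, hM⟩ := hF.bdd
  have hCv := convex_convexHull ℝ (rho F)
  refine ⟨convexHull ℝ (rho F), compact_hull (rho_compact hM), hCv,
    fun q l x hq hx => subset_convexHull ℝ _ (periodic_mem hF hq hx), ?_⟩
  intro q l hq hno hwC
  have hne := not_extreme hF hq hno
  obtain ⟨p, hp0, hp⟩ := support hF hq hno
  set w := (1 / (q:ℝ)) • emb l with hw
  set C := convexHull ℝ (rho F) with hC
  have : ∃ u ∈ C, ∃ v ∈ C, w ∈ openSegment ℝ u v ∧ u ≠ w := by
    by_contra hcon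
    push Not at hcon
    exact hne ⟨hwC, fun u hu v hv h => hcon u hu v hv h⟩
  obtain ⟨u, hu, v, hv, hwuv, huw⟩ := this
  have huv : u ≠ v := by
    rintro rfl
    rw [openSegment_same] at hwuv
    exact huw (Set.mem_singleton_iff.1 hwuv).symm
  refine ⟨u, v, huv, ?_, hwuv⟩
  intro z hz
  refine ⟨subset_closure (hCv.segment_subset hu hv hz), fun hzint => ?_⟩
  set L : ℂ →ₗ[ℝ] ℝ := p.1 • Complex.reLm + p.2 • Complex.imLm with hL
  have hLz : ∀ z, p.1 * z.re + p.2 * z.im = L z := by intro z; simp [hL]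
  have hLC : ∀ y ∈ C, L w ≤ L y := by
    intro y hy
    have := hp y hy
    rw [hLz, map_sub] at this
    linarith
  obtain ⟨a, b, ha, hb, hab, h⟩ := hwuv
  have h1 := hLC u hu
  have h2 := hLC v hv
  have h3 : a * L u + b * L v = L w := by
    rw [← h, map_add, map_smul, map_smul, smul_eq_mul, smul_eq_mul]
  have h4 : a * (L u - L w) + b * (L v - L w) = 0 := by
    have : (a + b) * L w = L w := by rw [hab, one_mul]
    linarith
  have h5 : L u = L w := by
    have := mul_nonneg ha.le (sub_nonneg.2 h1)
    have := mul_nonneg hb.le (sub_nonneg.2 h2)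
    have h6 : a * (L u - L w) = 0 := by linarith
    rcases mul_eq_zero.1 h6 with h7 | h7
    · linarith
    · linarith
  have h6 : L v = L w := by
    have := mul_nonneg ha.le (sub_nonneg.2 h1)
    have := mul_nonneg hb.le (sub_nonneg.2 h2)
    have h6 : b * (L v - L w) = 0 := by linarith
    rcases mul_eq_zero.1 h6 with h7 | h7
    · linarith
    · linarith
  have h7 : L z = L w := by
    obtain ⟨a', b', _, _, hab', rfl⟩ := hz
    rw [map_add, map_smul, map_smul, h5, h6, smul_eq_mul, smul_eq_mul, ← add_mul, hab', one_mul]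
  set d : ℂ := ⟨p.1, p.2⟩ with hd
  have hLd : 0 < L d := by
    rw [← hLz]
    simp only [hd]
    have : p.1 ≠ 0 ∨ p.2 ≠ 0 := by
      by_contra hcon
      push Not at hcon
      exact hp0 (Prod.ext hcon.1 hcon.2)
    rcases this with h | h
    · have := mul_self_pos.2 h
      nlinarith [mul_self_nonneg p.2]
    · have := mul_self_pos.2 h
      nlinarith [mul_self_nonneg p.1]
  have hcont : Tendsto (fun t : ℝ => z - t • d) (𝓝[>] 0) (𝓝 z) := by
    have : Continuous (fun t : ℝ => z - t • d) := by fun_prop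
    have h := this.tendsto 0
    simp only [zero_smul, sub_zero] at h
    exact h.mono_left nhdsWithin_le_nhds
  have hev := hcont.eventually (mem_interior_iff_mem_nhds.1 hzint)
  obtain ⟨t, ht1, ht2⟩ := (hev.and self_mem_nhdsWithin).exists
  have h8 := hLC _ ht1
  have h9 : L (z - t • d) = L w - t * L d := by rw [map_sub, L.map_smul t d, smul_eq_mul, h7]
  rw [h9] at h8
  have : 0 < t * L d := mul_pos ht2 hLd
  linarith

end FT

/-- For a homeomorphism of the torus isotopic to the identity (given by a lift `F`
commuting with integer translations), the set of rotation vectors of cycles is the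
intersection of `ℚ²` with a compact convex set, except perhaps some points from
interiors of segments contained in the boundary of that set. -/
theorem torus_rotation_vectors (F : (ℝ × ℝ) ≃ₜ (ℝ × ℝ))
    (hlift : ∀ (x : ℝ × ℝ) (m n : ℤ), F (x + ((m : ℝ), (n : ℝ))) = F x + ((m : ℝ), (n : ℝ))) :
    ∃ C : Set (ℝ × ℝ), IsCompact C ∧ Convex ℝ C ∧
      (∀ w ∈ torusRotSet F, ((w.1 : ℝ), (w.2 : ℝ)) ∈ C) ∧
      (∀ w : ℚ × ℚ, ((w.1 : ℝ), (w.2 : ℝ)) ∈ C → w ∉ torusRotSet F →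
        ∃ u v : ℝ × ℝ, u ≠ v ∧ segment ℝ u v ⊆ frontier C ∧
          ((w.1 : ℝ), (w.2 : ℝ)) ∈ openSegment ℝ u v) := by
  set e : ℂ ≃L[ℝ] ℝ × ℝ := Complex.equivRealProdCLM with he
  set H : ℂ ≃ₜ ℝ × ℝ := e.toHomeomorph with hH
  set Φ : ℂ ≃ₜ ℂ := (H.trans F).trans H.symm with hΦ
  have hemb : ∀ l : ℤ × ℤ, e (FT.emb l) = ((l.1 : ℝ), (l.2 : ℝ)) := by
    intro l; rfl
  have hΦe : ∀ z, e (Φ z) = F (e z) := by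
    intro z
    exact H.apply_symm_apply (F (H z))
  have hiter : ∀ (q : ℕ) z, e (Φ^[q] z) = F^[q] (e z) := by
    intro q z
    induction q generalizing z with
    | zero => rfl
    | succ q ih => rw [Function.iterate_succ_apply, Function.iterate_succ_apply, ih, hΦe]
  have hL : FT.Lift Φ := by
    intro z l
    apply e.injective
    rw [hΦe, map_add e, map_add e, hΦe, hemb, hlift]
  have hw : ∀ (q : ℕ) (l : ℤ × ℤ), e ((1 / (q:ℝ)) • FT.emb l) = ((l.1 : ℝ) / q, (l.2 : ℝ) / q) := by
    intro q l
    rw [map_smul, hemb]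
    apply Prod.ext
    · simp; ring
    · simp; ring
  obtain ⟨C, hCc, hCv, hR, hB⟩ := FT.main_C hL
  refine ⟨e '' C, hCc.image e.continuous, hCv.linear_image e.toLinearEquiv.toLinearMap, ?_, ?_⟩
  · rintro _ ⟨q, a, b, x, hq, hx, rfl⟩
    refine ⟨(1 / (q:ℝ)) • FT.emb (a, b), hR q (a, b) (e.symm x) hq ?_, ?_⟩
    · apply e.injective
      rw [hiter, map_add, hemb, e.apply_symm_apply, hx]
    · rw [hw]; push_cast; rfl
  · intro w hwC hwR
    set q : ℕ := w.1.den * w.2.den with hq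
    have hq0 : 0 < q := Nat.mul_pos w.1.den_pos w.2.den_pos
    set l : ℤ × ℤ := (w.1.num * w.2.den, w.2.num * w.1.den) with hl
    have d1 : (w.1.den : ℚ) ≠ 0 := by exact_mod_cast w.1.den_pos.ne'
    have d2 : (w.2.den : ℚ) ≠ 0 := by exact_mod_cast w.2.den_pos.ne'
    have w1 : w.1 = (l.1 : ℚ) / q := by
      rw [hl, hq]; push_cast
      rw [mul_div_mul_right _ _ d2, Rat.num_div_den]
    have w2 : w.2 = (l.2 : ℚ) / q := by
      rw [hl, hq]; push_cast
      rw [mul_comm (w.1.den : ℚ), mul_div_mul_right _ _ d1, Rat.num_div_den]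
    have hwe : ((w.1 : ℝ), (w.2 : ℝ)) = e ((1 / (q:ℝ)) • FT.emb l) := by
      rw [hw, w1, w2]; push_cast; rfl
    rw [hwe] at hwC ⊢
    have hwC' : (1 / (q:ℝ)) • FT.emb l ∈ C := by
      obtain ⟨y, hy, hye⟩ := hwC
      rwa [← e.injective hye]
    obtain ⟨u, v, huv, hseg, hmem⟩ := hB q l hq0 (fun x hx => hwR ⟨q, l.1, l.2, e x, hq0, by
      rw [← hiter, hx, map_add, hemb], Prod.ext w1 w2⟩) hwC'
    refine ⟨e u, e v, fun h => huv (e.injective h), ?_, ?_⟩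
    · have h1 := image_segment ℝ e.toLinearEquiv.toLinearMap.toAffineMap u v
      have h2 : e '' segment ℝ u v = segment ℝ (e u) (e v) := h1
      have h3 : e '' frontier C = frontier (e '' C) := H.image_frontier C
      rw [← h2, ← h3]
      exact Set.image_mono hseg
    · have h1 := image_openSegment ℝ e.toLinearEquiv.toLinearMap.toAffineMap u v
      have h2 : e '' openSegment ℝ u v = openSegment ℝ (e u) (e v) := h1
      rw [← h2]
      exact ⟨_, hmem, rfl⟩
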